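/- arXiv:2401.00925 — 2 statements merged into one kernel-verified Lean document; each statement's English description precedes it below -/
import Mathlib

section
/- Let (T,m,k) be a complete local reduced ring of prime characteristic p > 0 with dim T ≥ 2, with an approximately Gorenstein sequence {I_s} whose socle generators y_s ∈ T satisfy y_s^{p^e} ∉ I_s^{[p^e]} for all s and e, and suppose there exists a nonmaximal prime ideal p of T with M_{I_s,y_s} ⊆ p for all s. If in addition T is not equidimensional and depth T ≥ 2, then there exists a weakly F-regular local domain (A, m∩A) which is not catenary and whose (m∩A)-adic completion is isomorphic to T. -/
open IsLocalRing

/-- The `q`-th Frobenius power `I^{[q]}` of an ideal: the ideal generated by `q`-th powers of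
elements of `I`. -/
def Ideal.frobPow {R : Type*} [CommRing R] (I : Ideal R) (q : ℕ) : Ideal R :=
  Ideal.span ((fun r => r ^ q) '' (I : Set R))

/-- Membership in the tight closure `I*` of an ideal `I` in a ring of characteristic `p`:
there is a `c` outside every minimal prime with `c * x^{p^e} ∈ I^{[p^e]}` for all `e ≫ 0`. -/
def Ideal.MemTightClosure {R : Type*} [CommRing R] (p : ℕ) (I : Ideal R) (x : R) : Prop :=
  ∃ c : R, (∀ P ∈ minimalPrimes R, c ∉ P) ∧
    ∃ E : ℕ, ∀ e : ℕ, E ≤ e → c * x ^ p ^ e ∈ I.frobPow (p ^ e)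

/-- A ring of characteristic `p` is weakly F-regular if every ideal is tightly closed. -/
def WeaklyFRegular (R : Type*) [CommRing R] (p : ℕ) : Prop :=
  ∀ (I : Ideal R) (x : R), I.MemTightClosure p x → x ∈ I

/-- A ring is F-regular if all of its localizations are weakly F-regular. -/
def FRegular (R : Type*) [CommRing R] (p : ℕ) : Prop :=
  ∀ S : Submonoid R, WeaklyFRegular (Localization S) p

/-- A ring is catenary if any two saturated chains of primes with the same endpoints have
the same length. -/
def IsCatenaryRing (R : Type*) [CommRing R] : Prop :=
  ∀ (n m : ℕ) (f : Fin (n + 1) → PrimeSpectrum R) (g : Fin (m + 1) → PrimeSpectrum R),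
    f 0 = g 0 → f (Fin.last n) = g (Fin.last m) →
    (∀ i : Fin n, f i.castSucc ⋖ f i.succ) → (∀ i : Fin m, g i.castSucc ⋖ g i.succ) →
    n = m

/-- `y` generates the socle of `T/I`, i.e. `(I : m) = I + (y)` and `y ∉ I`. -/
def IsSocleGenerator {T : Type*} [CommRing T] [IsLocalRing T] (I : Ideal T) (y : T) : Prop :=
  y ∉ I ∧ I.colon (maximalIdeal T) = I ⊔ Ideal.span {y}

/-- An approximately Gorenstein sequence: a descending chain of `m`-primary ideals with
Gorenstein quotients, cofinal with the powers of `m`. -/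
def IsApproxGorensteinSeq (T : Type*) [CommRing T] [IsLocalRing T] (I : ℕ → Ideal T) : Prop :=
  Antitone I ∧ (∀ s, (I s).radical = maximalIdeal T) ∧
  (∀ s, ∃ y, IsSocleGenerator (I s) y) ∧
  ∀ N : ℕ, ∃ S : ℕ, ∀ s : ℕ, S ≤ s → I s ≤ maximalIdeal T ^ N

/-- The set `M_{I,y} = ⋃_{e ≥ 1} ⋂_{f ≥ e} (I^{[p^f]} : y^{p^f})`. -/
def MIy {T : Type*} [CommRing T] (p : ℕ) (I : Ideal T) (y : T) : Set T :=
  {c : T | ∃ e : ℕ, 1 ≤ e ∧ ∀ f : ℕ, e ≤ f → c * y ^ p ^ f ∈ I.frobPow (p ^ f)}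

/-- `depth T ≥ n`: there is a regular sequence of length `n` in the maximal ideal. -/
def DepthGE (T : Type*) [CommRing T] [IsLocalRing T] (n : ℕ) : Prop :=
  ∃ rs : List T, rs.length = n ∧ (∀ x ∈ rs, x ∈ maximalIdeal T) ∧
    RingTheory.Sequence.IsRegular T rs

/-- A Noetherian local ring is Cohen–Macaulay iff there is a regular sequence in the maximal
ideal of length equal to the Krull dimension. -/
def IsCohenMacaulayLocal (T : Type*) [CommRing T] [IsLocalRing T] : Prop :=
  ∃ rs : List T, (∀ x ∈ rs, x ∈ maximalIdeal T) ∧ RingTheory.Sequence.IsRegular T rs ∧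
    (rs.length : WithBot (WithTop ℕ)) = ringKrullDim T

/-- A parameter ideal: generated by `dim T` elements, with radical the maximal ideal. -/
def IsParameterIdeal (T : Type*) [CommRing T] [IsLocalRing T] (I : Ideal T) : Prop :=
  ∃ (n : ℕ) (x : Fin n → T), I = Ideal.span (Set.range x) ∧ I.radical = maximalIdeal T ∧
    (n : WithBot (WithTop ℕ)) = ringKrullDim T

/-- A Noetherian local ring is Gorenstein iff it is Cohen–Macaulay and every parameter ideal
is irreducible (has one-dimensional socle). -/
def IsGorensteinLocal (T : Type*) [CommRing T] [IsLocalRing T] : Prop :=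
  IsCohenMacaulayLocal T ∧ ∀ I : Ideal T, IsParameterIdeal T I → ∃ y, IsSocleGenerator I y

/-- A `p`-subring of a local ring `T`: a quasi-local subring `(R, R ∩ m)` which is small,
misses `p`, and misses every associated prime of `T`. -/
def IsPSubring (T : Type*) [CommRing T] [IsLocalRing T] (P : Ideal T) (R : Subring T) : Prop :=
  IsLocalRing R ∧ (Ideal.comap R.subtype (maximalIdeal T)).IsMaximal ∧
  (Cardinal.mk R ≤ max Cardinal.aleph0 (Cardinal.mk (ResidueField T)) ∧
    (Cardinal.mk R = max Cardinal.aleph0 (Cardinal.mk (ResidueField T)) →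
      Cardinal.mk (ResidueField T) ≤ Cardinal.aleph0)) ∧
  Ideal.comap R.subtype P = ⊥ ∧
  ∀ Q ∈ associatedPrimes T T, Ideal.comap R.subtype Q = ⊥

/-- An N-subring of a local ring `T`: a quasi-local UFD `(R, R ∩ m)` inside `T` which is small,
misses every associated prime of `T`, and such that `R ∩ J` has height at most one for every
`J ∈ Ass(T/tT)`, `t` a nonzerodivisor. -/
def IsNSubring (T : Type*) [CommRing T] [IsLocalRing T] (R : Subring T) : Prop :=
  IsLocalRing R ∧ (Ideal.comap R.subtype (maximalIdeal T)).IsMaximal ∧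
  (∃ _ : IsDomain R, UniqueFactorizationMonoid R) ∧
  (Cardinal.mk R ≤ max Cardinal.aleph0 (Cardinal.mk (ResidueField T)) ∧
    (Cardinal.mk R = max Cardinal.aleph0 (Cardinal.mk (ResidueField T)) →
      Cardinal.mk (ResidueField T) ≤ Cardinal.aleph0)) ∧
  (∀ Q ∈ associatedPrimes T T, Ideal.comap R.subtype Q = ⊥) ∧
  ∀ t ∈ nonZeroDivisors T, ∀ J ∈ associatedPrimes T (T ⧸ Ideal.span {t}),
    ∀ q0 q1 : Ideal R, q0.IsPrime → q1.IsPrime →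
      ¬(q0 < q1 ∧ q1 < Ideal.comap R.subtype J)

universe u

/-- Prime avoidance for a finite set of primes. -/
theorem exists_mem_forall_notMem_of_forall_not_le {T : Type*} [CommRing T] {C : Set (Ideal T)}
    (hfin : C.Finite) (hprime : ∀ P ∈ C, P.IsPrime) {J : Ideal T} (hJ : ∀ P ∈ C, ¬ J ≤ P) :
    ∃ z ∈ J, ∀ P ∈ C, z ∉ P := by
  by_contra! h
  obtain ⟨P, hP, hle⟩ := (J.subset_union_prime_finite hfin (f := id) 0 0
    fun P hP _ _ ↦ hprime P hP).1 (fun z hz ↦ by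
      obtain ⟨P, hP, hzP⟩ := h z hz
      exact Set.mem_biUnion hP hzP)
  exact hJ P hP hle

/-- Power series in `z` with coefficients among representatives of the residue field stay
distinct modulo every prime that does not contain `z`. -/
theorem exists_family_injective_mod_primes {T : Type*} [CommRing T] [IsLocalRing T]
    [IsAdicComplete (maximalIdeal T) T] {z : T} (hz : z ∈ maximalIdeal T) :
    ∃ φ : (ℕ → ResidueField T) → T, ∀ P : Ideal T, P.IsPrime → z ∉ P →
      ∀ e e', φ e - φ e' ∈ P → e = e' := by
  classical
  let ρ : ResidueField T → T := Function.surjInv residue_surjective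
  have hρ : ∀ x, residue T (ρ x) = x := Function.surjInv_eq residue_surjective
  let S : (ℕ → ResidueField T) → ℕ → T := fun e n ↦ ∑ i ∈ Finset.range n, ρ (e i) * z ^ i
  have hex : ∀ e, ∃ L : T, ∀ n, ∃ w ∈ maximalIdeal T ^ n, L = S e n + w := by
    intro e
    obtain ⟨L, hL⟩ := IsPrecomplete.prec (I := maximalIdeal T) (M := T) inferInstance (f := S e) (by
      intro m n hmn
      rw [SModEq.sub_mem]
      obtain ⟨k, rfl⟩ := Nat.exists_eq_add_of_le hmn
      simp only [S, Finset.sum_range_add, sub_add_cancel_left, smul_eq_mul, Ideal.mul_top]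
      refine neg_mem (sum_mem fun i _ ↦ ?_)
      rw [pow_add, mul_left_comm]
      exact Ideal.mul_mem_right _ _ (Ideal.pow_mem_pow hz m))
    refine ⟨L, fun n ↦ ⟨L - S e n, ?_, by ring⟩⟩
    have := (hL n).symm
    rw [SModEq.sub_mem] at this
    simpa using this
  choose φ hφ using hex
  have hrec : ∀ e, φ e = ρ (e 0) + z * φ (fun n ↦ e (n + 1)) := by
    intro e
    rw [← sub_eq_zero]
    refine IsHausdorff.haus (I := maximalIdeal T) (M := T) inferInstance _ fun n ↦ ?_
    rw [SModEq.zero, smul_eq_mul, Ideal.mul_top]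
    obtain ⟨w, hw, h⟩ := hφ e (n + 1)
    obtain ⟨w', hw', h'⟩ := hφ (fun n ↦ e (n + 1)) n
    have hS : S e (n + 1) = ρ (e 0) + z * S (fun n ↦ e (n + 1)) n := by
      simp only [S, Finset.sum_range_succ', Finset.mul_sum, pow_zero, mul_one]
      rw [add_comm]
      congr 1
      exact Finset.sum_congr rfl fun i _ ↦ by ring
    have : φ e - (ρ (e 0) + z * φ (fun n ↦ e (n + 1))) = w - z * w' := by
      rw [h, h', hS]; ring
    rw [this]
    exact sub_mem (Ideal.pow_le_pow_right n.le_succ hw) (Ideal.mul_mem_left _ _ hw')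
  refine ⟨φ, fun P hP hzP e e' h ↦ funext fun n ↦ ?_⟩
  induction n generalizing e e' with
  | zero =>
    have h0 := le_maximalIdeal hP.ne_top h
    rw [hrec e, hrec e', ← residue_eq_zero_iff] at h0
    have hz0 : residue T z = 0 := (residue_eq_zero_iff z).2 hz
    simpa [hρ, hz0, sub_eq_zero] using h0
  | succ n ih =>
    have h0 : e 0 = e' 0 := by
      have h0 := le_maximalIdeal hP.ne_top h
      rw [hrec e, hrec e', ← residue_eq_zero_iff] at h0
      have hz0 : residue T z = 0 := (residue_eq_zero_iff z).2 hz
      simpa [hρ, hz0, sub_eq_zero] using h0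
    rw [hrec e, hrec e', h0, add_sub_add_left_eq_sub, ← mul_sub] at h
    exact ih _ _ ((hP.mem_or_mem h).resolve_left hzP)

/-- In a complete local ring, an ideal `J` is not covered by few cosets of finitely many
nonmaximal primes not containing `J`. -/
theorem exists_mem_forall_mk_notMem {T : Type*} [CommRing T] [IsLocalRing T]
    [IsAdicComplete (maximalIdeal T) T] {C : Set (Ideal T)} (hfin : C.Finite)
    (hprime : ∀ P ∈ C, P.IsPrime) (hmax : ∀ P ∈ C, P ≠ maximalIdeal T)
    {J : Ideal T} (hJ : ∀ P ∈ C, ¬ J ≤ P) (B : ∀ P : Ideal T, Set (T ⧸ P))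
    (hB : ∀ P ∈ C, Cardinal.mk (B P) < Cardinal.mk (ℕ → ResidueField T)) :
    ∃ u ∈ J, ∀ P ∈ C, Ideal.Quotient.mk P u ∉ B P := by
  obtain ⟨w, hwJ, hw⟩ := exists_mem_forall_notMem_of_forall_not_le hfin hprime hJ
  obtain ⟨z, hz, hzC⟩ := exists_mem_forall_notMem_of_forall_not_le (J := maximalIdeal T)
    hfin hprime fun P hP h ↦ hmax P hP (le_antisymm (le_maximalIdeal (hprime P hP).ne_top) h)
  obtain ⟨φ, hφ⟩ := exists_family_injective_mod_primes hz
  by_contra! hcon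
  have hinf : Cardinal.aleph0 ≤ Cardinal.mk (ℕ → ResidueField T) := by
    rw [← Cardinal.infinite_iff]; infer_instance
  have hcover : (Set.univ : Set (ℕ → ResidueField T)) ⊆
      ⋃ P ∈ C, {e | Ideal.Quotient.mk P (w * φ e) ∈ B P} := by
    intro e _
    obtain ⟨P, hP, h⟩ := hcon (w * φ e) (Ideal.mul_mem_right _ _ hwJ)
    exact Set.mem_biUnion hP h
  have hlt : ∀ P ∈ C, Cardinal.mk {e | Ideal.Quotient.mk P (w * φ e) ∈ B P} <
      Cardinal.mk (ℕ → ResidueField T) := by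
    intro P hP
    have := hprime P hP
    refine lt_of_le_of_lt (Cardinal.mk_le_of_injective
      (f := fun e : {e | Ideal.Quotient.mk P (w * φ e) ∈ B P} ↦ (⟨_, e.2⟩ : B P)) ?_) (hB P hP)
    rintro ⟨e, he⟩ ⟨e', he'⟩ h
    rw [Subtype.mk.injEq, Ideal.Quotient.eq, ← mul_sub] at h
    exact Subtype.ext (hφ P this (hzC P hP) e e' ((this.mem_or_mem h).resolve_left (hw P hP)))
  have hfinU : ∀ C' : Set (Ideal T), C'.Finite → C' ⊆ C →
      Cardinal.mk (⋃ P ∈ C', {e | Ideal.Quotient.mk P (w * φ e) ∈ B P} :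
        Set (ℕ → ResidueField T)) < Cardinal.mk (ℕ → ResidueField T) := by
    intro C' hC'
    induction C', hC' using Set.Finite.induction_on with
    | empty => intro _; simpa using lt_of_lt_of_le Cardinal.aleph0_pos hinf
    | insert _ _ ih =>
      intro hsub
      rw [Set.biUnion_insert]
      exact (Cardinal.mk_union_le _ _).trans_lt (Cardinal.add_lt_of_lt hinf
        (hlt _ (hsub (Set.mem_insert _ _))) (ih ((Set.subset_insert _ _).trans hsub)))
  have := Cardinal.mk_le_mk_of_subset hcover
  rw [Cardinal.mk_univ] at this
  exact absurd (hfinU C hfin subset_rfl) this.not_gt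

/-- Every element of the subring `R` lying in some member of `C` vanishes. -/
def Subring.MeetsTrivially {T : Type*} [CommRing T] (R : Subring T) (C : Set (Ideal T)) : Prop :=
  ∀ P ∈ C, ∀ x ∈ R, x ∈ P → x = 0

theorem aleph0_lt_mk_nat_to_residueField (T : Type*) [CommRing T] [IsLocalRing T] :
    Cardinal.aleph0 < Cardinal.mk (ℕ → ResidueField T) := by
  have h2 : (2 : Cardinal) ≤ Cardinal.mk (ResidueField T) := by
    rw [Cardinal.two_le_iff]
    exact ⟨0, 1, zero_ne_one⟩
  calc Cardinal.aleph0 < 2 ^ Cardinal.aleph0 := Cardinal.cantor _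
    _ ≤ Cardinal.mk (ResidueField T) ^ Cardinal.aleph0 := Cardinal.power_le_power_right h2
    _ = Cardinal.mk (ℕ → ResidueField T) := by simp

/-- A small subring meeting `C` trivially can be enlarged by a generic element of `t + J`. -/
theorem Subring.MeetsTrivially.exists_adjoin {T : Type*} [CommRing T] [IsLocalRing T]
    [IsAdicComplete (maximalIdeal T) T] {C : Set (Ideal T)} (hfin : C.Finite)
    (hprime : ∀ P ∈ C, P.IsPrime) (hmax : ∀ P ∈ C, P ≠ maximalIdeal T)
    {R : Subring T} (hR : R.MeetsTrivially C)
    (hcard : Cardinal.mk R < Cardinal.mk (ℕ → ResidueField T))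
    (t : T) {J : Ideal T} (hJ : ∀ P ∈ C, ¬ J ≤ P) :
    ∃ u ∈ J, ∃ R' : Subring T, R ≤ R' ∧ R'.MeetsTrivially C ∧ t + u ∈ R' ∧
      Cardinal.mk R' ≤ max (Cardinal.mk R) Cardinal.aleph0 := by
  have hμ : max (Cardinal.mk R) Cardinal.aleph0 < Cardinal.mk (ℕ → ResidueField T) :=
    max_lt hcard (aleph0_lt_mk_nat_to_residueField T)
  have hinj : ∀ P ∈ C, Function.Injective ((Ideal.Quotient.mk P).comp R.subtype) := by
    intro P hP
    rw [injective_iff_map_eq_zero]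
    intro x hx
    exact Subtype.ext (hR P hP x x.2 (Ideal.Quotient.eq_zero_iff_mem.1 hx))
  let B : ∀ P : Ideal T, Set (T ⧸ P) := fun P ↦ ⋃ g : {g : Polynomial R // g ≠ 0},
    {b | (g.1.map ((Ideal.Quotient.mk P).comp R.subtype)).IsRoot (Ideal.Quotient.mk P t + b)}
  have hB : ∀ P ∈ C, Cardinal.mk (B P) < Cardinal.mk (ℕ → ResidueField T) := by
    intro P hP
    have := hprime P hP
    refine lt_of_le_of_lt (Cardinal.mk_iUnion_le _) (lt_of_le_of_lt (Cardinal.mul_le_max _ _) ?_)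
    refine max_lt (max_lt ?_ ?_) (aleph0_lt_mk_nat_to_residueField T)
    · exact (Cardinal.mk_subtype_le _).trans_lt (Polynomial.cardinalMk_le_max.trans_lt hμ)
    · refine lt_of_le_of_lt (ciSup_le' fun g ↦ ?_) (aleph0_lt_mk_nat_to_residueField T)
      have hg : g.1.map ((Ideal.Quotient.mk P).comp R.subtype) ≠ 0 :=
        (Polynomial.map_ne_zero_iff (hinj P hP)).2 g.2
      refine (Set.Finite.lt_aleph0 ?_).le
      exact (Polynomial.finite_setOfPred_isRoot hg).preimage ((add_right_injective _).injOn)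
  obtain ⟨u, huJ, hu⟩ := exists_mem_forall_mk_notMem hfin hprime hmax hJ B hB
  refine ⟨u, huJ, (Polynomial.eval₂RingHom R.subtype (t + u)).range, ?_, ?_, ?_, ?_⟩
  · intro x hx
    exact ⟨Polynomial.C ⟨x, hx⟩, by simp⟩
  · rintro P hP _ ⟨g, rfl⟩ hg
    by_contra h0
    refine hu P hP (Set.mem_iUnion.2 ⟨⟨g, fun hg0 ↦ h0 (by rw [hg0, map_zero])⟩, ?_⟩)
    rw [Set.mem_ofPred_eq, Polynomial.IsRoot.def, Polynomial.eval_map, ← map_add,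
      ← Polynomial.hom_eval₂]
    exact Ideal.Quotient.eq_zero_iff_mem.2 hg
  · exact ⟨Polynomial.X, by simp⟩
  · exact (Cardinal.mk_le_of_surjective
      (Polynomial.eval₂RingHom R.subtype (t + u)).rangeRestrict_surjective).trans
        Polynomial.cardinalMk_le_max


/-- A subring meeting `C` trivially can be enlarged by all quotients of its elements that exist
in the ambient ring. -/
theorem Subring.MeetsTrivially.exists_saturated {T : Type*} [CommRing T] {C : Set (Ideal T)}
    (hnzd : ∀ x : T, (∀ P ∈ C, x ∉ P) → x ∈ nonZeroDivisors T)
    {R : Subring T} (hR : R.MeetsTrivially C) :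
    ∃ R' : Subring T, R ≤ R' ∧ R'.MeetsTrivially C ∧
      Cardinal.mk R' ≤ max (Cardinal.mk R) Cardinal.aleph0 ∧
      ∀ t, ∀ a ∈ R, a ≠ 0 → a * t ∈ R → t ∈ R' := by
  have hreg : ∀ a ∈ R, a ≠ 0 → a ∈ nonZeroDivisors T := fun a ha h0 ↦
    hnzd a fun P hP haP ↦ h0 (hR P hP a ha haP)
  have hmul : ∀ a ∈ R, a ≠ 0 → ∀ x, a * x = 0 → x = 0 := fun a ha h0 x hx ↦
    (hreg a ha h0).1 x hx
  by_cases hnt : (1 : T) = 0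
  · have : Subsingleton T := subsingleton_of_zero_eq_one hnt.symm
    exact ⟨R, le_rfl, hR, le_max_left _ _, fun t a ha h0 _ ↦ (h0 (Subsingleton.elim _ _)).elim⟩
  let R' : Subring T :=
    { carrier := {t | ∃ a ∈ R, a ≠ 0 ∧ a * t ∈ R}
      mul_mem' := by
        rintro s t ⟨a, ha, ha0, hs⟩ ⟨b, hb, hb0, ht⟩
        refine ⟨a * b, R.mul_mem ha hb, fun h ↦ hb0 (hmul a ha ha0 b h), ?_⟩
        rw [mul_mul_mul_comm]
        exact R.mul_mem hs ht
      one_mem' := ⟨1, R.one_mem, hnt, by simp⟩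
      add_mem' := by
        rintro s t ⟨a, ha, ha0, hs⟩ ⟨b, hb, hb0, ht⟩
        refine ⟨a * b, R.mul_mem ha hb, fun h ↦ hb0 (hmul a ha ha0 b h), ?_⟩
        rw [show a * b * (s + t) = b * (a * s) + a * (b * t) by ring]
        exact R.add_mem (R.mul_mem hb hs) (R.mul_mem ha ht)
      zero_mem' := ⟨1, R.one_mem, hnt, by simp [R.zero_mem]⟩
      neg_mem' := by
        rintro t ⟨a, ha, ha0, ht⟩
        exact ⟨a, ha, ha0, by simpa using ht⟩ }
  refine ⟨R', fun x hx ↦ ⟨1, R.one_mem, hnt, by simpa using hx⟩, ?_, ?_,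
    fun t a ha h0 h ↦ ⟨a, ha, h0, h⟩⟩
  · rintro P hP t ⟨a, ha, ha0, ht⟩ htP
    exact hmul a ha ha0 t (hR P hP _ ht (P.mul_mem_left a htP))
  · choose a ha ha0 hat using fun t : R' ↦ t.2
    refine le_trans (Cardinal.mk_le_of_injective
      (f := fun t : R' ↦ ((⟨a t, ha t⟩, ⟨a t * t, hat t⟩) : R × R)) ?_) ?_
    · intro s t h
      simp only [Prod.mk.injEq, Subtype.mk.injEq] at h
      obtain ⟨h1, h2⟩ := h
      rw [h1, ← sub_eq_zero, ← mul_sub] at h2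
      exact Subtype.ext (sub_eq_zero.1 (hmul _ (ha t) (ha0 t) _ h2))
    · rw [Cardinal.mk_prod, Cardinal.lift_id]
      exact (Cardinal.mul_le_max _ _).trans (by simp)

/-- If `c ∈ R` is a combination of elements of `R` with coefficients in the ambient ring, then
after a small enlargement of `R` the coefficients can be taken in the subring. -/
theorem Subring.MeetsTrivially.exists_mem_span {T : Type*} [CommRing T] [IsLocalRing T]
    [IsAdicComplete (maximalIdeal T) T] {C : Set (Ideal T)} (hfin : C.Finite)
    (hprime : ∀ P ∈ C, P.IsPrime) (hmax : ∀ P ∈ C, P ≠ maximalIdeal T)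
    (hnzd : ∀ x : T, (∀ P ∈ C, x ∉ P) → x ∈ nonZeroDivisors T) (n : ℕ) :
    ∀ (l : List T) (R : Subring T), l.length = n → R.MeetsTrivially C →
      Cardinal.mk R < Cardinal.mk (ℕ → ResidueField T) →
      (∀ x ∈ l, x ∈ R) → ∀ c ∈ R, c ∈ Ideal.span {x | x ∈ l} →
      ∃ R' : Subring T, R ≤ R' ∧ R'.MeetsTrivially C ∧
        Cardinal.mk R' ≤ max (Cardinal.mk R) Cardinal.aleph0 ∧
        c ∈ Submodule.span R' {x | x ∈ l} := by
  induction n with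
  | zero =>
    intro l R hl hR _ _ c hc hcl
    rw [List.length_eq_zero_iff] at hl
    subst hl
    refine ⟨R, le_rfl, hR, le_max_left _ _, ?_⟩
    have : c = 0 := by simpa using hcl
    rw [this]
    exact zero_mem _
  | succ n ih =>
    intro l R hl hR hcard hlR c hc hcl
    have hcons : ∀ (a : T) (l : List T), {x | x ∈ a :: l} = insert a {x | x ∈ l} := by
      intro a l; ext; simp
    match l, hl with
    | [a], _ =>
      have hsing : {x : T | x ∈ [a]} = {a} := by ext; simp
      rw [hsing, Ideal.mem_span_singleton'] at hcl
      obtain ⟨t, rfl⟩ := hcl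
      have haR : a ∈ R := hlR a (by simp)
      by_cases ha : a = 0
      · refine ⟨R, le_rfl, hR, le_max_left _ _, ?_⟩
        simp [ha]
      obtain ⟨R', hle, hR', hcard', hsat⟩ := hR.exists_saturated hnzd
      refine ⟨R', hle, hR', hcard', ?_⟩
      rw [hsing, Submodule.mem_span_singleton]
      exact ⟨⟨t, hsat t a haR ha (by rwa [mul_comm])⟩, rfl⟩
    | a :: b :: l, hl =>
      have haR : a ∈ R := hlR a (by simp)
      have hbR : b ∈ R := hlR b (by simp)
      by_cases hb : b = 0
      · subst hb
        obtain ⟨R', hle, hR', hcard', hmem⟩ := ih (a :: l) R (by simpa using hl) hR hcard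
          (fun x hx ↦ hlR x (by simp at hx ⊢; tauto)) c hc (by
            rw [hcons, hcons, Set.insert_comm, Ideal.span_insert_zero] at hcl
            rwa [hcons])
        refine ⟨R', hle, hR', hcard', Submodule.span_mono ?_ hmem⟩
        intro x hx
        simp at hx ⊢
        tauto
      rw [hcons, Ideal.mem_span_insert] at hcl
      obtain ⟨t, w, hw, rfl⟩ := hcl
      rw [hcons, Ideal.mem_span_insert] at hw
      obtain ⟨t', w', hw', rfl⟩ := hw
      obtain ⟨u, hu, R₁, hle₁, hR₁, hmem₁, hcard₁⟩ := hR.exists_adjoin hfin hprime hmax hcard t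
        (J := Ideal.span {b}) fun P hP h ↦ hb (hR P hP b hbR (h (Ideal.mem_span_singleton_self b)))
      obtain ⟨v, rfl⟩ := Ideal.mem_span_singleton'.1 hu
      obtain ⟨R', hle, hR', hcard', hmem⟩ := ih (b :: l) R₁ (by simpa using hl) hR₁
        (hcard₁.trans_lt (max_lt hcard (aleph0_lt_mk_nat_to_residueField T)))
        (fun x hx ↦ hle₁ (hlR x (List.mem_cons_of_mem _ hx)))
        (t * a + (t' * b + w') - (t + v * b) * a)
        (sub_mem (hle₁ hc) (mul_mem hmem₁ (hle₁ haR))) (by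
          rw [hcons, Ideal.mem_span_insert]
          exact ⟨t' - v * a, w', hw', by ring⟩)
      refine ⟨R', hle₁.trans hle, hR', hcard'.trans (max_le hcard₁ (le_max_right _ _)), ?_⟩
      rw [hcons, Submodule.mem_span_insert]
      refine ⟨⟨t + v * b, hle hmem₁⟩, _, hmem, ?_⟩
      rw [Subring.smul_def]
      simp only [smul_eq_mul]
      ring

theorem Subring.MeetsTrivially.iSup {T ι : Type*} [CommRing T] [Nonempty ι] {C : Set (Ideal T)}
    {F : ι → Subring T} (hdir : Directed (· ≤ ·) F) (hF : ∀ i, (F i).MeetsTrivially C) :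
    (⨆ i, F i).MeetsTrivially C := by
  intro P hP x hx hxP
  obtain ⟨i, hi⟩ := (Subring.mem_iSup_of_directed hdir).1 hx
  exact hF i P hP x hi hxP

theorem Subring.mk_iSup_le_of_directed {T ι : Type u} [CommRing T] [Nonempty ι]
    {F : ι → Subring T} (hdir : Directed (· ≤ ·) F) {μ : Cardinal.{u}}
    (hμ : Cardinal.aleph0 ≤ μ) (hι : Cardinal.mk ι ≤ μ) (hF : ∀ i, Cardinal.mk (F i) ≤ μ) :
    Cardinal.mk (⨆ i, F i : Subring T) ≤ μ := by
  have h : Cardinal.mk (⨆ i, F i : Subring T) = Cardinal.mk (⋃ i, (F i : Set T)) := by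
    rw [← Subring.coe_iSup_of_directed hdir]; rfl
  rw [h]
  refine (Cardinal.mk_iUnion_le _).trans ?_
  exact (mul_le_mul' hι (ciSup_le' hF)).trans (Cardinal.mul_eq_self hμ).le

/-- Transfinite iteration of a one-step enlargement of small subrings meeting `C` trivially. -/
theorem Subring.MeetsTrivially.exists_chain {T X : Type u} [CommRing T] {C : Set (Ideal T)}
    [LinearOrder X] [WellFoundedLT X] {κ : Cardinal.{u}} (hκ : Cardinal.aleph0 < κ)
    (hX : ∀ x : X, Cardinal.mk (Set.Iio x) < κ)
    {R₀ : Subring T} (hR₀ : R₀.MeetsTrivially C) (hcard₀ : Cardinal.mk R₀ < κ)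
    (Φ : X → Subring T → Subring T → Prop)
    (hstep : ∀ x (R : Subring T), R.MeetsTrivially C → Cardinal.mk R < κ →
      ∃ R' : Subring T, R ≤ R' ∧ R'.MeetsTrivially C ∧
        Cardinal.mk R' ≤ max (Cardinal.mk R) Cardinal.aleph0 ∧ Φ x R R') :
    ∃ F : X → Subring T, Monotone F ∧ ∀ x, R₀ ≤ F x ∧ (F x).MeetsTrivially C ∧
      Cardinal.mk (F x) ≤
        max (max (Cardinal.mk R₀) Cardinal.aleph0) (Cardinal.mk (Set.Iio x)) ∧
      ∃ U : Subring T, R₀ ≤ U ∧ (∀ y < x, F y ≤ U) ∧ Φ x U (F x) := by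
  classical
  choose! step hle hgood hcard hΦ using hstep
  let next : X → Subring T → Subring T := fun x R ↦
    if R.MeetsTrivially C ∧ Cardinal.mk R < κ then step x R else R
  have hnext : ∀ x R, R ≤ next x R := by
    intro x R
    by_cases h : R.MeetsTrivially C ∧ Cardinal.mk R < κ
    · simpa only [next, if_pos h] using hle x R h.1 h.2
    · simp only [next, if_neg h, le_refl]
  let below : ∀ x : X, ((y : X) → y < x → Subring T) → Option (Set.Iio x) → Subring T :=
    fun x G o ↦ o.elim R₀ fun y ↦ G y.1 y.2
  let F : X → Subring T := (wellFounded_lt (α := X)).fix fun x G ↦ next x (⨆ o, below x G o)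
  let U : X → Subring T := fun x ↦ ⨆ o, below x (fun y _ ↦ F y) o
  have hF : ∀ x, F x = next x (U x) := fun x ↦ (wellFounded_lt (α := X)).fix_eq _ x
  have hU : ∀ x, ∀ y < x, F y ≤ U x := fun x y hy ↦
    le_iSup (below x fun y _ ↦ F y) (some ⟨y, hy⟩)
  have hR₀U : ∀ x, R₀ ≤ U x := fun x ↦ le_iSup (below x fun y _ ↦ F y) none
  have hUF : ∀ x, U x ≤ F x := fun x ↦ (hF x).symm ▸ hnext x (U x)
  have hmono : Monotone F := by
    intro y x hyx
    obtain rfl | h := hyx.eq_or_lt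
    · exact le_rfl
    · exact (hU x y h).trans (hUF x)
  have hdir : ∀ x, Directed (· ≤ ·) (below x fun y _ ↦ F y) := by
    intro x
    rintro (_ | y) (_ | z)
    · exact ⟨none, le_rfl, le_rfl⟩
    · exact ⟨some z, (hR₀U z).trans (hUF z), le_rfl⟩
    · exact ⟨some y, le_rfl, (hR₀U y).trans (hUF y)⟩
    · exact ⟨some (max y z), hmono (le_max_left y z), hmono (le_max_right y z)⟩
  have main : ∀ x, (U x).MeetsTrivially C ∧ Cardinal.mk (U x) ≤
        max (max (Cardinal.mk R₀) Cardinal.aleph0) (Cardinal.mk (Set.Iio x)) ∧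
      (F x).MeetsTrivially C ∧ Cardinal.mk (F x) ≤
        max (max (Cardinal.mk R₀) Cardinal.aleph0) (Cardinal.mk (Set.Iio x)) ∧
      Φ x (U x) (F x) := by
    intro x
    induction x using WellFoundedLT.induction with
    | ind x ih =>
      have h1 : (U x).MeetsTrivially C := by
        refine Subring.MeetsTrivially.iSup (hdir x) ?_
        rintro (_ | y)
        · exact hR₀
        · exact (ih y y.2).2.2.1
      have h2 : Cardinal.mk (U x) ≤
          max (max (Cardinal.mk R₀) Cardinal.aleph0) (Cardinal.mk (Set.Iio x)) := by
        have hinf : Cardinal.aleph0 ≤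
            max (max (Cardinal.mk R₀) Cardinal.aleph0) (Cardinal.mk (Set.Iio x)) :=
          (le_max_right _ _).trans (le_max_left _ _)
        refine Subring.mk_iSup_le_of_directed (hdir x) hinf ?_ ?_
        · rw [Cardinal.mk_option]
          exact Cardinal.add_le_of_le hinf (le_max_right _ _)
            (Cardinal.one_le_aleph0.trans hinf)
        · rintro (_ | y)
          · exact (le_max_left _ _).trans (le_max_left _ _)
          · refine (ih y y.2).2.2.2.1.trans (max_le_max le_rfl ?_)
            exact Cardinal.mk_le_mk_of_subset (Set.Iio_subset_Iio y.2.le)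
      have h3 : Cardinal.mk (U x) < κ :=
        h2.trans_lt (max_lt (max_lt hcard₀ hκ) (hX x))
      have hFx : F x = step x (U x) := by
        rw [hF]
        exact if_pos ⟨h1, h3⟩
      rw [hFx]
      exact ⟨h1, h2, hgood x _ h1 h3, (hcard x _ h1 h3).trans (max_le h2
        ((le_max_right _ _).trans (le_max_left _ _))), hΦ x _ h1 h3⟩
  exact ⟨F, hmono, fun x ↦ ⟨(hR₀U x).trans (hUF x), (main x).2.2.1, (main x).2.2.2.1,
    U x, hR₀U x, hU x, (main x).2.2.2.2⟩⟩

theorem Submodule.span_subring_mono {T : Type*} [CommRing T] {R R' : Subring T} (h : R ≤ R')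
    {s : Set T} {c : T} (hc : c ∈ Submodule.span R s) : c ∈ Submodule.span R' s := by
  induction hc using Submodule.span_induction with
  | mem x hx => exact Submodule.subset_span hx
  | zero => exact zero_mem _
  | add x y _ _ hx hy => exact add_mem hx hy
  | smul a x _ hx => exact Submodule.smul_mem _ (⟨a, h a.2⟩ : R') hx

/-- Simultaneous version of `Subring.MeetsTrivially.exists_mem_span`. -/
theorem Subring.MeetsTrivially.exists_forall_mem_span {T : Type u} [CommRing T] [IsLocalRing T]
    [IsAdicComplete (maximalIdeal T) T] {C : Set (Ideal T)} (hfin : C.Finite)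
    (hprime : ∀ P ∈ C, P.IsPrime) (hmax : ∀ P ∈ C, P ≠ maximalIdeal T)
    (hnzd : ∀ x : T, (∀ P ∈ C, x ∉ P) → x ∈ nonZeroDivisors T)
    {R : Subring T} (hR : R.MeetsTrivially C)
    (hcard : Cardinal.mk R < Cardinal.mk (ℕ → ResidueField T)) :
    ∃ R' : Subring T, R ≤ R' ∧ R'.MeetsTrivially C ∧
      Cardinal.mk R' ≤ max (Cardinal.mk R) Cardinal.aleph0 ∧
      ∀ l : List T, (∀ x ∈ l, x ∈ R) → ∀ c ∈ R, c ∈ Ideal.span {x | x ∈ l} →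
        c ∈ Submodule.span R' {x | x ∈ l} := by
  obtain ⟨_, _⟩ := exists_wellFoundedLT (List R × R)
  have hμ : max (Cardinal.mk R) Cardinal.aleph0 < Cardinal.mk (ℕ → ResidueField T) :=
    max_lt hcard (aleph0_lt_mk_nat_to_residueField T)
  have hX : Cardinal.mk (List R × R) ≤ max (Cardinal.mk R) Cardinal.aleph0 := by
    rw [Cardinal.mk_prod, Cardinal.lift_id, Cardinal.lift_id]
    refine (Cardinal.mul_le_max _ _).trans (max_le (max_le ?_ (le_max_left _ _)) (le_max_right _ _))
    rw [max_comm]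
    exact Cardinal.mk_list_le_max R
  obtain ⟨F, hmono, hF⟩ := hR.exists_chain (X := List R × R)
    (aleph0_lt_mk_nat_to_residueField T)
    (fun x ↦ (Cardinal.mk_set_le _).trans_lt (hX.trans_lt hμ)) hcard
    (fun x U R' ↦ R ≤ U → x.2.1 ∈ Ideal.span {z | z ∈ x.1.map R.subtype} →
      x.2.1 ∈ Submodule.span R' {z | z ∈ x.1.map R.subtype})
    (by
      intro x U hU hUcard
      by_cases h : R ≤ U ∧ x.2.1 ∈ Ideal.span {z | z ∈ x.1.map R.subtype}
      · obtain ⟨R', h1, h2, h3, h4⟩ := Subring.MeetsTrivially.exists_mem_span hfin hprime hmax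
          hnzd _ _ U rfl hU hUcard (fun z hz ↦ by
            obtain ⟨r, -, rfl⟩ := List.mem_map.1 hz
            exact h.1 r.2) _ (h.1 x.2.2) h.2
        exact ⟨R', h1, h2, h3, fun _ _ ↦ h4⟩
      · exact ⟨U, le_rfl, hU, le_max_left _ _, fun h1 h2 ↦ (h ⟨h1, h2⟩).elim⟩)
  have hdir : Directed (· ≤ ·) F := hmono.directed_le
  refine ⟨⨆ x, F x, (hF ([], 0)).1.trans (le_iSup F _),
    Subring.MeetsTrivially.iSup hdir fun x ↦ (hF x).2.1, ?_, ?_⟩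
  · refine Subring.mk_iSup_le_of_directed hdir (le_max_right _ _) hX fun x ↦ ?_
    exact (hF x).2.2.1.trans (max_le le_rfl ((Cardinal.mk_set_le _).trans hX))
  · intro l hl c hc hcl
    lift l to List R using hl
    obtain ⟨-, -, -, U, hRU, -, hΦ⟩ := hF (l, ⟨c, hc⟩)
    exact Submodule.span_subring_mono (le_iSup F _) (hΦ hRU hcl)

/-- A small subring meeting `C` trivially can be enlarged by generic perturbations of finitely
many elements. -/
theorem Subring.MeetsTrivially.exists_adjoin_finset {T : Type*} [CommRing T] [IsLocalRing T]
    [IsAdicComplete (maximalIdeal T) T] {C : Set (Ideal T)} (hfin : C.Finite)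
    (hprime : ∀ P ∈ C, P.IsPrime) (hmax : ∀ P ∈ C, P ≠ maximalIdeal T)
    {R : Subring T} (hR : R.MeetsTrivially C)
    (hcard : Cardinal.mk R < Cardinal.mk (ℕ → ResidueField T))
    {J : Ideal T} (hJ : ∀ P ∈ C, ¬ J ≤ P) (s : Finset T) :
    ∃ R' : Subring T, R ≤ R' ∧ R'.MeetsTrivially C ∧
      Cardinal.mk R' ≤ max (Cardinal.mk R) Cardinal.aleph0 ∧ ∀ g ∈ s, ∃ u ∈ J, g + u ∈ R' := by
  classical
  induction s using Finset.induction_on with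
  | empty => exact ⟨R, le_rfl, hR, le_max_left _ _, by simp⟩
  | insert g s _ ih =>
    obtain ⟨R₁, hle, hR₁, hcard₁, hs⟩ := ih
    obtain ⟨u, hu, R', hle', hR', hmem, hcard'⟩ := hR₁.exists_adjoin hfin hprime hmax
      (hcard₁.trans_lt (max_lt hcard (aleph0_lt_mk_nat_to_residueField T))) g hJ
    refine ⟨R', hle.trans hle', hR', hcard'.trans (max_le hcard₁ (le_max_right _ _)), ?_⟩
    intro x hx
    rcases Finset.mem_insert.1 hx with rfl | hx
    · exact ⟨u, hu, hmem⟩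
    · obtain ⟨v, hv, hv'⟩ := hs x hx
      exact ⟨v, hv, hle' hv'⟩

/-- A small subring meeting `C` trivially can be enlarged so as to contain generators of a given
ideal not contained in any member of `C`. -/
theorem Subring.MeetsTrivially.exists_generators {T : Type*} [CommRing T] [IsLocalRing T]
    [IsNoetherianRing T]
    [IsAdicComplete (maximalIdeal T) T] {C : Set (Ideal T)} (hfin : C.Finite)
    (hprime : ∀ P ∈ C, P.IsPrime) (hmax : ∀ P ∈ C, P ≠ maximalIdeal T)
    {R : Subring T} (hR : R.MeetsTrivially C)
    (hcard : Cardinal.mk R < Cardinal.mk (ℕ → ResidueField T))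
    {Q : Ideal T} (hQ : ∀ P ∈ C, ¬ Q ≤ P) :
    ∃ R' : Subring T, R ≤ R' ∧ R'.MeetsTrivially C ∧
      Cardinal.mk R' ≤ max (Cardinal.mk R) Cardinal.aleph0 ∧
      Q ≤ Ideal.span {x | x ∈ Q ∧ x ∈ R'} := by
  have hmQ : ∀ P ∈ C, ¬ maximalIdeal T * Q ≤ P := by
    intro P hP h
    rcases (hprime P hP).mul_le.1 h with h | h
    · exact hmax P hP (le_antisymm (le_maximalIdeal (hprime P hP).ne_top) h)
    · exact hQ P hP h
  obtain ⟨s, hs⟩ := IsNoetherian.noetherian Q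
  obtain ⟨R', hle, hR', hcard', hgen⟩ := hR.exists_adjoin_finset hfin hprime hmax hcard hmQ s
  refine ⟨R', hle, hR', hcard', ?_⟩
  have hmul : maximalIdeal T * Q ≤ Q := Ideal.mul_le_right
  have hsup : Q ≤ Ideal.span {x | x ∈ Q ∧ x ∈ R'} ⊔ maximalIdeal T * Q := by
    have h : Ideal.span (s : Set T) ≤
        Ideal.span {x | x ∈ Q ∧ x ∈ R'} ⊔ maximalIdeal T * Q := by
      refine Ideal.span_le.2 fun g hg ↦ ?_
      obtain ⟨u, hu, hmem⟩ := hgen g hg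
      have hgQ : g ∈ Q := hs ▸ Submodule.subset_span hg
      have hguQ : g + u ∈ Q := Q.add_mem hgQ (hmul hu)
      have hg' : g = (g + u) - u := by ring
      rw [SetLike.mem_coe, hg']
      exact Ideal.sub_mem _ (Ideal.mem_sup_left (Ideal.subset_span ⟨hguQ, hmem⟩))
        (Ideal.mem_sup_right hu)
    calc Q = Ideal.span (s : Set T) := hs.symm
      _ ≤ _ := h
  exact Submodule.le_of_le_smul_of_le_jacobson_bot (I := maximalIdeal T) ⟨s, hs⟩
    (maximalIdeal_le_jacobson _) hsup

/-- A subring meeting finitely many nonmaximal primes trivially, containing generators of the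
maximal ideal and of `Q`, surjecting onto the residue field, and all of whose finitely generated
ideals are contracted from the complete ring. -/
theorem exists_subring_contracted {T : Type u} [CommRing T] [IsLocalRing T] [IsNoetherianRing T]
    [IsAdicComplete (maximalIdeal T) T] {C : Set (Ideal T)} (hfin : C.Finite)
    (hprime : ∀ P ∈ C, P.IsPrime) (hmax : ∀ P ∈ C, P ≠ maximalIdeal T)
    (hnzd : ∀ x : T, (∀ P ∈ C, x ∉ P) → x ∈ nonZeroDivisors T)
    {R : Subring T} (hR : R.MeetsTrivially C)
    (hcard : Cardinal.mk R < Cardinal.mk (ℕ → ResidueField T))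
    {Q : Ideal T} (hQ : ∀ P ∈ C, ¬ Q ≤ P) :
    ∃ A : Subring T, A.MeetsTrivially C ∧
      maximalIdeal T ≤ Ideal.span {x | x ∈ maximalIdeal T ∧ x ∈ A} ∧
      Q ≤ Ideal.span {x | x ∈ Q ∧ x ∈ A} ∧
      (∀ t : T, ∃ a ∈ A, t - a ∈ maximalIdeal T) ∧
      ∀ l : List T, (∀ x ∈ l, x ∈ A) → ∀ c ∈ A, c ∈ Ideal.span {x | x ∈ l} →
        c ∈ Submodule.span A {x | x ∈ l} := by
  have hκ := aleph0_lt_mk_nat_to_residueField T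
  have hm : ∀ P ∈ C, ¬ maximalIdeal T ≤ P := fun P hP h ↦
    hmax P hP (le_antisymm (le_maximalIdeal (hprime P hP).ne_top) h)
  obtain ⟨R₁, -, hR₁, hcard₁, hgen₁⟩ := hR.exists_generators hfin hprime hmax hcard hm
  replace hcard₁ := hcard₁.trans_lt (max_lt hcard hκ)
  obtain ⟨R₂, hle₂, hR₂, hcard₂, hgen₂⟩ := hR₁.exists_generators hfin hprime hmax hcard₁ hQ
  replace hcard₂ := hcard₂.trans_lt (max_lt hcard₁ hκ)
  let ν : Cardinal.{u} := max (Cardinal.mk (ResidueField T)) Cardinal.aleph0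
  have hν : Cardinal.aleph0 ≤ ν := le_max_right _ _
  have hνκ : ν ≤ Cardinal.mk (ℕ → ResidueField T) :=
    max_le (Cardinal.mk_le_of_injective (f := fun x _ ↦ x) fun x y h ↦ congrFun h 0) hκ.le
  have : NoMaxOrder ν.ord.ToType := Cardinal.noMaxOrder hν
  have hIio : ∀ x : ν.ord.ToType, Cardinal.mk (Set.Iio x) < ν := fun x ↦ by
    simpa using Cardinal.mk_Iio_lt x (by simp)
  have hne : Nonempty ν.ord.ToType := by
    rw [← Cardinal.mk_ne_zero_iff, Cardinal.mk_ord_toType]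
    exact (Cardinal.aleph0_pos.trans_le hν).ne'
  obtain ⟨f, hf⟩ : ∃ f : ν.ord.ToType → ResidueField T, Function.Surjective f := by
    have : Cardinal.mk (ResidueField T) ≤ Cardinal.mk ν.ord.ToType := by
      rw [Cardinal.mk_ord_toType]; exact le_max_left _ _
    obtain ⟨g⟩ := this
    exact ⟨Function.invFun g, Function.invFun_surjective g.injective⟩
  obtain ⟨F, hmono, hF⟩ := hR₂.exists_chain (X := ν.ord.ToType) hκ
    (fun x ↦ (hIio x).trans_le hνκ) hcard₂
    (fun x U R' ↦ (∃ r ∈ R', residue T r = f x) ∧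
      ∀ l : List T, (∀ z ∈ l, z ∈ U) → ∀ c ∈ U, c ∈ Ideal.span {z | z ∈ l} →
        c ∈ Submodule.span R' {z | z ∈ l})
    (by
      intro x U hU hUcard
      obtain ⟨t, ht⟩ := residue_surjective (f x)
      obtain ⟨u, hu, V, hUV, hV, hmem, hVcard⟩ :=
        hU.exists_adjoin hfin hprime hmax hUcard t hm
      obtain ⟨R', hVR', hR', hR'card, hspan⟩ := hV.exists_forall_mem_span hfin hprime hmax hnzd
        (hVcard.trans_lt (max_lt hUcard hκ))
      refine ⟨R', hUV.trans hVR', hR', hR'card.trans (max_le hVcard (le_max_right _ _)),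
        ⟨t + u, hVR' hmem, ?_⟩, fun l hl c hc ↦ hspan l (fun z hz ↦ hUV (hl z hz)) c (hUV hc)⟩
      rw [map_add, ht, (residue_eq_zero_iff u).2 hu, add_zero])
  have hdir : Directed (· ≤ ·) F := hmono.directed_le
  have hR₂A : R₂ ≤ ⨆ x, F x := (hF hne.some).1.trans (le_iSup F _)
  refine ⟨⨆ x, F x, Subring.MeetsTrivially.iSup hdir fun x ↦ (hF x).2.1, ?_, ?_, ?_, ?_⟩
  · exact hgen₁.trans (Ideal.span_mono fun x hx ↦ ⟨hx.1, hR₂A (hle₂ hx.2)⟩)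
  · exact hgen₂.trans (Ideal.span_mono fun x hx ↦ ⟨hx.1, hR₂A hx.2⟩)
  · intro t
    obtain ⟨x, hx⟩ := hf (residue T t)
    obtain ⟨-, -, -, U, -, -, ⟨r, hr, hrx⟩, -⟩ := hF x
    refine ⟨r, le_iSup F x hr, ?_⟩
    rw [← residue_eq_zero_iff, map_sub, hrx, hx, sub_self]
  · intro l hl c hc hcl
    have hl' : ∃ x, ∀ z ∈ c :: l, z ∈ F x := by
      have : ∀ z ∈ c :: l, z ∈ ⨆ x, F x := by
        simpa using ⟨hc, hl⟩
      generalize c :: l = l' at this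
      induction l' with
      | nil => exact ⟨hne.some, by simp⟩
      | cons z l' ih =>
        obtain ⟨x, hx⟩ := ih fun w hw ↦ this w (List.mem_cons_of_mem _ hw)
        obtain ⟨y, hy⟩ := (Subring.mem_iSup_of_directed hdir).1 (this z List.mem_cons_self)
        refine ⟨max x y, fun w hw ↦ ?_⟩
        rcases List.mem_cons.1 hw with rfl | hw
        · exact hmono (le_max_right x y) hy
        · exact hmono (le_max_left x y) (hx w hw)
    obtain ⟨y, hy⟩ := hl'
    obtain ⟨x, hyx⟩ := exists_gt y
    obtain ⟨-, -, -, U, -, hU, -, hspan⟩ := hF x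
    exact Submodule.span_subring_mono (le_iSup F x) (hspan l
      (fun z hz ↦ hU y hyx (hy z (List.mem_cons_of_mem _ hz))) c
      (hU y hyx (hy c List.mem_cons_self)) hcl)

/-- If finitely generated ideals of a subring `A` of a Noetherian ring are contracted, then every
ideal of `A` is contracted and finitely generated. -/
theorem Subring.comap_map_eq_and_fg {T : Type*} [CommRing T] [IsNoetherianRing T] {A : Subring T}
    (hA : ∀ l : List T, (∀ x ∈ l, x ∈ A) → ∀ c ∈ A, c ∈ Ideal.span {x | x ∈ l} →
      c ∈ Submodule.span A {x | x ∈ l}) (I : Ideal A) :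
    (I.map A.subtype).comap A.subtype = I ∧ I.FG := by
  obtain ⟨s, hsI, hs⟩ := Submodule.fg_span_iff_fg_span_finset_subset _ |>.1
    (IsNoetherian.noetherian (I.map A.subtype))
  let I' : Ideal A := Ideal.span {a | (a : T) ∈ s}
  have hI'I : I' ≤ I := by
    refine Ideal.span_le.2 fun a ha ↦ ?_
    obtain ⟨b, hb, hab⟩ := hsI ha
    rwa [← Subtype.ext (show (b : T) = a from hab)]
  have hfg : I'.FG :=
    Submodule.fg_span (s.finite_toSet.preimage Subtype.val_injective.injOn)
  have hle : (I.map A.subtype).comap A.subtype ≤ I' := by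
    intro c hc
    have hc' : (c : T) ∈ Ideal.span {x | x ∈ s.toList} := by
      have : {x | x ∈ s.toList} = (s : Set T) := by ext; simp
      have hc' : (c : T) ∈ Submodule.span T (A.subtype '' I) := hc
      rwa [hs, ← this] at hc'
    have hmem := hA s.toList (fun x hx ↦ by
      obtain ⟨b, -, hb⟩ := hsI (Finset.mem_toList.1 hx)
      exact hb ▸ b.2) c c.2 hc'
    have hsub : Submodule.span A {x | x ∈ s.toList} ≤
        Submodule.map (Algebra.linearMap A T) I' := by
      refine Submodule.span_le.2 fun x hx ↦ ?_
      have hx' : x ∈ s := Finset.mem_toList.1 hx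
      obtain ⟨b, -, hb⟩ := hsI hx'
      exact ⟨b, Ideal.subset_span (show (b : T) ∈ s from (show (b : T) = x from hb) ▸ hx'), hb⟩
    obtain ⟨d, hd, hdc⟩ := hsub hmem
    rwa [← Subtype.ext (show (d : T) = c from hdc)]
  have heq : I' = I := le_antisymm hI'I (Ideal.le_comap_map.trans hle)
  exact ⟨le_antisymm (hle.trans hI'I) Ideal.le_comap_map, heq ▸ hfg⟩

/-- A subring of a local ring with contracted ideals is local, its maximal ideal being the
contraction of the maximal ideal. -/
theorem Subring.isLocalRing_of_contracted {T : Type*} [CommRing T] [IsLocalRing T]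
    {A : Subring T} (hA : ∀ I : Ideal A, (I.map A.subtype).comap A.subtype = I) :
    ∃ _ : IsLocalRing A, maximalIdeal A = (maximalIdeal T).comap A.subtype := by
  have hunit : ∀ a : A, IsUnit (a : T) → IsUnit a := by
    intro a ha
    rw [← Ideal.span_singleton_eq_top, ← hA (Ideal.span {a}), Ideal.map_span,
      Set.image_singleton]
    rw [show Ideal.span {A.subtype a} = ⊤ from Ideal.span_singleton_eq_top.2 ha, Ideal.comap_top]
  have : IsLocalHom A.subtype := ⟨hunit⟩
  have hloc : IsLocalRing A := A.subtype.domain_isLocalRing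
  refine ⟨hloc, ?_⟩
  ext a
  rw [mem_maximalIdeal, mem_nonunits_iff, Ideal.mem_comap, mem_maximalIdeal, mem_nonunits_iff]
  exact not_congr ⟨fun h ↦ h.map A.subtype, hunit a⟩

section Completion

variable {T : Type*} [CommRing T] [IsLocalRing T] {A : Subring T}

/-- If `A` surjects onto the residue field and contains generators of the maximal ideal, then `A`
is dense in the adic topology. -/
theorem Subring.exists_sub_mem_maximalIdeal_pow
    (hm : ((maximalIdeal T).comap A.subtype).map A.subtype = maximalIdeal T)
    (hres : ∀ t : T, ∃ a ∈ A, t - a ∈ maximalIdeal T) (n : ℕ) (t : T) :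
    ∃ a : A, t - a ∈ maximalIdeal T ^ n := by
  induction n generalizing t with
  | zero => exact ⟨0, by simp⟩
  | succ n ih =>
    have hpow : ((maximalIdeal T).comap A.subtype ^ n).map A.subtype = maximalIdeal T ^ n := by
      rw [Ideal.map_pow, hm]
    have key : ∀ w ∈ maximalIdeal T ^ n, ∃ a : A, A.subtype a ∈ maximalIdeal T ^ n ∧
        w - a ∈ maximalIdeal T ^ (n + 1) := by
      intro w hw
      rw [← hpow] at hw
      refine Submodule.span_induction (p := fun (w : T) _ ↦ ∃ a : A,
        A.subtype a ∈ maximalIdeal T ^ n ∧ w - a ∈ maximalIdeal T ^ (n + 1)) ?_ ⟨0, by simp⟩ ?_ ?_ hw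
      · rintro _ ⟨a, ha, rfl⟩
        exact ⟨a, hpow.le (Ideal.mem_map_of_mem A.subtype ha), by simp⟩
      · rintro x y - - ⟨a, ha, hxa⟩ ⟨b, hb, hyb⟩
        refine ⟨a + b, by rw [map_add]; exact add_mem ha hb, ?_⟩
        rw [Subring.coe_add, add_sub_add_comm]
        exact add_mem hxa hyb
      · rintro r x - ⟨a, ha, hxa⟩
        obtain ⟨b, hbA, hb⟩ := hres r
        refine ⟨⟨b, hbA⟩ * a, by rw [map_mul]; exact Ideal.mul_mem_left _ _ ha, ?_⟩
        have : r • x - ((⟨b, hbA⟩ * a : A) : T) = r * (x - a) + a * (r - b) := by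
          simp only [smul_eq_mul, Subring.coe_mul]; ring
        rw [this]
        exact add_mem (Ideal.mul_mem_left _ r hxa) (pow_succ (maximalIdeal T) n ▸
          Ideal.mul_mem_mul ha hb)
    obtain ⟨a, ha⟩ := ih t
    obtain ⟨b, -, hb⟩ := key _ ha
    exact ⟨a + b, by rwa [Subring.coe_add, ← sub_sub]⟩

/-- A dense subring with contracted ideals has the ambient complete ring as completion. -/
theorem Subring.exists_adicCompletion_algEquiv [IsAdicComplete (maximalIdeal T) T]
    (hA : ∀ I : Ideal A, (I.map A.subtype).comap A.subtype = I)
    (hm : ((maximalIdeal T).comap A.subtype).map A.subtype = maximalIdeal T)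
    (hres : ∀ t : T, ∃ a ∈ A, t - a ∈ maximalIdeal T) :
    Nonempty (AdicCompletion ((maximalIdeal T).comap A.subtype) A ≃ₐ[A] T) := by
  set n := (maximalIdeal T).comap A.subtype with hn
  have hpow (k : ℕ) (a : A) : (a : T) ∈ maximalIdeal T ^ k ↔ a ∈ n ^ k := by
    rw [← hA (n ^ k), Ideal.map_pow, hm]
    rfl
  have hker (k : ℕ) (a : A) (ha : a ∈ n ^ k) :
      ((Ideal.Quotient.mkₐ A (maximalIdeal T ^ k)).comp (Algebra.ofId A T)) a = 0 :=
    Ideal.Quotient.eq_zero_iff_mem.2 ((hpow k a).2 ha)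
  let g (k : ℕ) : A ⧸ n ^ k →ₐ[A] T ⧸ maximalIdeal T ^ k := Ideal.Quotient.liftₐ (n ^ k) _ (hker k)
  have hg (k : ℕ) (a : A) : g k (Ideal.Quotient.mk _ a) = Ideal.Quotient.mk _ (a : T) := rfl
  have hginj (k : ℕ) (x : A ⧸ n ^ k) (hx : g k x = 0) : x = 0 := by
    obtain ⟨a, rfl⟩ := Ideal.Quotient.mk_surjective x
    rw [hg, Ideal.Quotient.eq_zero_iff_mem, hpow] at hx
    exact Ideal.Quotient.eq_zero_iff_mem.2 hx
  have hcompat {i j : ℕ} (hle : i ≤ j) :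
      (Ideal.Quotient.factorₐ A (Ideal.pow_le_pow_right hle)).comp
        ((g j).comp (AdicCompletion.evalₐ n j)) = (g i).comp (AdicCompletion.evalₐ n i) := by
    ext x
    obtain ⟨x, rfl⟩ := AdicCompletion.mk_surjective n A x
    simp only [AlgHom.comp_apply, AdicCompletion.evalₐ_mk, hg]
    have := AdicCompletion.Ideal.mk_eq_mk (I := n) hle x
    have h2 := congrArg (g i) this
    rw [hg, hg] at h2
    exact h2
  let F := IsAdicComplete.liftAlgHom (maximalIdeal T)
    (fun k ↦ (g k).comp (AdicCompletion.evalₐ n k)) hcompat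
  have hF (k : ℕ) (x) : Ideal.Quotient.mk (maximalIdeal T ^ k) (F x) =
      g k (AdicCompletion.evalₐ n k x) :=
    IsAdicComplete.mk_liftAlgHom (maximalIdeal T) _ hcompat k x
  refine ⟨AlgEquiv.ofBijective F ⟨(injective_iff_map_eq_zero F).2 fun x hx ↦ ?_, fun t ↦ ?_⟩⟩
  · refine AdicCompletion.ext_evalₐ fun k ↦ ?_
    rw [map_zero]
    refine hginj k _ ?_
    rw [← hF, hx, map_zero]
  · choose a ha using fun k ↦ Subring.exists_sub_mem_maximalIdeal_pow hm hres k t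
    let x := AdicCompletion.AdicCauchySequence.mk n A a fun k ↦ by
      rw [SModEq.sub_mem, smul_eq_mul, Ideal.mul_top, ← hpow]
      have : ((a k - a (k + 1) : A) : T) = (t - a (k + 1)) - (t - a k) := by
        push_cast; ring
      rw [this]
      exact sub_mem (Ideal.pow_le_pow_right k.le_succ (ha (k + 1))) (ha k)
    refine ⟨AdicCompletion.mk n A x, ?_⟩
    rw [← sub_eq_zero]
    refine IsHausdorff.haus (I := maximalIdeal T) inferInstance _ fun k ↦ ?_
    rw [SModEq.zero, smul_eq_mul, Ideal.mul_top, ← Ideal.Quotient.eq_zero_iff_mem, map_sub, hF,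
      AdicCompletion.evalₐ_mk, hg, ← map_sub, Ideal.Quotient.eq_zero_iff_mem]
    rw [← neg_sub]
    exact neg_mem (ha k)

end Completion

section Socle

variable {T : Type*} [CommRing T] [IsLocalRing T]

/-- An element outside an ideal containing a power of the maximal ideal has a multiple which is a
nonzero socle element of the quotient. -/
theorem exists_mul_notMem_and_forall_mul_mem {J : Ideal T} {N : ℕ} (hN : maximalIdeal T ^ N ≤ J)
    {w : T} (hw : w ∉ J) : ∃ r : T, r * w ∉ J ∧ ∀ m ∈ maximalIdeal T, m * (r * w) ∈ J := by
  classical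
  have hex : ∃ k, ∀ r ∈ maximalIdeal T ^ k, r * w ∈ J :=
    ⟨N, fun r hr ↦ Ideal.mul_mem_right _ _ (hN hr)⟩
  obtain ⟨k, hk⟩ := Nat.exists_eq_succ_of_ne_zero (n := Nat.find hex) fun h0 ↦ hw <| by
    have := Nat.find_spec hex
    rw [h0] at this
    simpa using this 1 (by simp)
  have hmin := Nat.find_min hex (m := k) (by omega)
  push Not at hmin
  obtain ⟨r, hr, hrw⟩ := hmin
  refine ⟨r, hrw, fun m hm ↦ ?_⟩
  rw [← mul_assoc]
  refine Nat.find_spec hex _ ?_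
  rw [hk, Nat.succ_eq_add_one, pow_succ']
  exact Ideal.mul_mem_mul hm hr

theorem IsSocleGenerator.mul_mem {I : Ideal T} {y : T} (hy : IsSocleGenerator I y) {m : T}
    (hm : m ∈ maximalIdeal T) : m * y ∈ I := by
  have hmem : y ∈ I.colon (maximalIdeal T) :=
    hy.2 ▸ Ideal.mem_sup_right (Ideal.mem_span_singleton_self y)
  simpa [mul_comm] using Submodule.mem_colon.1 hmem m hm

variable [IsNoetherianRing T]

/-- Double annihilator property: modulo an `m`-primary ideal with simple socle, every ideal is
the annihilator of its annihilator. -/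
theorem IsSocleGenerator.mem_of_forall_mul_mem {I : Ideal T} {y : T} (hy : IsSocleGenerator I y)
    {N : ℕ} (hN : maximalIdeal T ^ N ≤ I) {K : Ideal T} (hIK : I ≤ K) {z : T}
    (hz : ∀ l : T, (∀ k ∈ K, l * k ∈ I) → l * z ∈ I) : z ∈ K := by
  have hsoc (w : T) (hw : ∀ m ∈ maximalIdeal T, m * w ∈ I) : ∃ r : T, w - r * y ∈ I := by
    have : w ∈ I.colon (maximalIdeal T) := Submodule.mem_colon.2 fun m hm ↦ by
      rw [smul_eq_mul, mul_comm]; exact hw m hm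
    rw [hy.2, Submodule.mem_sup] at this
    obtain ⟨i, hi, s, hs, rfl⟩ := this
    obtain ⟨r, rfl⟩ := Ideal.mem_span_singleton'.1 hs
    exact ⟨r, by simpa using hi⟩
  let D : Set (Ideal T) := {K' | (I ≤ K' ∧ K' ≤ K) ∧
    ∀ z : T, (∀ l : T, (∀ k ∈ K', l * k ∈ I) → l * z ∈ I) → z ∈ K'}
  have hID : I ∈ D := ⟨⟨le_rfl, hIK⟩, fun z hz ↦ by
    simpa using hz 1 fun k hk ↦ by simpa using hk⟩
  obtain ⟨K', ⟨⟨hIK', hK'K⟩, hK'⟩, hmax⟩ := set_has_maximal_iff_noetherian.2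
    (inferInstanceAs (IsNoetherian T T)) D ⟨I, hID⟩
  suffices h : K ≤ K' by rw [le_antisymm h hK'K] at hz; exact h.antisymm hK'K ▸ hK' z hz
  by_contra hKK'
  obtain ⟨x₀, hx₀K, hx₀⟩ := SetLike.not_le_iff_exists.1 hKK'
  obtain ⟨r₀, hx, hmx⟩ := exists_mul_notMem_and_forall_mul_mem (hN.trans hIK') hx₀
  set x := r₀ * x₀ with hxdef
  have hxK : x ∈ K := Ideal.mul_mem_left _ _ hx₀K
  refine hmax (K' ⊔ Ideal.span {x}) ⟨⟨hIK'.trans le_sup_left, sup_le hK'K <| by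
    rwa [Ideal.span_singleton_le_iff_mem]⟩, fun z hz ↦ ?_⟩ (lt_of_le_of_ne le_sup_left
      fun h ↦ hx (h ▸ Ideal.mem_sup_right (Ideal.mem_span_singleton_self x)))
  have hann (l : T) (hl : ∀ k ∈ K', l * k ∈ I) (hlx : l * x ∈ I) : l * z ∈ I := by
    refine hz l fun k hk ↦ ?_
    obtain ⟨k', hk', s, hs, rfl⟩ := Submodule.mem_sup.1 hk
    obtain ⟨r, rfl⟩ := Ideal.mem_span_singleton'.1 hs
    rw [mul_add, mul_left_comm]
    exact add_mem (hl k' hk') (Ideal.mul_mem_left _ _ hlx)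
  have hsocx (b : T) (hb : ∀ k ∈ K', b * k ∈ I) : ∃ r : T, b * x - r * y ∈ I :=
    hsoc _ fun m hm ↦ by rw [mul_left_comm]; exact hb _ (hmx m hm)
  have hex : ∃ a : T, (∀ k ∈ K', a * k ∈ I) ∧ a * x - y ∈ I := by
    obtain ⟨b, hb, hbx⟩ : ∃ b : T, (∀ k ∈ K', b * k ∈ I) ∧ b * x ∉ I := by
      by_contra! h
      exact hx (hK' x h)
    obtain ⟨r, hr⟩ := hsocx b hb
    have hru : IsUnit r := by
      by_contra hru
      refine hbx ?_
      simpa using add_mem hr (hy.mul_mem ((mem_maximalIdeal r).2 hru))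
    obtain ⟨u, rfl⟩ := hru
    refine ⟨↑u⁻¹ * b, fun k hk ↦ ?_, ?_⟩
    · rw [mul_assoc]; exact Ideal.mul_mem_left _ _ (hb k hk)
    · have := Ideal.mul_mem_left I (↑u⁻¹ : T) hr
      rwa [mul_sub, ← mul_assoc, Units.inv_mul_cancel_left] at this
  obtain ⟨a, ha, hax⟩ := hex
  obtain ⟨r, hr⟩ := hsoc (a * z) fun m hm ↦ by
    rw [← mul_assoc]
    refine hann _ (fun k hk ↦ by rw [mul_assoc]; exact Ideal.mul_mem_left _ _ (ha k hk)) ?_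
    have : m * a * x = m * (a * x - y) + m * y := by ring
    rw [this]
    exact add_mem (Ideal.mul_mem_left _ _ hax) (hy.mul_mem hm)
  have hzr : z - r * x ∈ K' := by
    refine hK' _ fun b hb ↦ ?_
    obtain ⟨s, hs⟩ := hsocx b hb
    have h1 : (b - s * a) * z ∈ I := by
      refine hann _ (fun k hk ↦ ?_) ?_
      · rw [sub_mul, mul_assoc]
        exact sub_mem (hb k hk) (Ideal.mul_mem_left _ _ (ha k hk))
      · have : (b - s * a) * x = (b * x - s * y) - s * (a * x - y) := by ring
        rw [this]
        exact sub_mem hs (Ideal.mul_mem_left _ _ hax)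
    have : b * (z - r * x) = (b - s * a) * z + s * (a * z - r * y) - r * (b * x - s * y) := by
      ring
    rw [this]
    exact sub_mem (add_mem h1 (Ideal.mul_mem_left _ _ hr)) (Ideal.mul_mem_left _ _ hs)
  have : z = (z - r * x) + r * x := by ring
  rw [this]
  exact add_mem (Ideal.mem_sup_left hzr)
    (Ideal.mem_sup_right (Ideal.mem_span_singleton'.2 ⟨r, rfl⟩))

/-- An element outside an ideal `K` can be multiplied onto the socle generator modulo `I` by an
element multiplying `K` into `I`. -/
theorem IsSocleGenerator.exists_mul_sub_mem {I : Ideal T} {y : T} (hy : IsSocleGenerator I y)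
    {N : ℕ} (hN : maximalIdeal T ^ N ≤ I) {K : Ideal T} (hIK : I ≤ K) {x : T} (hx : x ∉ K) :
    ∃ l : T, (∀ k ∈ K, l * k ∈ I) ∧ l * x - y ∈ I := by
  obtain ⟨l, hl, hlx⟩ : ∃ l : T, (∀ k ∈ K, l * k ∈ I) ∧ l * x ∉ I := by
    by_contra! h
    exact hx (hy.mem_of_forall_mul_mem hN hIK h)
  obtain ⟨r, hr, hmr⟩ := exists_mul_notMem_and_forall_mul_mem hN hlx
  have hy' : y ∈ I ⊔ Ideal.span {r * (l * x)} := by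
    refine hy.mem_of_forall_mul_mem hN le_sup_left fun b hb ↦ ?_
    have hbm : b ∈ maximalIdeal T := by
      rw [mem_maximalIdeal, mem_nonunits_iff]
      rintro ⟨u, rfl⟩
      refine hr ?_
      have := Ideal.mul_mem_left I (↑u⁻¹ : T) (hb (r * (l * x))
        (Ideal.mem_sup_right (Ideal.mem_span_singleton_self _)))
      rwa [Units.inv_mul_cancel_left] at this
    exact hy.mul_mem hbm
  obtain ⟨i, hi, s, hs, hsum⟩ := Submodule.mem_sup.1 hy'
  obtain ⟨t, rfl⟩ := Ideal.mem_span_singleton'.1 hs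
  refine ⟨t * (r * l), fun k hk ↦ ?_, ?_⟩
  · rw [mul_assoc, mul_assoc]
    exact Ideal.mul_mem_left _ _ (Ideal.mul_mem_left _ _ (hl k hk))
  · have : t * (r * l) * x - y = -i := by rw [← hsum]; ring
    rw [this]
    exact neg_mem hi

end Socle

/-- A domain `A` in `T` with contracted ideals which meets trivially a prime containing all the
sets `MIy` of an approximately Gorenstein sequence of `T` is weakly F-regular. -/
theorem Subring.weaklyFRegular_of_forall_MIy_subset {T : Type*} [CommRing T] [IsLocalRing T]
    [IsNoetherianRing T] {p : ℕ} [Fact p.Prime] [CharP T p]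
    {I : ℕ → Ideal T} (hI : IsApproxGorensteinSeq T I) {y : ℕ → T}
    (hy : ∀ s, IsSocleGenerator (I s) (y s)) {P : Ideal T}
    (hP : ∀ s, MIy p (I s) (y s) ⊆ (P : Set T)) {A : Subring T} [IsDomain A]
    (hA : ∀ J : Ideal A, (J.map A.subtype).comap A.subtype = J)
    (hAP : ∀ x ∈ A, x ∈ P → x = 0) : WeaklyFRegular A p := by
  rintro J x ⟨c, hc, E, hE⟩
  have hc0 : c ≠ 0 := by
    rintro rfl
    exact hc ⊥ (by simp [IsDomain.minimalPrimes_eq_singleton_bot]) (by simp)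
  rw [← hA J, Ideal.mem_comap]
  by_contra hx
  obtain ⟨N, hN⟩ : ∃ N, A.subtype x ∉ J.map A.subtype ⊔ maximalIdeal T ^ N := by
    by_contra! h
    refine hx ?_
    have hhaus : IsHausdorff (maximalIdeal T) (T ⧸ J.map A.subtype) :=
      .of_isLocalRing _ _ (Ideal.IsPrime.ne_top inferInstance)
    rw [← Ideal.Quotient.eq_zero_iff_mem]
    refine hhaus.haus _ fun k ↦ ?_
    obtain ⟨a, ha, b, hb, hab⟩ := Submodule.mem_sup.1 (h k)
    rw [SModEq.zero, ← hab, map_add, Ideal.Quotient.eq_zero_iff_mem.2 ha, zero_add,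
      ← mul_one b, map_mul]
    exact Submodule.smul_mem_smul hb (Submodule.mem_top (x := (1 : T ⧸ J.map A.subtype)))
  obtain ⟨S, hS⟩ := hI.2.2.2 N
  obtain ⟨M, hM⟩ : ∃ M, maximalIdeal T ^ M ≤ I S := by
    rw [← hI.2.1 S]
    exact Ideal.exists_radical_pow_le_of_fg _ (IsNoetherian.noetherian _)
  obtain ⟨l, hl, hlx⟩ := (hy S).exists_mul_sub_mem hM
    (K := J.map A.subtype ⊔ I S) le_sup_right
    (fun h ↦ hN (sup_le_sup_left (hS S le_rfl) _ h))
  have hfrob (q : ℕ) (z : A) (hz : z ∈ J.frobPow q) : l ^ q * (z : T) ∈ (I S).frobPow q := by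
    refine Submodule.span_induction (p := fun (z : A) _ ↦ l ^ q * (z : T) ∈ (I S).frobPow q)
      ?_ (by simp) ?_ ?_ hz
    · rintro _ ⟨a, ha, rfl⟩
      refine Ideal.subset_span ⟨l * a, hl _ (Ideal.mem_sup_left (Ideal.mem_map_of_mem _ ha)), ?_⟩
      simp [mul_pow]
    · intro a b _ _ ha hb
      rw [Subring.coe_add, mul_add]
      exact add_mem ha hb
    · intro a b _ hb
      rw [smul_eq_mul, Subring.coe_mul, mul_left_comm]
      exact Ideal.mul_mem_left _ _ hb
  refine hc0 (Subtype.ext (hAP c c.2 (hP S ⟨max E 1, le_max_right _ _, fun f hf ↦ ?_⟩)))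
  have h1 := hfrob _ _ (hE f ((le_max_left _ _).trans hf))
  have h2 : y S ^ p ^ f = (l * x) ^ p ^ f - (l * x - y S) ^ p ^ f := by
    rw [← sub_pow_char_pow, sub_sub_cancel]
  have h3 : (l * x - y S) ^ p ^ f ∈ (I S).frobPow (p ^ f) := Ideal.subset_span ⟨_, hlx, rfl⟩
  rw [h2, mul_sub]
  refine sub_mem ?_ (Ideal.mul_mem_left _ _ h3)
  have : (c : T) * (l * x) ^ p ^ f = l ^ p ^ f * ((c * x ^ p ^ f : A) : T) := by
    push_cast; ring
  rwa [this]

section MaximalChains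

variable {T : Type*} [CommRing T] [IsLocalRing T] [IsNoetherianRing T]

/-- In a Noetherian local ring of depth at least two, there is a prime strictly between any
minimal prime and the maximal ideal. -/
theorem DepthGE.exists_isPrime_between (hdepth : DepthGE T 2) {P : Ideal T}
    (hP : P ∈ minimalPrimes T) : ∃ L : Ideal T, L.IsPrime ∧ P < L ∧ L ≠ maximalIdeal T := by
  obtain ⟨rs, hlen, hmem, hreg⟩ := hdepth
  obtain ⟨x₁, x₂, rfl⟩ := List.length_eq_two.1 hlen
  have hx₁m : x₁ ∈ maximalIdeal T := hmem _ (by simp)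
  have hx₂m : x₂ ∈ maximalIdeal T := hmem _ (by simp)
  have hweak := hreg.toIsWeaklyRegular
  rw [RingTheory.Sequence.isWeaklyRegular_cons_iff,
    RingTheory.Sequence.isWeaklyRegular_cons_iff] at hweak
  obtain ⟨h₁, h₂, -⟩ := hweak
  have hx₂ (t : T) (ht : x₁ ∣ x₂ * t) : x₁ ∣ t := by
    obtain ⟨s, hs⟩ := ht
    have hzero : x₂ • (Submodule.Quotient.mk t : QuotSMulTop x₁ T) = 0 := by
      rw [← Submodule.Quotient.mk_smul, Submodule.Quotient.mk_eq_zero, smul_eq_mul, hs]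
      exact Submodule.smul_mem_pointwise_smul s x₁ ⊤ trivial
    have := h₂.right_eq_zero_of_smul hzero
    rw [Submodule.Quotient.mk_eq_zero] at this
    obtain ⟨r, -, hr⟩ := this
    exact ⟨r, hr.symm⟩
  by_contra! hcon
  have hx₁P : x₁ ∉ P := fun h ↦ Set.disjoint_left.1
    (Ideal.disjoint_nonZeroDivisors_of_mem_minimalPrimes hP) h
    (mem_nonZeroDivisors_iff_right.2 fun t ht ↦ h₁.right_eq_zero_of_smul (by
      rwa [smul_eq_mul, mul_comm]))
  have hrad : x₂ ∈ (P ⊔ Ideal.span {x₁}).radical := by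
    rw [Ideal.radical_eq_sInf, Submodule.mem_sInf]
    rintro L ⟨hL, hLp⟩
    rw [hcon L hLp (lt_of_le_of_ne (le_sup_left.trans hL) fun h ↦ hx₁P <| h ▸
      hL (Ideal.mem_sup_right (Ideal.mem_span_singleton_self x₁)))]
    exact hx₂m
  obtain ⟨k, hk⟩ := hrad
  let N : Ideal T := P.annihilator
  have hN : N ≠ ⊥ := by
    have hass : P ∈ associatedPrimes T T := by
      refine Module.associatedPrimes.minimalPrimes_annihilator_subset_associatedPrimes T T ?_
      rwa [Module.annihilator_eq_bot.2 inferInstance]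
    obtain ⟨hPp, n, hn⟩ := isAssociatedPrime_iff.1 hass
    refine (Submodule.ne_bot_iff _).2 ⟨n, Submodule.mem_annihilator.2 fun a ha ↦ ?_, ?_⟩
    · rw [hn] at ha
      simpa [mul_comm] using ha
    · rintro rfl
      exact hPp.ne_top (hn.trans (by simp))
  refine hN (Submodule.eq_bot_of_le_smul_of_le_jacobson_bot (Ideal.span {x₁}) N
    (IsNoetherian.noetherian N) (fun n hn ↦ ?_) ?_)
  · obtain ⟨t, rfl⟩ : x₁ ∣ n := by
      obtain ⟨a, ha, b, hb, hab⟩ := Submodule.mem_sup.1 hk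
      have hdvd : x₁ ∣ x₂ ^ k * n := by
        obtain ⟨c, rfl⟩ := Ideal.mem_span_singleton'.1 hb
        rw [← hab, add_mul, mul_comm a, show n * a = 0 from Submodule.mem_annihilator.1 hn a ha,
          zero_add]
        exact ⟨c * n, by ring⟩
      clear hk hab
      induction k with
      | zero => simpa using hdvd
      | succ k ih => exact ih (hx₂ _ (by rwa [← mul_assoc, ← pow_succ']))
    refine Submodule.smul_mem_smul (Ideal.mem_span_singleton_self x₁) ?_
    refine Submodule.mem_annihilator.2 fun a ha ↦ h₁.right_eq_zero_of_smul ?_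
    simpa [mul_assoc] using Submodule.mem_annihilator.1 hn a ha
  · rw [IsLocalRing.jacobson_eq_maximalIdeal ⊥ bot_ne_top]
    rwa [Ideal.span_singleton_le_iff_mem]

/-- Any prime avoiding an element `f` of the maximal ideal is contained in a prime which avoids
`f` and is maximal among the nonmaximal primes. -/
theorem exists_isPrime_notMem_forall_lt_eq_maximalIdeal {P : Ideal T} [hPp : P.IsPrime] {f : T}
    (hfP : f ∉ P) : ∃ Q : Ideal T, Q.IsPrime ∧ P ≤ Q ∧ f ∉ Q ∧
      ∀ L : Ideal T, L.IsPrime → Q < L → L = maximalIdeal T := by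
  obtain ⟨Q, ⟨hQ, hPQ, hfQ⟩, hmax⟩ : ∃ Q ∈ {Q : Ideal T | Q.IsPrime ∧ P ≤ Q ∧ f ∉ Q},
      ∀ L ∈ {Q : Ideal T | Q.IsPrime ∧ P ≤ Q ∧ f ∉ Q}, ¬ Q < L := set_has_maximal_iff_noetherian.2
    (inferInstanceAs (IsNoetherian T T)) _ ⟨P, hPp, le_rfl, hfP⟩
  refine ⟨Q, hQ, hPQ, hfQ, fun L hL hQL ↦ ?_⟩
  have hmem (L : Ideal T) (hL : L.IsPrime) (hQL : Q < L) : f ∈ L := by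
    by_contra hf
    exact hmax L ⟨hL, hPQ.trans hQL.le, hf⟩ hQL
  have hle (L : Ideal T) (hL : L.IsPrime) (hQL : Q < L) : Q ⊔ Ideal.span {f} ≤ L :=
    sup_le hQL.le ((Ideal.span_singleton_le_iff_mem _).2 (hmem L hL hQL))
  have hlt (L : Ideal T) (hL : Q ⊔ Ideal.span {f} ≤ L) : Q < L :=
    lt_of_le_of_ne (le_sup_left.trans hL) fun h ↦ hfQ <| h ▸
      hL (Ideal.mem_sup_right (Ideal.mem_span_singleton_self f))
  by_cases hmin : maximalIdeal T ∈ (Q ⊔ Ideal.span {f}).minimalPrimes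
  · exact le_antisymm (le_maximalIdeal hL.ne_top) (hmin.2 ⟨hL, hle L hL hQL⟩
      (le_maximalIdeal hL.ne_top))
  exfalso
  obtain ⟨g, hgm, hg⟩ := exists_mem_forall_notMem_of_forall_not_le
    (Ideal.finite_minimalPrimes_of_isNoetherianRing T (Q ⊔ Ideal.span {f})) (fun L hL ↦ hL.1.1)
    (J := maximalIdeal T) fun L hL hmL ↦ hmin <| by
      rwa [(le_antisymm hmL (le_maximalIdeal hL.1.1.ne_top))]
  obtain ⟨L₁, hL₁⟩ := Ideal.nonempty_minimalPrimes (I := Ideal.span (insert g (Q : Set T)))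
    fun h ↦ (Ideal.IsPrime.ne_top (inferInstanceAs (maximalIdeal T).IsPrime)) <| top_le_iff.1 <|
      h ▸ Ideal.span_le.2 (Set.insert_subset hgm (le_maximalIdeal hQ.ne_top))
  have hL₁p : L₁.IsPrime := hL₁.1.1
  have hgL₁ : g ∈ L₁ := hL₁.1.2 (Ideal.subset_span (Set.mem_insert _ _))
  have hQL₁ : Q ≤ L₁ := fun x hx ↦ hL₁.1.2 (Ideal.subset_span (Set.mem_insert_of_mem _ hx))
  have hgQ : g ∉ Q := fun h ↦ by
    obtain ⟨L₀, hL₀, -⟩ := Ideal.exists_minimalPrimes_le (hle L hL hQL)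
    exact hg L₀ hL₀ ((hlt L₀ hL₀.1.2).le h)
  obtain ⟨L₂, hL₂, hL₂₁⟩ := Ideal.exists_minimalPrimes_le
    (hle L₁ hL₁p (lt_of_le_of_ne hQL₁ fun h ↦ hgQ (h ▸ hgL₁)))
  have hL₂p : L₂.IsPrime := hL₂.1.1
  have hQL₂ := hlt L₂ hL₂.1.2
  have := Ideal.mem_minimalPrimes_span_of_mem_minimalPrimes_span_insert
    (lt_of_le_of_ne hL₂₁ fun h ↦ hg L₂ hL₂ (h ▸ hgL₁)) g Q hL₁ Q hQL₂.le
    (fun x hx ↦ Ideal.le_radical (Ideal.subset_span (Set.mem_insert_of_mem _ hx)))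
  exact hQL₂.not_ge (this.2 ⟨hQ, by rw [Ideal.span_eq]⟩ hQL₂.le)

/-- In a Noetherian local ring of depth at least two that is not equidimensional, there is a
prime, maximal among the nonmaximal ones, containing no minimal prime of maximal dimension and
not contained in any minimal prime nor in a given nonmaximal prime. -/
theorem DepthGE.exists_isPrime_forall_lt_eq_maximalIdeal (hdepth : DepthGE T 2)
    (hneq : ¬ ∀ Q ∈ minimalPrimes T, ringKrullDim (T ⧸ Q) = ringKrullDim T)
    {P : Ideal T} (hP : P.IsPrime) (hPm : P ≠ maximalIdeal T) :
    ∃ Q : Ideal T, Q.IsPrime ∧ Q ≠ maximalIdeal T ∧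
      (∀ L : Ideal T, L.IsPrime → Q < L → L = maximalIdeal T) ∧
      (∀ P' ∈ minimalPrimes T ∪ {P}, ¬ Q ≤ P') ∧
      ∀ P' ∈ minimalPrimes T, P' ≤ Q → ringKrullDim (T ⧸ P') ≠ ringKrullDim T := by
  push Not at hneq
  obtain ⟨P₀, hP₀, hdim₀⟩ := hneq
  have hP₀p : P₀.IsPrime := hP₀.1.1
  obtain ⟨L₀, hL₀, hPL₀, hL₀m⟩ := hdepth.exists_isPrime_between hP₀
  let S : Set (Ideal T) := {P' ∈ minimalPrimes T | ringKrullDim (T ⧸ P') = ringKrullDim T} ∪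
    ({P} \ {P₀}) ∪ {maximalIdeal T}
  have hS : S.Finite := (((minimalPrimes.finite_of_isNoetherianRing T).subset
    (Set.sep_subset _ _)).union ((Set.finite_singleton P).subset Set.sdiff_subset)).union
    (Set.finite_singleton _)
  have hnle : ¬ hS.toFinset.inf id ≤ P₀ := by
    rw [hP₀p.inf_le']
    rintro ⟨P', hP', hle⟩
    rw [Set.Finite.mem_toFinset] at hP'
    rcases hP' with (⟨hmin, hd⟩ | ⟨rfl, hne⟩) | rfl
    · exact hdim₀ (le_antisymm hle (hP₀.2 ⟨hmin.1.1, bot_le⟩ hle) ▸ hd)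
    · exact hne (le_antisymm hle (hP₀.2 ⟨hP, bot_le⟩ hle))
    · exact hPL₀.not_ge ((le_maximalIdeal hL₀.ne_top).trans hle)
  obtain ⟨f, hf, hfP₀⟩ := SetLike.not_le_iff_exists.1 hnle
  have hfS (P' : Ideal T) (hP' : P' ∈ S) : f ∈ P' :=
    Finset.inf_le (f := id) (hS.mem_toFinset.2 hP') hf
  obtain ⟨Q, hQ, hPQ, hfQ, hcov⟩ := exists_isPrime_notMem_forall_lt_eq_maximalIdeal hfP₀
  have hQP₀ : Q ≠ P₀ := by
    rintro rfl
    exact hL₀m (hcov L₀ hL₀ hPL₀)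
  refine ⟨Q, hQ, fun h ↦ hfQ (h ▸ hfS _ (Or.inr rfl)), hcov, ?_, fun P' hP' hle hd ↦
    hfQ (hle (hfS P' (Or.inl (Or.inl ⟨hP', hd⟩))))⟩
  rintro P' (hP' | rfl) hle
  · exact hQP₀ (le_antisymm (hle.trans (hP'.2 ⟨hP₀p, bot_le⟩ (hPQ.trans hle))) hPQ)
  · have hQP' : Q = P' := by
      by_contra hne
      exact hPm (hcov P' hP (lt_of_le_of_ne hle hne))
    exact hfQ (hQP' ▸ hfS P' (Or.inl (Or.inr ⟨rfl, fun h ↦ hQP₀ (hQP'.trans h)⟩)))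

end MaximalChains

/-- In a Noetherian domain there is a saturated chain of primes from zero to any prime whose
length is the height of the prime. -/
theorem exists_covBy_series_length_eq_height {A : Type*} [CommRing A] [IsDomain A]
    [IsNoetherianRing A] (q : PrimeSpectrum A) :
    ∃ l : RelSeries {(a, b) : PrimeSpectrum A × PrimeSpectrum A | a ⋖ b},
      l.head = ⊥ ∧ l.last = q ∧ (l.length : ℕ∞) = q.asIdeal.height := by
  obtain ⟨n, hn⟩ := ENat.ne_top_iff_exists.1 (Ideal.height_ne_top q.2.ne_top)
  have hn' : Order.height q = n := by rw [← PrimeSpectrum.height_eq_orderHeight, hn]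
  obtain ⟨l, rfl, rfl⟩ := Order.exists_series_of_height_eq_coe q hn'
  have hidx := Order.height_eq_index_of_length_eq_height_last hn'.symm
  refine ⟨⟨l.length, l.toFun, fun i ↦ ⟨l.step i, fun z hz₁ hz₂ ↦ ?_⟩⟩, ?_, rfl, hn⟩
  · have hz : Order.height z < ⊤ := (Order.height_mono hz₂.le).trans_lt <| by
      rw [show Order.height (l.toFun i.succ) = _ from hidx i.succ]
      exact ENat.natCast_lt_top _
    have h₁ := Order.height_strictMono hz₁ ((Order.height_mono hz₁.le).trans_lt hz)
    have h₂ := Order.height_strictMono hz₂ hz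
    rw [show Order.height (l.toFun i.castSucc) = _ from hidx i.castSucc] at h₁
    rw [show Order.height (l.toFun i.succ) = _ from hidx i.succ] at h₂
    obtain ⟨k, hk⟩ := ENat.ne_top_iff_exists.1 hz.ne
    rw [← hk, Nat.cast_lt] at h₁ h₂
    simp only [Fin.val_castSucc, Fin.val_succ] at h₁ h₂
    omega
  · have h0 := hidx 0
    rw [Fin.val_zero, Nat.cast_zero, Order.height_eq_zero] at h0
    exact h0.eq_bot

/-- A Noetherian local domain is not catenary if it has a prime, maximal among the nonmaximal
ones, whose height is too small. -/
theorem not_isCatenaryRing_of_height_add_one_lt {A : Type*} [CommRing A] [IsDomain A]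
    [IsNoetherianRing A] [IsLocalRing A] (q : Ideal A) [hq : q.IsPrime]
    (hqm : q ≠ maximalIdeal A) (hcov : ∀ L : Ideal A, L.IsPrime → q < L → L = maximalIdeal A)
    (hlt : q.height + 1 < (maximalIdeal A).height) : ¬ IsCatenaryRing A := by
  intro hcat
  let x : PrimeSpectrum A := ⟨q, hq⟩
  let c : PrimeSpectrum A := ⟨maximalIdeal A, inferInstance⟩
  have hxc : x ⋖ c := by
    refine ⟨lt_of_le_of_ne (le_maximalIdeal hq.ne_top)
      fun h ↦ hqm (congrArg PrimeSpectrum.asIdeal h), fun z hz₁ hz₂ ↦ hz₂.ne ?_⟩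
    exact PrimeSpectrum.ext (hcov z.asIdeal z.2 hz₁)
  obtain ⟨l₁, hl₁h, hl₁l, hl₁⟩ := exists_covBy_series_length_eq_height x
  obtain ⟨l₂, hl₂h, hl₂l, hl₂⟩ := exists_covBy_series_length_eq_height c
  let l := l₁.snoc c (by rw [hl₁l]; exact hxc)
  have hlen := hcat l.length l₂.length l.toFun l₂.toFun
    (((l₁.head_snoc c _).trans hl₁h).trans hl₂h.symm)
    (((l₁.last_snoc c _)).trans hl₂l.symm) l.step l₂.step
  have hlen' : l₁.length + 1 = l₂.length := by rw [← hlen]; rfl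
  refine hlt.ne ?_
  change x.asIdeal.height + 1 = c.asIdeal.height
  rw [← hl₁, ← hl₂, ← hlen']
  norm_cast

/-- A nonmaximal prime of a local ring containing only minimal primes of non-maximal dimension has
small height. -/
theorem height_add_one_lt_of_forall_minimalPrimes {T : Type*} [CommRing T] [IsLocalRing T]
    [IsNoetherianRing T] (Q : Ideal T) [hQ : Q.IsPrime] (hQm : Q ≠ maximalIdeal T)
    (hmin : ∀ P ∈ minimalPrimes T, P ≤ Q → ringKrullDim (T ⧸ P) ≠ ringKrullDim T) :
    Q.height + 1 < (maximalIdeal T).height := by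
  obtain ⟨n, hn⟩ := ENat.ne_top_iff_exists.1 (Ideal.height_ne_top hQ.ne_top)
  let x : PrimeSpectrum T := ⟨Q, hQ⟩
  let c : PrimeSpectrum T := ⟨maximalIdeal T, inferInstance⟩
  have hxc : x < c := lt_of_le_of_ne (le_maximalIdeal hQ.ne_top)
    fun h ↦ hQm (congrArg PrimeSpectrum.asIdeal h)
  obtain ⟨l, hlx, hlen⟩ := Order.exists_series_of_height_eq_coe x (n := n) (by
    rw [← PrimeSpectrum.height_eq_orderHeight, hn])
  obtain ⟨P, hP, hPl⟩ := Ideal.exists_minimalPrimes_le (bot_le (a := l.head.asIdeal))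
  let z : PrimeSpectrum T := ⟨P, hP.1.1⟩
  have hle := Order.length_le_coheight (x := z) (p := l.snoc c (by rwa [hlx])) (by
    rw [RelSeries.head_snoc]; exact hPl)
  have hdim : ringKrullDim (T ⧸ P) = Order.coheight z := by
    rw [ringKrullDim_quotient, Order.coheight_eq_krullDim_Ici]
    congr 1
  have hPQ : P ≤ Q := hPl.trans (hlx ▸ l.head_le_last : l.head ≤ x)
  have hlt := lt_of_le_of_ne (ringKrullDim_quotient_le P) (hmin P hP hPQ)
  rw [hdim, ← maximalIdeal_height_eq_ringKrullDim, WithBot.coe_lt_coe] at hlt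
  refine lt_of_le_of_lt ?_ hlt
  rw [← hn, ← hlen]
  simpa using hle

/-- The prime subring of a ring of prime characteristic meets proper ideals trivially. -/
theorem Subring.meetsTrivially_bot {T : Type*} [CommRing T] {p : ℕ} (hp : p.Prime) [CharP T p]
    {C : Set (Ideal T)} (hC : ∀ P ∈ C, P ≠ ⊤) : (⊥ : Subring T).MeetsTrivially C := by
  intro P hP x hx hxP
  obtain ⟨n, rfl⟩ := Subring.mem_bot.1 hx
  rw [CharP.intCast_eq_zero_iff T p]
  by_contra hn
  obtain ⟨a, b, hab⟩ := (Nat.prime_iff_prime_int.1 hp).coprime_iff_not_dvd.2 hn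
  refine hC P hP ((Ideal.eq_top_iff_one P).2 ?_)
  have h1 : (1 : T) = (b : T) * (n : T) := by
    have := congrArg (Int.cast : ℤ → T) hab
    push_cast at this
    rw [← this, CharP.cast_eq_zero, mul_zero, zero_add]
  rw [h1]
  exact Ideal.mul_mem_left _ _ hxP

/-- A subring meeting a prime ideal trivially is a domain. -/
theorem Subring.MeetsTrivially.isDomain {T : Type*} [CommRing T] {A : Subring T}
    {C : Set (Ideal T)} (hA : A.MeetsTrivially C) {P : Ideal T} (hP : P.IsPrime) (hPC : P ∈ C) :
    IsDomain A := by
  have : Nontrivial T := ⟨0, 1, fun h ↦ hP.ne_top ((Ideal.eq_top_iff_one P).2 (h ▸ P.zero_mem))⟩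
  have : NoZeroDivisors A := ⟨fun {a b} hab ↦ by
    have h : (a : T) * b ∈ P := by
      rw [← Subring.coe_mul, hab]
      exact P.zero_mem
    exact (hP.mem_or_mem h).imp (fun h ↦ Subtype.ext (hA P hPC a a.2 h))
      fun h ↦ Subtype.ext (hA P hPC b b.2 h)⟩
  exact NoZeroDivisors.to_isDomain A

/-- In a reduced ring, an element outside all minimal primes is a nonzerodivisor. -/
theorem mem_nonZeroDivisors_of_forall_minimalPrimes {T : Type*} [CommRing T] [IsReduced T] {x : T}
    (hx : ∀ P ∈ minimalPrimes T, x ∉ P) : x ∈ nonZeroDivisors T := by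
  refine mem_nonZeroDivisors_iff_right.2 fun t ht ↦ ?_
  have : t ∈ nilradical T := by
    rw [nilradical, Ideal.zero_eq_bot, ← Ideal.sInf_minimalPrimes, Submodule.mem_sInf]
    intro P hP
    exact (hP.1.1.mem_or_mem (ht ▸ P.zero_mem : t * x ∈ P)).resolve_right (hx P hP)
  rwa [nilradical_eq_zero, Ideal.zero_eq_bot, Ideal.mem_bot] at this

/-- If the extension to `T` of the contraction of a prime `Q`, maximal among the nonmaximal ones,
is `Q`, then the contraction is maximal among the nonmaximal primes too. -/
theorem Subring.eq_comap_maximalIdeal_of_comap_lt {T : Type*} [CommRing T] [IsLocalRing T]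
    {A : Subring T} (hA : ∀ J : Ideal A, (J.map A.subtype).comap A.subtype = J) {Q : Ideal T}
    (hQ : (Q.comap A.subtype).map A.subtype = Q)
    (hcov : ∀ L : Ideal T, L.IsPrime → Q < L → L = maximalIdeal T) {L : Ideal A} (hL : L.IsPrime)
    (hQL : Q.comap A.subtype < L) : L = (maximalIdeal T).comap A.subtype := by
  have hrad : maximalIdeal T ≤ (L.map A.subtype).radical := by
    rw [Ideal.radical_eq_sInf]
    refine le_sInf fun L' ⟨hLL', hL'⟩ ↦ (hcov L' hL' (lt_of_le_of_ne ?_ ?_)).ge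
    · rw [← hQ]
      exact (Ideal.map_mono hQL.le).trans hLL'
    · rintro rfl
      exact hQL.not_ge (Ideal.map_le_iff_le_comap.1 hLL')
  refine le_antisymm ?_ fun a ha ↦ ?_
  · rw [← hA L]
    refine Ideal.comap_mono (le_maximalIdeal fun h ↦ hL.ne_top ?_)
    rw [← hA L, h, Ideal.comap_top]
  · obtain ⟨k, hk⟩ := hrad ha
    refine hL.mem_of_pow_mem k ?_
    rw [← hA L, Ideal.mem_comap, map_pow]
    exact hk

/-- Heights of contractions along the completion. -/
theorem Subring.height_comap_add_one_lt {T : Type*} [CommRing T] [IsLocalRing T]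
    [IsNoetherianRing T] {A : Subring T} [IsNoetherianRing A] [Module.Flat A T]
    (hm : ((maximalIdeal T).comap A.subtype).map A.subtype = maximalIdeal T) {Q : Ideal T}
    [Q.IsPrime] (hlt : Q.height + 1 < (maximalIdeal T).height) :
    (Q.comap A.subtype).height + 1 < ((maximalIdeal T).comap A.subtype).height := by
  have hQ : Q.LiesOver (Q.comap A.subtype) := ⟨rfl⟩
  have hn : (maximalIdeal T).LiesOver ((maximalIdeal T).comap A.subtype) := ⟨rfl⟩
  have h₁ : (Q.comap A.subtype).height ≤ Q.height := by
    rw [Ideal.height_eq_height_add_of_liesOver_of_hasGoingDown (Q.comap A.subtype) Q]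
    exact le_self_add
  have hzero (J : Ideal T) (hJ : J = maximalIdeal T) :
      ((maximalIdeal T).map (Ideal.Quotient.mk J)).height = 0 := by
    subst hJ
    rw [Ideal.map_quotient_self, Ideal.height_bot]
  have h₂ := Ideal.height_le_height_add_of_liesOver ((maximalIdeal T).comap A.subtype)
    (maximalIdeal T)
  rw [hzero (((maximalIdeal T).comap A.subtype).map (algebraMap A T)) hm, add_zero] at h₂
  exact (add_le_add_left h₁ 1).trans_lt (hlt.trans_le h₂)

/-- Noncatenary weakly F-regular precompletions, assuming `T` is not
equidimensional and has depth at least two. -/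
theorem noncatenary_weaklyFRegular_precompletion
    (T : Type*) [CommRing T] [IsLocalRing T] [IsNoetherianRing T]
    [IsAdicComplete (maximalIdeal T) T] [IsReduced T]
    (p : ℕ) (hp : p.Prime) [CharP T p]
    (hdim : 2 ≤ ringKrullDim T)
    (I : ℕ → Ideal T) (hI : IsApproxGorensteinSeq T I)
    (y : ℕ → T) (hy : ∀ s, IsSocleGenerator (I s) (y s))
    (h1 : ∀ s e : ℕ, y s ^ p ^ e ∉ (I s).frobPow (p ^ e))
    (P : Ideal T) (hP : P.IsPrime) (hPm : P ≠ maximalIdeal T)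
    (h2 : ∀ s, MIy p (I s) (y s) ⊆ (P : Set T))
    (hneq : ¬ ∀ Q ∈ minimalPrimes T, ringKrullDim (T ⧸ Q) = ringKrullDim T)
    (hdepth : DepthGE T 2) :
    ∃ (A : Subring T) (_ : IsDomain A),
      IsNoetherianRing A ∧ IsLocalRing A ∧
      (Ideal.comap A.subtype (maximalIdeal T)).IsMaximal ∧
      WeaklyFRegular A p ∧ ¬ IsCatenaryRing A ∧
      Nonempty (AdicCompletion (Ideal.comap A.subtype (maximalIdeal T)) A ≃+* T) := by
  have : Fact p.Prime := ⟨hp⟩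
  obtain ⟨Q, hQ, hQm, hQcov, hQC, hQmin⟩ :=
    hdepth.exists_isPrime_forall_lt_eq_maximalIdeal hneq hP hPm
  have hprime (P' : Ideal T) (hP' : P' ∈ minimalPrimes T ∪ {P}) : P'.IsPrime := by
    rcases hP' with h | rfl
    exacts [h.1.1, hP]
  have hne (P' : Ideal T) (hP' : P' ∈ minimalPrimes T ∪ {P}) : P' ≠ maximalIdeal T := by
    rcases hP' with h | rfl
    · rintro rfl
      obtain ⟨L, hL, hlt, -⟩ := hdepth.exists_isPrime_between h
      exact hlt.not_ge (le_maximalIdeal hL.ne_top)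
    · exact hPm
  have hcard : Cardinal.mk (⊥ : Subring T) < Cardinal.mk (ℕ → ResidueField T) := by
    refine lt_of_le_of_lt ?_ (aleph0_lt_mk_nat_to_residueField T)
    have : Countable (⊥ : Subring T) := by
      have h : ((⊥ : Subring T) : Set T).Countable := by
        rw [Subring.coe_bot]
        exact Set.countable_range _
      exact h.to_subtype
    exact Cardinal.mk_le_aleph0
  obtain ⟨A, hAC, hAm, hAQ, hres, hcontr⟩ := exists_subring_contracted
    ((minimalPrimes.finite_of_isNoetherianRing T).union (Set.finite_singleton P)) hprime hne
    (fun x hx ↦ mem_nonZeroDivisors_of_forall_minimalPrimes fun P' hP' ↦ hx P' (Or.inl hP'))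
    (Subring.meetsTrivially_bot hp fun P' hP' ↦ (hprime P' hP').ne_top) hcard hQC
  have hA (J : Ideal A) := (Subring.comap_map_eq_and_fg hcontr J).1
  have hmap {J : Ideal T} (hJ : J ≤ Ideal.span {x | x ∈ J ∧ x ∈ A}) :
      (J.comap A.subtype).map A.subtype = J :=
    le_antisymm Ideal.map_comap_le (hJ.trans (Ideal.span_le.2 fun x hx ↦
      Ideal.mem_map_of_mem A.subtype (x := ⟨x, hx.2⟩) hx.1))
  have hm := hmap hAm
  have hdom : IsDomain A := hAC.isDomain hP (Or.inr rfl)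
  have hnoeth : IsNoetherianRing A := (isNoetherianRing_iff_ideal_fg A).2 fun J ↦
    (Subring.comap_map_eq_and_fg hcontr J).2
  obtain ⟨hloc, hmax⟩ := Subring.isLocalRing_of_contracted hA
  obtain ⟨e⟩ := Subring.exists_adicCompletion_algEquiv hA hm hres
  have hflat : Module.Flat A T := Module.Flat.of_linearEquiv e.symm.toLinearEquiv
  refine ⟨A, hdom, hnoeth, hloc, hmax ▸ inferInstance,
    Subring.weaklyFRegular_of_forall_MIy_subset hI hy h2 hA (hAC P (Or.inr rfl)), ?_,
    ⟨e.toRingEquiv⟩⟩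
  refine not_isCatenaryRing_of_height_add_one_lt (Q.comap A.subtype) (fun h ↦ hQm ?_)
    (fun L hL hlt ↦ ?_) ?_
  · rw [← hmap hAQ, h, hmax, hm]
  · rw [hmax]
    exact Subring.eq_comap_maximalIdeal_of_comap_lt hA (hmap hAQ) hQcov hL hlt
  · rw [hmax]
    exact Subring.height_comap_add_one_lt hm
      (height_add_one_lt_of_forall_minimalPrimes Q hQm hQmin)
end

section
/- There exists a weakly F-regular local unique factorization domain which is not Cohen–Macaulay. -/
open IsLocalRing

section FractionSubring

variable {R T V : Type*} [CommRing R] [CommRing T] [CommRing V]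

/-- The subring of `T` consisting of the fractions `j g / j h` lying in `T`, where `j h` becomes
invertible after inverting `j t`. -/
def fractionSubring (j : R →+* T) (t : R) : Subring T where
  carrier := {f | ∃ h g : R, (∃ n : ℕ, j h ∣ j t ^ n) ∧ j h * f = j g}
  mul_mem' := by
    rintro a b ⟨h, g, ⟨n, hn⟩, e⟩ ⟨h', g', ⟨n', hn'⟩, e'⟩
    refine ⟨h * h', g * g', ⟨n + n', ?_⟩, ?_⟩
    · rw [map_mul, pow_add]; exact mul_dvd_mul hn hn'
    · rw [map_mul, map_mul, ← e, ← e']; ring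
  one_mem' := ⟨1, 1, ⟨0, by simp⟩, by simp⟩
  add_mem' := by
    rintro a b ⟨h, g, ⟨n, hn⟩, e⟩ ⟨h', g', ⟨n', hn'⟩, e'⟩
    refine ⟨h * h', g * h' + h * g', ⟨n + n', ?_⟩, ?_⟩
    · rw [map_mul, pow_add]; exact mul_dvd_mul hn hn'
    · rw [map_mul, map_add, map_mul, map_mul, ← e, ← e']; ring
  zero_mem' := ⟨1, 0, ⟨0, by simp⟩, by simp⟩
  neg_mem' := by
    rintro a ⟨h, g, hn, e⟩
    exact ⟨h, -g, hn, by rw [mul_neg, e, map_neg]⟩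

variable {j : R →+* T} {t : R}

theorem mem_fractionSubring {f : T} : f ∈ fractionSubring j t ↔
    ∃ h g : R, (∃ n : ℕ, j h ∣ j t ^ n) ∧ j h * f = j g := Iff.rfl

theorem map_mem_fractionSubring (g : R) : j g ∈ fractionSubring j t :=
  ⟨1, g, ⟨0, by simp⟩, by simp⟩

theorem mem_fractionSubring_of_pow_mul_mem {f : T} {n : ℕ}
    (hf : j t ^ n * f ∈ fractionSubring j t) : f ∈ fractionSubring j t := by
  obtain ⟨h, g, ⟨m, hm⟩, e⟩ := hf
  refine ⟨h * t ^ n, g, ⟨m + n, ?_⟩, ?_⟩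
  · rw [map_mul, map_pow, pow_add]; exact mul_dvd_mul_right hm _
  · rw [← e, map_mul, map_pow, mul_assoc]

theorem inv_mem_fractionSubring {f f' : T} (hf : f ∈ fractionSubring j t) (hff : f * f' = 1) :
    f' ∈ fractionSubring j t := by
  obtain ⟨h, g, ⟨m, hm⟩, e⟩ := hf
  refine ⟨g, h, ⟨m, ?_⟩, ?_⟩
  · rw [← e]
    exact (IsUnit.of_mul_eq_one _ hff).mul_right_dvd.mpr hm
  · rw [← e, mul_assoc, hff, mul_one]

instance isLocalHom_fractionSubring : IsLocalHom (algebraMap (fractionSubring j t) T) := by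
  refine ⟨fun a ha => ?_⟩
  obtain ⟨b, hb⟩ := ha.exists_right_inv
  exact IsUnit.of_mul_eq_one (⟨b, inv_mem_fractionSubring a.2 hb⟩ : fractionSubring j t)
    (Subtype.ext hb)

instance isLocalRing_fractionSubring [IsLocalRing T] : IsLocalRing (fractionSubring j t) :=
  RingHom.domain_isLocalRing (algebraMap (fractionSubring j t) T)

theorem isRegular_of_dvd_pow (ht : j t ∈ nonZeroDivisors T) {h : R}
    (hh : ∃ n : ℕ, j h ∣ j t ^ n) : j h ∈ nonZeroDivisors T := by
  obtain ⟨n, c, hc⟩ := hh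
  have := pow_mem ht n
  rw [hc] at this
  exact (mul_mem_nonZeroDivisors.mp this).1

theorem eq_zero_of_mem_fractionSubring (ht : j t ∈ nonZeroDivisors T) (π : T →+* V)
    (hπ : Function.Injective (π.comp j)) {f : T} (hf : f ∈ fractionSubring j t) (h0 : π f = 0) :
    f = 0 := by
  obtain ⟨h, g, hh, e⟩ := hf
  have hg : g = 0 := hπ (by simp [← e, h0])
  rw [hg, map_zero] at e
  exact (mem_nonZeroDivisors_iff.mp (isRegular_of_dvd_pow ht hh)).1 f e

theorem injective_comp_subtype_fractionSubring (ht : j t ∈ nonZeroDivisors T) (π : T →+* V)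
    (hπ : Function.Injective (π.comp j)) :
    Function.Injective (π.comp (fractionSubring j t).subtype) :=
  (injective_iff_map_eq_zero _).mpr fun a ha =>
    Subtype.ext (eq_zero_of_mem_fractionSubring ht π hπ a.2 ha)

theorem isDomain_fractionSubring [IsDomain V] (ht : j t ∈ nonZeroDivisors T) (π : T →+* V)
    (hπ : Function.Injective (π.comp j)) : IsDomain (fractionSubring j t) :=
  (injective_comp_subtype_fractionSubring ht π hπ).isDomain _

theorem exists_sub_mem_pow (hd : ∀ f : T, ∃ a ∈ fractionSubring j t, j t ∣ f - a)
    (n : ℕ) (f : T) : ∃ a ∈ fractionSubring j t, ∃ c, f = a + j t ^ n * c := by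
  induction n with
  | zero => exact ⟨0, zero_mem _, f, by simp⟩
  | succ n ih =>
    obtain ⟨a, ha, c, hc⟩ := ih
    obtain ⟨b, hb, d, hd⟩ := hd c
    refine ⟨a + j t ^ n * b, add_mem ha (mul_mem (pow_mem (map_mem_fractionSubring t) n) hb),
      d, ?_⟩
    rw [hc, eq_add_of_sub_eq hd]; ring

/-- If `T` is flat over `R` up to powers of `t`, and `T` is the sum of `t T` and the
fraction subring, then `T` is flat over the fraction subring. -/
theorem flat_fractionSubring (ht : j t ∈ nonZeroDivisors T)
    (hd : ∀ f : T, ∃ a ∈ fractionSubring j t, j t ∣ f - a)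
    (hflat : ∀ (l : ℕ) (g : Fin l → R) (x : Fin l → T), ∑ i, j (g i) * x i = 0 →
      ∃ (N k : ℕ) (a : Fin l → Fin k → R) (y : Fin k → T),
        (∀ i, j t ^ N * x i = ∑ m, j (a i m) * y m) ∧ ∀ m, ∑ i, g i * a i m = 0) :
    Module.Flat (fractionSubring j t) T := by
  refine Module.Flat.of_forall_isTrivialRelation fun {l f x} hfx => ?_
  choose h g hh hg using fun i => mem_fractionSubring.mp (f i).2
  -- clear denominators
  have hH : j (∏ i, h i) ∈ nonZeroDivisors T := by
    rw [map_prod]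
    exact prod_mem fun i _ => isRegular_of_dvd_pow ht (hh i)
  have hG : ∀ i, j (∏ i, h i) * (f i : T) = j ((∏ m ∈ Finset.univ.erase i, h m) * g i) := by
    intro i
    rw [← Finset.mul_prod_erase Finset.univ h (Finset.mem_univ i), map_mul, map_mul, ← hg i]
    ring
  obtain ⟨N, k, a, y, hy, ha⟩ := hflat l
    (fun i => (∏ m ∈ Finset.univ.erase i, h m) * g i) x (by
      simp_rw [← hG, mul_assoc, ← Finset.mul_sum]
      simpa [Subring.smul_def] using congrArg (j (∏ i, h i) * ·) hfx)
  have hfa : ∀ m, ∑ i, (f i : T) * j (a i m) = 0 := by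
    intro m
    refine (mem_nonZeroDivisors_iff.mp hH).1 _ ?_
    rw [Finset.mul_sum, ← map_zero j, ← ha m, map_sum]
    exact Finset.sum_congr rfl fun i _ => by rw [← mul_assoc, hG, ← map_mul]
  choose b hb c hc using fun m => exists_sub_mem_pow hd N (y m)
  have hγ : ∀ i, x i - ∑ m, j (a i m) * c m ∈ fractionSubring j t := by
    intro i
    refine mem_fractionSubring_of_pow_mul_mem (n := N) ?_
    have : j t ^ N * (x i - ∑ m, j (a i m) * c m) = ∑ m, j (a i m) * b m := by
      rw [mul_sub, hy i, Finset.mul_sum, ← Finset.sum_sub_distrib]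
      exact Finset.sum_congr rfl fun m _ => by rw [hc m]; ring
    rw [this]
    exact sum_mem fun m _ => mul_mem (map_mem_fractionSubring _) (hb m)
  refine ⟨k + 1, fun i => Fin.cons ⟨_, hγ i⟩ fun m => ⟨_, map_mem_fractionSubring (a i m)⟩,
    Fin.cons 1 c, fun i => ?_, fun m => ?_⟩
  · simp [Fin.sum_univ_succ, Subring.smul_def]
  · refine Subtype.ext ?_
    refine Fin.cases ?_ (fun m => ?_) m
    · simp only [Fin.cons_zero, AddSubmonoidClass.coe_finsetSum, Subring.coe_mul,
        ZeroMemClass.coe_zero, mul_sub, Finset.sum_sub_distrib, Finset.mul_sum]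
      rw [Finset.sum_comm]
      simp_rw [← mul_assoc, ← Finset.sum_mul, hfa]
      simpa [Subring.smul_def] using hfx
    · simpa using hfa m

theorem isNoetherianRing_of_faithfullyFlat (A B : Type*) [CommRing A] [CommRing B] [Algebra A B]
    [Module.FaithfullyFlat A B] [IsNoetherianRing B] : IsNoetherianRing A := by
  have hmono : StrictMono (Ideal.map (algebraMap A B)) :=
    Monotone.strictMono_of_injective (fun _ _ h => Ideal.map_mono h) fun I J h => by
      rw [← Ideal.comap_map_eq_self_of_faithfullyFlat (B := B) I, h,
        Ideal.comap_map_eq_self_of_faithfullyFlat]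
  rw [isNoetherianRing_iff, isNoetherian_iff'] 
  exact hmono.wellFoundedGT

theorem dvd_of_dvd_prime_pow_mul {A : Type*} [CommRing A] [IsDomain A] {t r a : A} {m : ℕ}
    (ht : Prime t) (hr : ¬ t ∣ r) (h : r ∣ t ^ m * a) : r ∣ a := by
  obtain ⟨e, he⟩ := h
  obtain ⟨e', rfl⟩ := ht.pow_dvd_of_dvd_mul_left m hr ⟨a, he.symm⟩
  exact ⟨e', mul_left_cancel₀ (pow_ne_zero m ht.ne_zero) (by rw [he]; ring)⟩

theorem prime_fractionSubring (ht : j t ∈ nonZeroDivisors T) (htp : (Ideal.span {j t}).IsPrime) :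
    Prime (⟨j t, map_mem_fractionSubring t⟩ : fractionSubring j t) := by
  have : Nontrivial T := ⟨1, 0, fun h => htp.ne_top ((Ideal.eq_top_iff_one _).mpr (h ▸ zero_mem _))⟩
  have key : ∀ a : fractionSubring j t, (a : T) ∈ Ideal.span {j t} →
      (⟨j t, map_mem_fractionSubring t⟩ : fractionSubring j t) ∣ a := by
    intro a ha
    obtain ⟨c, hc⟩ := Ideal.mem_span_singleton'.mp ha
    refine ⟨⟨c, mem_fractionSubring_of_pow_mul_mem (n := 1) ?_⟩, Subtype.ext ?_⟩
    · rw [pow_one, mul_comm, hc]; exact a.2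
    · rw [Subring.coe_mul, mul_comm, hc]
  refine ⟨fun h => nonZeroDivisors.ne_zero ht (congrArg Subtype.val h), fun h => ?_,
    fun a b hab => ?_⟩
  · exact htp.ne_top (Ideal.span_singleton_eq_top.mpr (h.map (fractionSubring j t).subtype))
  · obtain ⟨c, hc⟩ := hab
    refine (htp.mem_or_mem (x := (a : T)) (y := b) ?_).imp (key a) (key b)
    rw [← Subring.coe_mul, hc, Subring.coe_mul]
    exact Ideal.mul_mem_right _ _ (Ideal.mem_span_singleton_self _)

/-- The fraction subring is factorial as soon as `R` is and `t` generates a prime ideal of `T`. -/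
theorem uniqueFactorizationMonoid_fractionSubring [IsDomain R] [UniqueFactorizationMonoid R]
    [IsDomain (fractionSubring j t)] [IsNoetherianRing (fractionSubring j t)]
    (ht : j t ∈ nonZeroDivisors T) (hj : Function.Injective j)
    (htp : (Ideal.span {j t}).IsPrime) :
    UniqueFactorizationMonoid (fractionSubring j t) := by
  rw [UniqueFactorizationMonoid.iff_exists_prime_mem_of_isPrime]
  intro Q hQ hQp
  let i : R →+* fractionSubring j t := j.codRestrict _ map_mem_fractionSubring
  have hi : Function.Injective i := fun a b h => hj (congrArg Subtype.val h)
  have htA : Prime (i t) := prime_fractionSubring ht htp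
  by_cases htQ : i t ∈ Q
  · exact ⟨_, htQ, htA⟩
  have hden : ∀ h : R, (∃ n : ℕ, j h ∣ j t ^ n) → ∃ n : ℕ, i h ∣ i t ^ n := by
    rintro h ⟨n, c, hc⟩
    exact ⟨n, ⟨c, h, t ^ n, ⟨n, c, hc⟩, by rw [map_pow, hc]⟩, Subtype.ext hc⟩
  have hdenQ : ∀ h : R, (∃ n : ℕ, j h ∣ j t ^ n) → i h ∉ Q := by
    intro h hh hQh
    obtain ⟨n, hn⟩ := hden h hh
    exact htQ (hQp.mem_of_pow_mem n (Ideal.mem_of_dvd _ hn hQh))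
  have hfrac : ∀ a : fractionSubring j t, ∃ h g : R, (∃ n : ℕ, j h ∣ j t ^ n) ∧ i h * a = i g :=
    fun a => by
      obtain ⟨h, g, hh, e⟩ := a.2
      exact ⟨h, g, hh, Subtype.ext e⟩
  have hq : Q.comap i ≠ ⊥ := by
    obtain ⟨f, hfQ, hf0⟩ := Submodule.exists_mem_ne_zero_of_ne_bot hQ
    obtain ⟨h, g, hh, e⟩ := hfrac f
    refine fun hbot => hdenQ h hh ?_
    have hg : g ∈ Q.comap i := by
      rw [Ideal.mem_comap, ← e]; exact Q.mul_mem_left _ hfQ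
    rw [hbot, Ideal.mem_bot] at hg
    rw [hg, map_zero, mul_eq_zero, or_iff_left hf0] at e
    rw [e]; exact zero_mem _
  obtain ⟨r, hrQ, hr⟩ := (Ideal.IsPrime.comap i (K := Q)).exists_mem_prime_of_ne_bot hq
  have hir : i r ≠ 0 := by rw [Ne, map_eq_zero_iff i hi]; exact hr.ne_zero
  obtain ⟨r', hrr, hr'⟩ :=
    (FiniteMultiplicity.of_prime_left htA hir).exists_eq_pow_mul_and_not_dvd
  generalize multiplicity (i t) (i r) = n at hrr
  have hr'Q : r' ∈ Q := by
    rw [Ideal.mem_comap, hrr] at hrQ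
    exact (hQp.mem_or_mem hrQ).resolve_left fun h => htQ (hQp.mem_of_pow_mem n h)
  have hdvd : ∀ (h g : R) (a : fractionSubring j t), (∃ n : ℕ, j h ∣ j t ^ n) → i h * a = i g →
      r ∣ g → r' ∣ a := by
    rintro h g a hh e ⟨s, rfl⟩
    obtain ⟨m, d, hd⟩ := hden h hh
    refine dvd_of_dvd_prime_pow_mul (m := m) htA hr' ⟨i t ^ n * i s * d, ?_⟩
    rw [hd, mul_right_comm, e, map_mul, hrr]; ring
  refine ⟨r', hr'Q, ?_, fun hu => hQp.ne_top (Q.eq_top_of_isUnit_mem hr'Q hu), ?_⟩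
  · rintro rfl
    exact hir (by rw [hrr, mul_zero])
  · rintro a b ⟨c, hc⟩
    obtain ⟨h₁, g₁, hh₁, e₁⟩ := hfrac a
    obtain ⟨h₂, g₂, hh₂, e₂⟩ := hfrac b
    obtain ⟨h₃, g₃, hh₃, e₃⟩ := hfrac c
    have hR : r * (g₃ * h₁ * h₂) = t ^ n * h₃ * (g₁ * g₂) := by
      apply hi
      simp only [map_mul, map_pow, ← e₁, ← e₂, ← e₃]
      rw [hrr]
      linear_combination (-i t ^ n * i h₁ * i h₂ * i h₃) * hc
    rcases hr.dvd_or_dvd ⟨_, hR.symm⟩ with h | h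
    · exfalso
      have hmem : i (t ^ n * h₃) ∈ Q := Ideal.mem_of_dvd _ (map_dvd i h) hrQ
      rw [map_mul, map_pow] at hmem
      exact (hQp.mem_or_mem hmem).elim (fun h => htQ (hQp.mem_of_pow_mem n h)) (hdenQ h₃ hh₃)
    · exact (hr.dvd_or_dvd h).imp (hdvd h₁ g₁ a hh₁ e₁) (hdvd h₂ g₂ b hh₂ e₂)

end FractionSubring

section PowerSeriesTensor

open TensorProduct PowerSeries

variable {k S ι : Type*} [Field k] [CommRing S] [Algebra k S]

/-- The base change of an augmentation `S → k` to `k⟦X⟧`. -/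
noncomputable def evalPowerSeries (ε : S →ₐ[k] k) : k⟦X⟧ ⊗[k] S →ₐ[k⟦X⟧] k⟦X⟧ :=
  Algebra.TensorProduct.lift (AlgHom.id _ _) ((Algebra.ofId k k⟦X⟧).comp ε) fun _ _ => .all _ _

@[simp] theorem evalPowerSeries_tmul (ε : S →ₐ[k] k) (v : k⟦X⟧) (s : S) :
    evalPowerSeries ε (v ⊗ₜ s) = v * C (ε s) := by
  simp [evalPowerSeries, Algebra.ofId_apply]

variable (k S) in
/-- Reduction of `k⟦X⟧ ⊗ S` modulo `X`. -/
noncomputable def reduceX : k⟦X⟧ ⊗[k] S →ₐ[k] S :=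
  Algebra.TensorProduct.lift
    ((Algebra.ofId k S).comp { constantCoeff (R := k) with commutes' := fun r => by simp })
    (AlgHom.id k S) fun _ _ => .all _ _

@[simp] theorem reduceX_tmul (v : k⟦X⟧) (s : S) :
    reduceX k S (v ⊗ₜ s) = algebraMap k S (constantCoeff v) * s := by
  simp only [reduceX, Algebra.TensorProduct.lift_tmul, AlgHom.comp_apply, AlgHom.id_apply]
  rfl

theorem augmentation_reduceX (ε : S →ₐ[k] k) (u : k⟦X⟧ ⊗[k] S) :
    ε (reduceX k S u) = constantCoeff (evalPowerSeries ε u) := by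
  induction u with
  | zero => simp
  | tmul v s => simp
  | add a b ha hb => simp [ha, hb]

theorem exists_eq_add_X_mul (u : k⟦X⟧ ⊗[k] S) :
    ∃ u', u = 1 ⊗ₜ reduceX k S u + (X : k⟦X⟧) ⊗ₜ 1 * u' := by
  induction u with
  | zero => exact ⟨0, by simp⟩
  | tmul v s =>
    obtain ⟨w, hw⟩ := X_dvd_iff.mpr (show constantCoeff (v - C (constantCoeff v)) = 0 by simp)
    refine ⟨w ⊗ₜ s, ?_⟩
    rw [Algebra.TensorProduct.tmul_mul_tmul, one_mul, ← hw, reduceX_tmul, ← Algebra.smul_def,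
      ← smul_tmul, sub_tmul, smul_eq_C_mul, mul_one, add_sub_cancel]
  | add a b ha hb =>
    obtain ⟨a', ha⟩ := ha
    obtain ⟨b', hb⟩ := hb
    refine ⟨a' + b', ?_⟩
    rw [map_add, tmul_add, mul_add]
    nth_rw 1 [ha, hb]
    abel

theorem X_tmul_mem_nonZeroDivisors : (X : k⟦X⟧) ⊗ₜ[k] (1 : S) ∈ nonZeroDivisors (k⟦X⟧ ⊗[k] S) := by
  have h := (Module.Flat.isSMulRegular_of_nonZeroDivisors (R := k⟦X⟧) (M := k⟦X⟧ ⊗[k] S) (r := X)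
    (mem_nonZeroDivisors_of_ne_zero X_ne_zero))
  refine mem_nonZeroDivisors_iff_right.mpr fun x hx => h ?_
  change (X : k⟦X⟧) • x = (X : k⟦X⟧) • 0
  rw [smul_zero]
  exact (Algebra.smul_def (X : k⟦X⟧) x).trans ((mul_comm _ _).trans hx)

instance isPrime_ker_augmentation (ε : S →ₐ[k] k) : (RingHom.ker ε).IsPrime :=
  RingHom.ker_isPrime _

/-- The ideal of `k⟦X⟧ ⊗ S` of elements vanishing at the closed point of an augmentation. -/
noncomputable abbrev closedPointIdeal (ε : S →ₐ[k] k) : Ideal (k⟦X⟧ ⊗[k] S) :=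
  (RingHom.ker ε).comap (reduceX k S)

instance isPrime_closedPointIdeal (ε : S →ₐ[k] k) : (closedPointIdeal ε).IsPrime :=
  Ideal.IsPrime.comap _

theorem mem_closedPointIdeal {ε : S →ₐ[k] k} {u : k⟦X⟧ ⊗[k] S} :
    u ∈ closedPointIdeal ε ↔ constantCoeff (evalPowerSeries ε u) = 0 := by
  rw [← augmentation_reduceX]; rfl

/-- The local ring of `k⟦X⟧ ⊗ S` at the closed point of an augmentation. -/
def LocalPowerSeriesTensor (ε : S →ₐ[k] k) : Type _ := Localization.AtPrime (closedPointIdeal ε)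

noncomputable instance (ε : S →ₐ[k] k) : CommRing (LocalPowerSeriesTensor ε) :=
  inferInstanceAs (CommRing (Localization.AtPrime (closedPointIdeal ε)))

noncomputable instance (ε : S →ₐ[k] k) : Algebra (k⟦X⟧ ⊗[k] S) (LocalPowerSeriesTensor ε) :=
  inferInstanceAs (Algebra (k⟦X⟧ ⊗[k] S) (Localization.AtPrime (closedPointIdeal ε)))

instance (ε : S →ₐ[k] k) :
    IsLocalization.AtPrime (LocalPowerSeriesTensor ε) (closedPointIdeal ε) :=
  inferInstanceAs
    (IsLocalization.AtPrime (Localization.AtPrime (closedPointIdeal ε)) (closedPointIdeal ε))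

instance (ε : S →ₐ[k] k) : IsLocalRing (LocalPowerSeriesTensor ε) :=
  inferInstanceAs (IsLocalRing (Localization.AtPrime (closedPointIdeal ε)))

/-- Reduction of the local ring of `k⟦X⟧ ⊗ S` modulo `X`. -/
noncomputable def localReduceX (ε : S →ₐ[k] k) :
    LocalPowerSeriesTensor ε →+* Localization.AtPrime (RingHom.ker ε) :=
  Localization.localRingHom _ _ (reduceX k S : k⟦X⟧ ⊗[k] S →+* S) rfl

/-- The extension of `evalPowerSeries` to the local ring. -/
noncomputable def localEval (ε : S →ₐ[k] k) : LocalPowerSeriesTensor ε →+* k⟦X⟧ :=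
  IsLocalization.lift (M := (closedPointIdeal ε).primeCompl)
    (g := (evalPowerSeries ε : k⟦X⟧ ⊗[k] S →+* k⟦X⟧)) fun u => by
      rw [PowerSeries.isUnit_iff_constantCoeff, isUnit_iff_ne_zero]
      exact fun h => u.2 (mem_closedPointIdeal.mpr h)

variable (ε : S →ₐ[k] k)

local notation "ofU" => algebraMap (k⟦X⟧ ⊗[k] S) (LocalPowerSeriesTensor ε)

@[simp] theorem localEval_algebraMap (u : k⟦X⟧ ⊗[k] S) :
    localEval ε (ofU u) = evalPowerSeries ε u := by
  simp [localEval]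

@[simp] theorem localReduceX_algebraMap (u : k⟦X⟧ ⊗[k] S) :
    localReduceX ε (ofU u) = algebraMap S _ (reduceX k S u) :=
  Localization.localRingHom_to_map _ _ _ _ _

theorem isUnit_algebraMap_iff {u : k⟦X⟧ ⊗[k] S} :
    IsUnit (ofU u) ↔ constantCoeff (evalPowerSeries ε u) ≠ 0 := by
  rw [IsLocalization.AtPrime.isUnit_to_map_iff _ (closedPointIdeal ε), Ne, ← mem_closedPointIdeal]
  rfl

theorem localX_mem_nonZeroDivisors :
    ofU ((X : k⟦X⟧) ⊗ₜ 1) ∈ nonZeroDivisors (LocalPowerSeriesTensor ε) :=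
  IsLocalization.map_nonZeroDivisors_le (closedPointIdeal ε).primeCompl _
    ⟨_, X_tmul_mem_nonZeroDivisors, rfl⟩

theorem localReduceX_surjective : Function.Surjective (localReduceX ε) := by
  intro y
  obtain ⟨a, b, rfl⟩ := IsLocalization.exists_mk'_eq (RingHom.ker ε).primeCompl y
  have hb : IsUnit (ofU ((1 : k⟦X⟧) ⊗ₜ (b : S))) := by
    rw [isUnit_algebraMap_iff]
    simpa using fun h => b.2 h
  obtain ⟨c, hc⟩ := hb.exists_right_inv
  refine ⟨ofU (1 ⊗ₜ a) * c, ?_⟩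
  rw [IsLocalization.eq_mk'_iff_mul_eq]
  have : algebraMap S (Localization.AtPrime (RingHom.ker ε)) b
      = localReduceX ε (ofU ((1 : k⟦X⟧) ⊗ₜ (b : S))) := by simp
  rw [this, ← map_mul, mul_assoc, mul_comm c, hc]
  simp

theorem localReduceX_eq_zero_iff [IsDomain S] {f : LocalPowerSeriesTensor ε} :
    localReduceX ε f = 0 ↔ ofU ((X : k⟦X⟧) ⊗ₜ 1) ∣ f := by
  constructor
  · intro h
    obtain ⟨u, b, rfl⟩ := IsLocalization.exists_mk'_eq (closedPointIdeal ε).primeCompl f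
    have hu : reduceX k S u = 0 := by
      apply IsLocalization.injective (Localization.AtPrime (RingHom.ker ε))
        (RingHom.ker ε).primeCompl_le_nonZeroDivisors
      rw [map_zero, ← localReduceX_algebraMap, ← IsLocalization.mk'_spec _ u b, map_mul, h,
        zero_mul]
    obtain ⟨u', hu'⟩ := exists_eq_add_X_mul u
    rw [hu, tmul_zero, zero_add] at hu'
    exact ⟨IsLocalization.mk' _ u' b, by rw [hu', IsLocalization.mul_mk'_eq_mk'_of_mul]⟩
  · rintro ⟨c, rfl⟩
    simp

theorem isPrime_span_localX [IsDomain S] :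
    (Ideal.span {ofU ((X : k⟦X⟧) ⊗ₜ 1)}).IsPrime := by
  have : Ideal.span {ofU ((X : k⟦X⟧) ⊗ₜ 1)} = RingHom.ker (localReduceX ε) := by
    ext f
    rw [Ideal.mem_span_singleton, RingHom.mem_ker, localReduceX_eq_zero_iff]
  rw [this]
  have : IsDomain (Localization.AtPrime (RingHom.ker ε)) :=
    IsLocalization.isDomain_localization (RingHom.ker ε).primeCompl_le_nonZeroDivisors
  exact RingHom.ker_isPrime _

instance [Algebra.FiniteType k S] : IsNoetherianRing (k⟦X⟧ ⊗[k] S) :=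
  Algebra.FiniteType.isNoetherianRing k⟦X⟧ _

instance [Algebra.FiniteType k S] : IsNoetherianRing (LocalPowerSeriesTensor ε) :=
  IsLocalization.isNoetherianRing (closedPointIdeal ε).primeCompl _ inferInstance

/-- The homomorphism to `k⟦X⟧ ⊗ S` shifting each variable by elements of the two factors. -/
noncomputable def shiftHom (σ : ι → k⟦X⟧) (ρ : ι → S) : MvPolynomial ι k →ₐ[k] k⟦X⟧ ⊗[k] S :=
  MvPolynomial.aeval fun i => σ i ⊗ₜ 1 + 1 ⊗ₜ ρ i

variable {σ : ι → k⟦X⟧} {ρ : ι → S}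

theorem evalPowerSeries_shiftHom (hρ : ∀ i, ε (ρ i) = 0) (f : MvPolynomial ι k) :
    evalPowerSeries ε (shiftHom σ ρ f) = MvPolynomial.aeval σ f := by
  have : ((evalPowerSeries ε).restrictScalars k).comp (shiftHom σ ρ) = MvPolynomial.aeval σ := by
    ext i : 1
    simp [shiftHom, hρ]
  exact DFunLike.congr_fun this f

theorem flat_of_injective_to_field {R E : Type*} [CommRing R] [IsDomain R] [Field E] (f : R →+* E)
    (hf : Function.Injective f) : f.Flat := by
  have h : f = (IsFractionRing.lift hf : FractionRing R →+* E).comp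
      (algebraMap R (FractionRing R)) := by ext; simp
  rw [h]
  refine .comp ?_ (.of_isField (Field.toIsField _) _)
  rw [RingHom.flat_algebraMap_iff]
  infer_instance

theorem exists_pow_X_mul_eq_algebraMap (e : FractionRing k⟦X⟧) :
    ∃ (N : ℕ) (v : k⟦X⟧), algebraMap k⟦X⟧ _ (X ^ N) * e = algebraMap _ _ v := by
  obtain ⟨v, w, rfl⟩ := IsLocalization.exists_mk'_eq (nonZeroDivisors k⟦X⟧) e
  obtain ⟨N, c, hc⟩ : ∃ N, (w : k⟦X⟧) ∣ X ^ N := by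
    have hw := nonZeroDivisors.coe_ne_zero w
    obtain ⟨N, h⟩ := IsDiscreteValuationRing.associated_pow_irreducible hw
      PowerSeries.X_irreducible
    exact ⟨N, h.dvd⟩
  refine ⟨N, c * v, ?_⟩
  rw [hc, map_mul, map_mul, mul_comm, ← mul_assoc, IsLocalization.mk'_spec, mul_comm]

/-- The endomorphism of `k[ι] ⊗ S` shifting each variable by an element of `S`. -/
noncomputable def shiftEndomorphism (ρ : ι → S) :
    MvPolynomial ι k ⊗[k] S →ₐ[k] MvPolynomial ι k ⊗[k] S :=
  Algebra.TensorProduct.lift (MvPolynomial.aeval fun i => MvPolynomial.X i ⊗ₜ 1 + 1 ⊗ₜ ρ i)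
    Algebra.TensorProduct.includeRight fun _ _ => .all _ _

theorem shiftEndomorphism_comp (ρ ρ' : ι → S) (h : ∀ i, ρ i + ρ' i = 0) :
    (shiftEndomorphism (k := k) ρ).comp (shiftEndomorphism ρ') = AlgHom.id k _ := by
  ext i
  · simp [shiftEndomorphism, ← Algebra.TensorProduct.one_def, add_assoc, ← tmul_add, h]
  · simp [shiftEndomorphism]

theorem bijective_shiftEndomorphism (ρ : ι → S) :
    Function.Bijective (shiftEndomorphism (k := k) ρ) := by
  have h₁ := shiftEndomorphism_comp (k := k) ρ (-ρ) (by simp)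
  have h₂ := shiftEndomorphism_comp (k := k) (-ρ) ρ (by simp)
  exact Function.bijective_iff_has_inverse.mpr
    ⟨shiftEndomorphism (k := k) (-ρ), fun x => DFunLike.congr_fun h₂ x,
      fun x => DFunLike.congr_fun h₁ x⟩

variable (k S) in
/-- The inclusion of `k⟦X⟧ ⊗ S` into its base change to the fraction field of `k⟦X⟧`. -/
noncomputable def toFractionTensor : k⟦X⟧ ⊗[k] S →ₐ[k] FractionRing k⟦X⟧ ⊗[k] S :=
  Algebra.TensorProduct.map (Algebra.ofId k⟦X⟧ (FractionRing k⟦X⟧) |>.restrictScalars k)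
      (AlgHom.id k S)

theorem injective_toFractionTensor : Function.Injective (toFractionTensor k S) :=
  Module.Flat.rTensor_preserves_injective_linearMap (M := S)
    (Algebra.ofId k⟦X⟧ (FractionRing k⟦X⟧) |>.restrictScalars k).toLinearMap
    (IsFractionRing.injective k⟦X⟧ (FractionRing k⟦X⟧))

theorem flat_toFractionTensor_shiftHom (hσ : AlgebraicIndependent k σ) :
    ((toFractionTensor k S).comp (shiftHom σ ρ)).Flat := by
  have h : (toFractionTensor k S).comp (shiftHom σ ρ) =
      (Algebra.TensorProduct.map ((Algebra.ofId k⟦X⟧ (FractionRing k⟦X⟧) |>.restrictScalars k).comp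
        (MvPolynomial.aeval σ)) (AlgHom.id k S)).comp
      ((shiftEndomorphism ρ).comp Algebra.TensorProduct.includeLeft) := by
    ext i
    simp [shiftHom, shiftEndomorphism, toFractionTensor]
  have h₁ : (Algebra.TensorProduct.includeLeft :
      MvPolynomial ι k →ₐ[k] MvPolynomial ι k ⊗[k] S).toRingHom.Flat :=
    RingHom.flat_algebraMap_iff.mpr
      (inferInstanceAs (Module.Flat (MvPolynomial ι k) (MvPolynomial ι k ⊗[k] S)))
  have h₂ : (shiftEndomorphism (k := k) ρ).toRingHom.Flat :=
    .of_bijective (bijective_shiftEndomorphism ρ)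
  have h₃ : (Algebra.TensorProduct.map
      ((Algebra.ofId k⟦X⟧ (FractionRing k⟦X⟧) |>.restrictScalars k).comp
        (MvPolynomial.aeval σ)) (AlgHom.id k S)).toRingHom.Flat :=
    RingHom.Flat.tensorProductMap (flat_of_injective_to_field _
      ((IsFractionRing.injective k⟦X⟧ (FractionRing k⟦X⟧)).comp hσ)) (RingHom.Flat.id _)
  rw [h]
  exact (h₁.comp h₂).comp h₃

end PowerSeriesTensor

section FlatShift

open TensorProduct PowerSeries

variable {k S ι : Type*} [Field k] [CommRing S] [Algebra k S]

theorem RingHom.Flat.exists_of_sum_mul_eq_zero {R B : Type*} [CommRing R] [CommRing B] {f : R →+* B}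
    (hf : f.Flat) {l : ℕ} {g : Fin l → R} {x : Fin l → B} (h : ∑ i, f (g i) * x i = 0) :
    ∃ (n : ℕ) (a : Fin l → Fin n → R) (y : Fin n → B),
      (∀ i, x i = ∑ m, f (a i m) * y m) ∧ ∀ m, ∑ i, g i * a i m = 0 := by
  algebraize [f]
  exact Module.Flat.isTrivialRelation_of_sum_smul_eq_zero (f := g) (x := x) h

theorem exists_pow_X_mul_eq_toFractionTensor {n : ℕ} (y : Fin n → FractionRing k⟦X⟧ ⊗[k] S) :
    ∃ (N : ℕ) (z : Fin n → k⟦X⟧ ⊗[k] S),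
      ∀ m, toFractionTensor k S ((X ^ N : k⟦X⟧) ⊗ₜ 1) * y m = toFractionTensor k S (z m) := by
  have key : ∀ y : FractionRing k⟦X⟧ ⊗[k] S, ∃ (N : ℕ) (z : k⟦X⟧ ⊗[k] S),
      toFractionTensor k S ((X ^ N : k⟦X⟧) ⊗ₜ 1) * y = toFractionTensor k S z := by
    intro y
    induction y with
    | zero => exact ⟨0, 0, by simp⟩
    | tmul e s =>
      obtain ⟨N, v, hv⟩ := exists_pow_X_mul_eq_algebraMap e
      refine ⟨N, v ⊗ₜ s, ?_⟩
      simp only [toFractionTensor, Algebra.TensorProduct.map_tmul,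
        Algebra.TensorProduct.tmul_mul_tmul, AlgHom.restrictScalars_apply, Algebra.ofId_apply, hv]
      simp
    | add a b ha hb =>
      obtain ⟨N, z, hz⟩ := ha
      obtain ⟨N', z', hz'⟩ := hb
      refine ⟨N + N', (X ^ N') ⊗ₜ 1 * z + (X ^ N) ⊗ₜ 1 * z', ?_⟩
      have : (X ^ (N + N') : k⟦X⟧) ⊗ₜ[k] (1 : S) = (X ^ N) ⊗ₜ 1 * (X ^ N') ⊗ₜ 1 := by
        simp [pow_add]
      rw [this, map_add, map_mul, map_mul, map_mul, ← hz, ← hz']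
      ring
  choose N z hz using fun m => key (y m)
  refine ⟨∑ m, N m, fun m => (X ^ (∑ i ∈ Finset.univ.erase m, N i)) ⊗ₜ 1 * z m, fun m => ?_⟩
  have : (X ^ (∑ m, N m) : k⟦X⟧) ⊗ₜ[k] (1 : S)
      = (X ^ (∑ i ∈ Finset.univ.erase m, N i)) ⊗ₜ 1 * (X ^ N m) ⊗ₜ 1 := by
    rw [← Finset.sum_erase_add _ _ (Finset.mem_univ m)]
    simp [pow_add]
  rw [this, map_mul, map_mul, mul_assoc, hz]

variable (ε : S →ₐ[k] k) (σ : ι → k⟦X⟧) (ρ : ι → S)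

/-- The homomorphism `shiftHom` followed by localization. -/
noncomputable def localShift : MvPolynomial ι k →+* LocalPowerSeriesTensor ε :=
  (algebraMap (k⟦X⟧ ⊗[k] S) (LocalPowerSeriesTensor ε)).comp (shiftHom σ ρ : _ →+* _)

theorem localShift_apply (f : MvPolynomial ι k) :
    localShift ε σ ρ f = algebraMap _ (LocalPowerSeriesTensor ε) (shiftHom σ ρ f) := rfl

variable {σ ρ}

theorem shiftHom_X {i₀ : ι} (hσ₀ : σ i₀ = X) (hρ₀ : ρ i₀ = 0) :
    shiftHom σ ρ (MvPolynomial.X i₀) = X ⊗ₜ 1 := by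
  simp [shiftHom, hσ₀, hρ₀]

theorem exists_common_denominator {n : ℕ} (x : Fin n → LocalPowerSeriesTensor ε) :
    ∃ b ∉ closedPointIdeal ε, ∃ u : Fin n → k⟦X⟧ ⊗[k] S,
      ∀ i, algebraMap _ (LocalPowerSeriesTensor ε) b * x i = algebraMap _ _ (u i) := by
  obtain ⟨b, hb⟩ :=
    IsLocalization.exist_integer_multiples_of_finite (closedPointIdeal ε).primeCompl x
  choose u hu using hb
  exact ⟨b, b.2, u, fun i => by rw [hu, Algebra.smul_def]⟩

theorem localShift_trivialRelation (hσ : AlgebraicIndependent k σ) {i₀ : ι} (hσ₀ : σ i₀ = X)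
    (hρ₀ : ρ i₀ = 0) (l : ℕ) (g : Fin l → MvPolynomial ι k) (x : Fin l → LocalPowerSeriesTensor ε)
    (hgx : ∑ i, localShift ε σ ρ (g i) * x i = 0) :
    ∃ (N n : ℕ) (a : Fin l → Fin n → MvPolynomial ι k) (y : Fin n → LocalPowerSeriesTensor ε),
      (∀ i, localShift ε σ ρ (MvPolynomial.X i₀) ^ N * x i = ∑ m, localShift ε σ ρ (a i m) * y m) ∧
        ∀ m, ∑ i, g i * a i m = 0 := by
  obtain ⟨b, hb, u, hu⟩ := exists_common_denominator ε x
  obtain ⟨⟨c, hcm⟩, hc⟩ := (IsLocalization.eq_iff_exists (closedPointIdeal ε).primeCompl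
      (LocalPowerSeriesTensor ε) (x := ∑ i, shiftHom σ ρ (g i) * u i) (y := 0)).mp (by
    rw [map_zero, map_sum, ← mul_zero (algebraMap _ (LocalPowerSeriesTensor ε) b), ← hgx,
      Finset.mul_sum]
    exact Finset.sum_congr rfl fun i _ => by rw [map_mul, ← hu, localShift_apply]; ring)
  obtain ⟨n, a, y, hy, ha⟩ := (flat_toFractionTensor_shiftHom (ρ := ρ) hσ).exists_of_sum_mul_eq_zero
    (g := g) (x := fun i => toFractionTensor k S (c * u i)) (by
      have := congrArg (toFractionTensor k S) hc
      rw [mul_zero, map_zero, Finset.mul_sum, map_sum] at this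
      rw [← this]
      refine Finset.sum_congr rfl fun i _ => ?_
      rw [mul_left_comm, map_mul _ (shiftHom σ ρ (g i))]
      rfl)
  obtain ⟨N, z, hz⟩ := exists_pow_X_mul_eq_toFractionTensor y
  have hU : ∀ i, (X ^ N : k⟦X⟧) ⊗ₜ[k] (1 : S) * (c * u i)
      = ∑ m, shiftHom σ ρ (a i m) * z m := by
    intro i
    apply injective_toFractionTensor
    rw [map_mul, hy i, map_sum, Finset.mul_sum]
    refine Finset.sum_congr rfl fun m _ => ?_
    rw [map_mul, ← hz, mul_left_comm]
    rfl
  obtain ⟨w, hw⟩ := (((IsLocalization.map_units (LocalPowerSeriesTensor ε)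
      (⟨c, hcm⟩ : (closedPointIdeal ε).primeCompl)).mul
    (IsLocalization.map_units (LocalPowerSeriesTensor ε)
      (⟨b, hb⟩ : (closedPointIdeal ε).primeCompl)))).exists_right_inv
  refine ⟨N, n, a, fun m => w * algebraMap _ _ (z m), fun i => ?_, ha⟩
  have h := congrArg (algebraMap _ (LocalPowerSeriesTensor ε)) (hU i)
  rw [map_mul, map_mul, ← hu, map_sum] at h
  calc _ = localShift ε σ ρ (MvPolynomial.X i₀) ^ N * x i *
      (algebraMap _ (LocalPowerSeriesTensor ε) c * algebraMap _ (LocalPowerSeriesTensor ε) b * w) := by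
        rw [hw, mul_one]
    _ = w * (algebraMap _ (LocalPowerSeriesTensor ε) ((X ^ N : k⟦X⟧) ⊗ₜ[k] (1 : S)) *
        (algebraMap _ (LocalPowerSeriesTensor ε) c *
          (algebraMap _ (LocalPowerSeriesTensor ε) b * x i))) := by
        rw [localShift_apply, shiftHom_X hσ₀ hρ₀, ← map_pow, Algebra.TensorProduct.tmul_pow,
          one_pow]
        ring
    _ = _ := by
        rw [h, Finset.mul_sum]
        exact Finset.sum_congr rfl fun m _ => by rw [map_mul, localShift_apply]; ring

theorem exists_mem_fractionSubring_dvd_sub [IsDomain S] {i₀ : ι} (hσ₀ : σ i₀ = X)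
    (hρ₀ : ρ i₀ = 0) (hρ : ∀ s, ε s = 0 → ∃ i, ρ i = s) (f : LocalPowerSeriesTensor ε) :
    ∃ a ∈ fractionSubring (localShift ε σ ρ) (MvPolynomial.X i₀),
      localShift ε σ ρ (MvPolynomial.X i₀) ∣ f - a := by
  have hlift : ∀ s : S, ∃ g : MvPolynomial ι k, reduceX k S (shiftHom σ ρ g) = s := by
    intro s
    obtain ⟨i, hi⟩ := hρ (s - algebraMap k S (ε s)) (by simp)
    refine ⟨MvPolynomial.X i - MvPolynomial.C (constantCoeff (σ i)) + MvPolynomial.C (ε s), ?_⟩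
    have hC : ∀ c : k, reduceX k S (shiftHom σ ρ (MvPolynomial.C c)) = algebraMap k S c := by
      intro c
      rw [← MvPolynomial.algebraMap_eq, AlgHom.commutes, AlgHom.commutes]
    rw [map_add, map_add, map_sub, map_sub, hC, hC]
    simp [shiftHom, hi]
  obtain ⟨a, b, hab⟩ := IsLocalization.exists_mk'_eq (RingHom.ker ε).primeCompl (localReduceX ε f)
  obtain ⟨α, hα⟩ := hlift a
  obtain ⟨β, hβ⟩ := hlift b
  have hu : IsUnit (localShift ε σ ρ β) := by
    rw [localShift_apply, isUnit_algebraMap_iff, ← augmentation_reduceX, hβ]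
    exact fun h => b.2 h
  obtain ⟨w, hw⟩ := hu.exists_right_inv
  refine ⟨localShift ε σ ρ α * w, mul_mem (map_mem_fractionSubring _)
    (inv_mem_fractionSubring (map_mem_fractionSubring _) hw), ?_⟩
  rw [localShift_apply, shiftHom_X hσ₀ hρ₀, ← localReduceX_eq_zero_iff, map_sub, sub_eq_zero,
    ← hab, eq_comm, IsLocalization.eq_mk'_iff_mul_eq]
  rw [← hβ, ← hα, ← localReduceX_algebraMap, ← localReduceX_algebraMap, ← map_mul,
    ← localShift_apply, ← localShift_apply, mul_assoc, mul_comm w, hw, mul_one]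

theorem localEval_localShift (hρ : ∀ i, ε (ρ i) = 0) (f : MvPolynomial ι k) :
    localEval ε (localShift ε σ ρ f) = MvPolynomial.aeval σ f := by
  rw [localShift_apply, localEval_algebraMap, evalPowerSeries_shiftHom ε hρ]

theorem injective_localEval_comp_localShift (hσ : AlgebraicIndependent k σ)
    (hρ : ∀ i, ε (ρ i) = 0) : Function.Injective ((localEval ε).comp (localShift ε σ ρ)) := by
  have : ⇑((localEval ε).comp (localShift ε σ ρ)) = MvPolynomial.aeval σ :=
    funext (localEval_localShift ε hρ)
  rw [this]
  exact hσ

theorem localShift_X_mem_nonZeroDivisors {i₀ : ι} (hσ₀ : σ i₀ = X) (hρ₀ : ρ i₀ = 0) :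
    localShift ε σ ρ (MvPolynomial.X i₀) ∈ nonZeroDivisors (LocalPowerSeriesTensor ε) := by
  rw [localShift_apply, shiftHom_X hσ₀ hρ₀]
  exact localX_mem_nonZeroDivisors ε

theorem isPrime_span_localShift_X [IsDomain S] {i₀ : ι} (hσ₀ : σ i₀ = X) (hρ₀ : ρ i₀ = 0) :
    (Ideal.span {localShift ε σ ρ (MvPolynomial.X i₀)}).IsPrime := by
  rw [localShift_apply, shiftHom_X hσ₀ hρ₀]
  exact isPrime_span_localX ε

variable (σ ρ) in
/-- The subring of fractions `localShift g / localShift h` such that `h` divides a power of the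
image of the `i₀`-th variable. -/
noncomputable abbrev shiftFractions (i₀ : ι) : Subring (LocalPowerSeriesTensor ε) :=
  fractionSubring (localShift ε σ ρ) (MvPolynomial.X i₀)

theorem faithfullyFlat_shiftFractions [IsDomain S] (hσ : AlgebraicIndependent k σ)
    {i₀ : ι} (hσ₀ : σ i₀ = X) (hρ₀ : ρ i₀ = 0) (hρ : ∀ s, ε s = 0 → ∃ i, ρ i = s) :
    Module.FaithfullyFlat (shiftFractions ε σ ρ i₀) (LocalPowerSeriesTensor ε) := by
  have := flat_fractionSubring (j := localShift ε σ ρ) (t := MvPolynomial.X i₀)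
    (localShift_X_mem_nonZeroDivisors ε hσ₀ hρ₀)
    (exists_mem_fractionSubring_dvd_sub ε hσ₀ hρ₀ hρ)
    (localShift_trivialRelation ε hσ hσ₀ hρ₀)
  exact Module.FaithfullyFlat.of_flat_of_isLocalHom

end FlatShift

section FrobeniusPowers

theorem mem_of_mul_pow_mem_frobPow {U T A : Type*} [CommRing U] [CommRing T] [CommRing A]
    [Algebra U T] [Algebra A T] [Module.FaithfullyFlat A T] (M : Ideal U) [M.IsPrime]
    [IsLocalization.AtPrime T M] {q : ℕ} (φ : U →+ U) (hφ : ∀ a b, φ (a ^ q * b) = a * φ b)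
    {I : Ideal A} {c x : A} (hcx : c * x ^ q ∈ I.frobPow q)
    (hc : ∀ b ∉ M, ∀ c', algebraMap U T b * algebraMap A T c = algebraMap U T c' →
      ∃ w, φ (w * c') ∉ M) : x ∈ I := by
  have hunit : ∀ {b : U}, b ∉ M → IsUnit (algebraMap U T b) := fun {b} hb =>
    IsLocalization.map_units T (⟨b, hb⟩ : M.primeCompl)
  have hrep : ∀ z : T, ∃ b ∉ M, ∃ u, algebraMap U T b * z = algebraMap U T u := by
    intro z
    obtain ⟨⟨u, b⟩, h⟩ := IsLocalization.surj M.primeCompl z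
    exact ⟨b, b.2, u, by rw [mul_comm, h]⟩
  have hmul : ∀ {a b : U}, a ∉ M → b ∉ M → a * b ∉ M := fun ha hb =>
    M.primeCompl.mul_mem ha hb
  have key : ∀ z ∈ I.frobPow q, ∃ b ∉ M, ∃ u, algebraMap U T b * algebraMap A T z =
      algebraMap U T u ∧ ∀ d, algebraMap U T (φ (d * u)) ∈ I.map (algebraMap A T) := by
    intro z hz
    induction hz using Submodule.span_induction with
    | mem z hz =>
      obtain ⟨y, hy, rfl⟩ := hz
      obtain ⟨b, hb, u, h⟩ := hrep (algebraMap A T y)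
      refine ⟨b ^ q, M.primeCompl.pow_mem hb q, u ^ q, ?_, fun d => ?_⟩
      · rw [map_pow, map_pow, map_pow, ← h, mul_pow]
      · rw [mul_comm, hφ, map_mul, ← h]
        exact Ideal.mul_mem_right _ _ (Ideal.mul_mem_left _ _ (Ideal.mem_map_of_mem _ hy))
    | zero => exact ⟨1, M.primeCompl.one_mem, 0, by simp, fun d => by simp⟩
    | add y z _ _ hy hz =>
      obtain ⟨b, hb, u, h, hu⟩ := hy
      obtain ⟨b', hb', u', h', hu'⟩ := hz
      refine ⟨b * b', hmul hb hb', b' * u + b * u', ?_, fun d => ?_⟩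
      · rw [map_mul, map_add, map_add, map_mul, map_mul, ← h, ← h']; ring
      · rw [mul_add, map_add, map_add, ← mul_assoc, ← mul_assoc]
        exact add_mem (hu _) (hu' _)
    | smul a z _ hz =>
      obtain ⟨b, hb, u, h, hu⟩ := hz
      obtain ⟨b', hb', u', h'⟩ := hrep (algebraMap A T a)
      refine ⟨b' * b, hmul hb' hb, u' * u, ?_, fun d => ?_⟩
      · rw [map_mul, smul_eq_mul, map_mul, map_mul, ← h, ← h']; ring
      · rw [← mul_assoc]; exact hu _
  obtain ⟨b, hb, u, h, hu⟩ := key _ hcx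
  obtain ⟨s, hs, x', hx'⟩ := hrep (algebraMap A T x)
  obtain ⟨s', hs', c', hc'⟩ := hrep (algebraMap A T c)
  obtain ⟨⟨r, hr⟩, hrU⟩ := (IsLocalization.eq_iff_exists M.primeCompl T
    (x := b * c' * x' ^ q) (y := s ^ q * s' * u)).mp (by
      simp only [map_mul, map_pow, ← hx', ← hc', ← h]; ring)
  obtain ⟨w, hw⟩ := hc (r * b * s') (hmul (hmul hr hb) hs') (r * b * c') (by
    rw [map_mul _ (r * b) s', mul_assoc, hc', ← map_mul])
  have hx : algebraMap U T x' ∈ I.map (algebraMap A T) := by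
    have := hu (w * r * (s ^ q * s'))
    rw [show w * r * (s ^ q * s') * u = x' ^ q * (w * (r * b * c')) by
      linear_combination -w * hrU, hφ, map_mul] at this
    exact (Ideal.mul_unit_mem_iff_mem _ (hunit hw)).mp this
  rw [← hx'] at hx
  rw [← Ideal.comap_map_eq_self_of_faithfullyFlat (B := T) I]
  exact (Ideal.unit_mul_mem_iff_mem _ (hunit hs)).mp hx

end FrobeniusPowers

section FrobeniusSplitting

open PowerSeries TensorProduct

variable {k : Type*} [Field k]

/-- The linear map collecting the coefficients in degrees congruent to `n` modulo `q`. -/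
noncomputable def decimate (q n : ℕ) : k⟦X⟧ →ₗ[k] k⟦X⟧ where
  toFun f := PowerSeries.mk fun m => coeff (q * m + n) f
  map_add' f g := by ext; simp
  map_smul' c f := by ext; simp

theorem coeff_decimate (q n m : ℕ) (f : k⟦X⟧) :
    coeff m (decimate q n f) = coeff (q * m + n) f := by
  simp [decimate]

theorem decimate_X_pow {q n : ℕ} (hq : q ≠ 0) : decimate q n (X ^ n : k⟦X⟧) = 1 := by
  ext m
  rw [coeff_decimate, coeff_X_pow, coeff_one]
  simp [hq]

theorem decimate_expand_mul {q n : ℕ} (hq : q ≠ 0) (hn : n < q) (f g : k⟦X⟧) :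
    decimate q n (expand q hq f * g) = f * decimate q n g := by
  ext m
  rw [coeff_decimate, coeff_mul, coeff_mul]
  symm
  refine Finset.sum_of_injOn (fun x => (q * x.1, q * x.2 + n)) ?_ ?_ ?_ ?_
  · rintro ⟨a, b⟩ _ ⟨c, d⟩ _ h
    simpa [hq] using h
  · rintro ⟨a, b⟩ h
    simp only [Finset.mem_coe, Finset.HasAntidiagonal.mem_antidiagonal] at h ⊢
    rw [← h]; ring
  · rintro ⟨a, b⟩ h h'
    rw [Finset.HasAntidiagonal.mem_antidiagonal] at h
    rw [coeff_expand, if_neg, zero_mul]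
    rintro ⟨c, hc⟩
    subst hc
    have hcm : c ≤ m := by
      by_contra! hlt
      have : q * (m + 1) ≤ q * c := Nat.mul_le_mul_left q hlt
      simp only at h
      rw [mul_add] at this
      omega
    obtain ⟨d, rfl⟩ := Nat.exists_eq_add_of_le hcm
    refine h' ⟨(c, d), by simp, ?_⟩
    simp only [mul_add] at h ⊢
    congr 1
    omega
  · rintro ⟨a, b⟩ _
    simp only [coeff_decimate]
    rw [coeff_expand_mul]

variable {p : ℕ} [hp : Fact p.Prime]

theorem expand_pow_eq_pow (e : ℕ) (f : (ZMod p)⟦X⟧) :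
    expand (p ^ e) (pow_ne_zero e hp.out.ne_zero) f = f ^ p ^ e := by
  have h := MvPowerSeries.map_iterateFrobenius_expand p hp.out.ne_zero f e
  have hid : iterateFrobenius (ZMod p) p e = RingHom.id _ :=
    RingHom.ext fun x => by rw [iterateFrobenius_def, ZMod.pow_card_pow, RingHom.id_apply]
  rwa [hid, MvPowerSeries.map_id] at h

theorem decimate_pow_mul {e n : ℕ} (hn : n < p ^ e) (f g : (ZMod p)⟦X⟧) :
    decimate (p ^ e) n (f ^ p ^ e * g) = f * decimate (p ^ e) n g := by
  rw [← expand_pow_eq_pow, decimate_expand_mul _ hn]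

variable {S : Type*} [CommRing S] [Algebra (ZMod p) S]

theorem evalPowerSeries_map_decimate {ε : S →ₐ[ZMod p] ZMod p} {Φ : S →ₗ[ZMod p] S}
    (hΦ : ∀ s, ε (Φ s) = ε s) (q n : ℕ) (u : (ZMod p)⟦X⟧ ⊗[ZMod p] S) :
    evalPowerSeries ε (TensorProduct.map (decimate q n) Φ u) =
      decimate q n (evalPowerSeries ε u) := by
  induction u with
  | zero => simp
  | tmul v s =>
    rw [map_tmul, evalPowerSeries_tmul, evalPowerSeries_tmul, hΦ, mul_comm, mul_comm v,
      ← smul_eq_C_mul, ← smul_eq_C_mul, map_smul]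
  | add a b ha hb => simp [ha, hb]

theorem map_decimate_pow_mul [CharP ((ZMod p)⟦X⟧ ⊗[ZMod p] S) p] {e n : ℕ} (hn : n < p ^ e)
    {Φ : S →ₗ[ZMod p] S} (hΦ : ∀ a b, Φ (a ^ p ^ e * b) = a * Φ b)
    (a b : (ZMod p)⟦X⟧ ⊗[ZMod p] S) :
    TensorProduct.map (decimate (p ^ e) n) Φ (a ^ p ^ e * b) =
      a * TensorProduct.map (decimate (p ^ e) n) Φ b := by
  induction a with
  | zero => simp [hp.out.ne_zero]
  | add a a' h h' => rw [add_pow_char_pow, add_mul, add_mul, map_add, h, h']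
  | tmul v s =>
    rw [Algebra.TensorProduct.tmul_pow]
    induction b with
    | zero => simp
    | add b b' h h' => rw [mul_add, map_add, map_add, mul_add, h, h']
    | tmul w r =>
      rw [Algebra.TensorProduct.tmul_mul_tmul, map_tmul, map_tmul, decimate_pow_mul hn, hΦ,
        Algebra.TensorProduct.tmul_mul_tmul]

theorem charP_powerSeries_tensor (ε : S →ₐ[ZMod p] ZMod p) :
    CharP ((ZMod p)⟦X⟧ ⊗[ZMod p] S) p := by
  have : Nontrivial ((ZMod p)⟦X⟧ ⊗[ZMod p] S) :=
    (evalPowerSeries ε : _ →+* (ZMod p)⟦X⟧).domain_nontrivial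
  exact charP_of_injective_algebraMap (algebraMap (ZMod p) _).injective p

/-- Weak F-regularity of the ring of fractions, from splittings of the Frobenius powers. -/
theorem weaklyFRegular_of_splitting (ε : S →ₐ[ZMod p] ZMod p)
    (Φ : ℕ → S →ₗ[ZMod p] S) (hΦ : ∀ e a b, Φ e (a ^ p ^ e * b) = a * Φ e b)
    (hΦε : ∀ e s, ε (Φ e s) = ε s) (A : Subring (LocalPowerSeriesTensor ε)) [IsDomain A]
    [Module.FaithfullyFlat A (LocalPowerSeriesTensor ε)]
    (hA : ∀ a ∈ A, localEval ε a = 0 → a = 0) : WeaklyFRegular A p := by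
  have := charP_powerSeries_tensor ε
  rintro I x ⟨c, hc, E, hE⟩
  have hc0 : localEval ε c ≠ 0 := by
    refine fun h => hc ⊥ ?_ (Subtype.ext (hA c c.2 h))
    rw [IsDomain.minimalPrimes_eq_singleton_bot]
    rfl
  obtain ⟨n, v, hv⟩ := IsDiscreteValuationRing.eq_unit_mul_pow_irreducible hc0 X_irreducible
  have hn : n < p ^ max E n :=
    (Nat.lt_pow_self hp.out.one_lt).trans_le (Nat.pow_le_pow_right hp.out.pos (le_max_right E n))
  refine mem_of_mul_pow_mem_frobPow (T := LocalPowerSeriesTensor ε) (closedPointIdeal ε)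
    (TensorProduct.map (decimate (p ^ max E n) n) (Φ (max E n))).toAddMonoidHom
    (map_decimate_pow_mul hn (hΦ _)) (hE _ (le_max_left E n)) fun b hb c' hbc => ?_
  have hbu : IsUnit (evalPowerSeries ε b) := by
    rw [PowerSeries.isUnit_iff_constantCoeff, isUnit_iff_ne_zero]
    exact fun h => hb (mem_closedPointIdeal.mpr h)
  have h := congrArg (localEval ε) hbc
  rw [map_mul, localEval_algebraMap, localEval_algebraMap] at h
  change _ * localEval ε (c : LocalPowerSeriesTensor ε) = _ at h
  rw [hv] at h
  obtain ⟨w, hw⟩ := (hbu.mul v.isUnit).exists_left_inv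
  refine ⟨w ⊗ₜ 1, fun hmem => ?_⟩
  rw [mem_closedPointIdeal, LinearMap.toAddMonoidHom_coe, evalPowerSeries_map_decimate (hΦε _),
    map_mul, ← h, evalPowerSeries_tmul, map_one, map_one, mul_one, ← mul_assoc, ← mul_assoc,
    mul_assoc w, hw, one_mul, decimate_X_pow (pow_ne_zero _ hp.out.ne_zero)] at hmem
  simp at hmem

end FrobeniusSplitting

section Depth

open PowerSeries TensorProduct RingTheory.Sequence

theorem exists_regular_pair_of_dvd {T V : Type*} [CommRing T] [IsLocalRing T] [IsNoetherianRing T]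
    [CommRing V] (π : T →+* V) (hπ : Function.Surjective π) {a b c : T}
    (ha : a ∈ maximalIdeal T) (hb : b ∈ maximalIdeal T) (hc : c ∈ maximalIdeal T)
    (h : IsWeaklyRegular T [a, b, c]) (hca : π c ∣ π a) (hcb : π c ∣ π b) :
    ∃ x y : T, π x = 0 ∧ π y = 0 ∧ (∀ z, x * z = 0 → z = 0) ∧ ∀ z, x ∣ y * z → x ∣ z := by
  obtain ⟨v, hv⟩ := hca
  obtain ⟨w, hw⟩ := hcb
  obtain ⟨v, rfl⟩ := hπ v
  obtain ⟨w, rfl⟩ := hπ w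
  have h₁ : IsWeaklyRegular T [c, a, b] :=
    isWeaklyRegular_of_perm_of_subset_maximalIdeal h (List.perm_append_comm (l₁ := [a, b])) (by
      simp only [List.mem_cons, List.not_mem_nil, or_false, forall_eq_or_imp, forall_eq]
      exact ⟨ha, hb, hc⟩)
  have h₂ : IsWeaklyRegular T [c, a - c * v, b - c * w] := by
    rw [isWeaklyRegular_cons_iff'] at h₁ ⊢
    have hmk : Ideal.Quotient.mk (Ideal.span {c}) c = 0 :=
      Ideal.Quotient.eq_zero_iff_mem.mpr (Ideal.mem_span_singleton_self c)
    simpa [hmk] using h₁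
  have h₃ : IsWeaklyRegular T [a - c * v, b - c * w, c] :=
    isWeaklyRegular_of_perm_of_subset_maximalIdeal h₂
      (List.perm_append_comm (l₁ := [c]) (l₂ := [a - c * v, b - c * w])) (by
        simp only [List.mem_cons, List.not_mem_nil, or_false, forall_eq_or_imp, forall_eq]
        exact ⟨hc, sub_mem ha (Ideal.mul_mem_right _ _ hc),
          sub_mem hb (Ideal.mul_mem_right _ _ hc)⟩)
  rw [isWeaklyRegular_cons_iff, isWeaklyRegular_cons_iff] at h₃
  refine ⟨a - c * v, b - c * w, by simp [hv], by simp [hw], fun z hz => ?_, fun z hz => ?_⟩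
  · exact h₃.1.right_eq_zero_of_smul hz
  · have := (isSMulRegular_quotient_iff_mem_of_smul_mem _ _).mp h₃.2.1 z
    rw [Submodule.mem_smul_pointwise_iff_exists, Submodule.mem_smul_pointwise_iff_exists] at this
    obtain ⟨u, hu⟩ := hz
    obtain ⟨u', -, hu'⟩ := this ⟨u, trivial, hu.symm⟩
    exact ⟨u', hu'.symm⟩

theorem exists_regular_pair {T V : Type*} [CommRing T] [IsLocalRing T] [IsNoetherianRing T]
    [CommRing V] [IsDomain V] [ValuationRing V] (π : T →+* V) (hπ : Function.Surjective π)
    {a b c : T} (ha : a ∈ maximalIdeal T) (hb : b ∈ maximalIdeal T) (hc : c ∈ maximalIdeal T)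
    (h : IsWeaklyRegular T [a, b, c]) :
    ∃ x y : T, π x = 0 ∧ π y = 0 ∧ (∀ z, x * z = 0 → z = 0) ∧ ∀ z, x ∣ y * z → x ∣ z := by
  have hmem : ∀ r ∈ [a, b, c], r ∈ maximalIdeal T := by
    simp only [List.mem_cons, List.not_mem_nil, or_false, forall_eq_or_imp, forall_eq]
    exact ⟨ha, hb, hc⟩
  have hbca : IsWeaklyRegular T [b, c, a] :=
    isWeaklyRegular_of_perm_of_subset_maximalIdeal h (List.perm_append_comm (l₁ := [a])) hmem
  have hcab : IsWeaklyRegular T [c, a, b] :=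
    isWeaklyRegular_of_perm_of_subset_maximalIdeal h (List.perm_append_comm (l₁ := [a, b])) hmem
  rcases ValuationRing.dvd_total (π a) (π b) with hab | hba
  · rcases ValuationRing.dvd_total (π a) (π c) with hac | hca
    · exact exists_regular_pair_of_dvd π hπ hb hc ha hbca hab hac
    · exact exists_regular_pair_of_dvd π hπ ha hb hc h hca (hca.trans hab)
  · rcases ValuationRing.dvd_total (π b) (π c) with hbc | hcb
    · exact exists_regular_pair_of_dvd π hπ hc ha hb hcab hbc hba
    · exact exists_regular_pair_of_dvd π hπ ha hb hc h (hcb.trans hba) hcb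

variable {k S ι : Type*} [Field k] [CommRing S] [Algebra k S] {ε : S →ₐ[k] k}

theorem lTensor_mul_sub {μ : S →ₗ[k] S}
    (hμ : ∀ a b, μ a * (b - algebraMap k S (ε b)) = (a - algebraMap k S (ε a)) * μ b)
    (α β : k⟦X⟧ ⊗[k] S) :
    μ.lTensor k⟦X⟧ α * (β - evalPowerSeries ε β ⊗ₜ 1) =
      (α - evalPowerSeries ε α ⊗ₜ 1) * μ.lTensor k⟦X⟧ β := by
  have hsub : ∀ (v : k⟦X⟧) (s : S), v ⊗ₜ[k] s - evalPowerSeries ε (v ⊗ₜ[k] s) ⊗ₜ 1 =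
      v ⊗ₜ[k] (s - algebraMap k S (ε s)) := by
    intro v s
    rw [evalPowerSeries_tmul, mul_comm, ← smul_eq_C_mul, smul_tmul, tmul_sub,
      Algebra.algebraMap_eq_smul_one]
  induction α with
  | zero => simp
  | add α α' h h' =>
    rw [map_add, add_mul, h, h', map_add, add_tmul]
    ring
  | tmul v a =>
    induction β with
    | zero => simp
    | add β β' h h' =>
      rw [map_add, map_add, add_tmul, mul_add, ← h, ← h']
      ring
    | tmul w b =>
      rw [hsub, hsub, LinearMap.lTensor_tmul, LinearMap.lTensor_tmul,
        Algebra.TensorProduct.tmul_mul_tmul, Algebra.TensorProduct.tmul_mul_tmul, hμ]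

variable (ε)

theorem localEval_surjective : Function.Surjective (localEval ε) := fun v =>
  ⟨algebraMap (k⟦X⟧ ⊗[k] S) _ (v ⊗ₜ 1), by simp⟩

/-- A homothety-like endomorphism of the augmentation ideal that is not a multiplication obstructs
depth three. -/
theorem not_isWeaklyRegular_triple [IsDomain S] [Algebra.FiniteType k S] {μ : S →ₗ[k] S}
    (hμ : ∀ a b, μ a * (b - algebraMap k S (ε b)) = (a - algebraMap k S (ε a)) * μ b)
    {x : S} (hx : ε x = 0) (hμx : ∀ d n, d * μ x = n * x → ε d = 0)
    {a b c : LocalPowerSeriesTensor ε} (ha : a ∈ maximalIdeal (LocalPowerSeriesTensor ε))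
    (hb : b ∈ maximalIdeal (LocalPowerSeriesTensor ε))
    (hc : c ∈ maximalIdeal (LocalPowerSeriesTensor ε)) :
    ¬ IsWeaklyRegular (LocalPowerSeriesTensor ε) [a, b, c] := by
  intro h
  obtain ⟨y, z, hy, hz, hreg, hreg'⟩ :=
    exists_regular_pair (localEval ε) (localEval_surjective ε) ha hb hc h
  obtain ⟨s, hs, β, hβ⟩ := exists_common_denominator ε ![y, z]
  have hβ₀ : algebraMap _ (LocalPowerSeriesTensor ε) s * y = algebraMap _ _ (β 0) := hβ 0
  have hβ₁ : algebraMap _ (LocalPowerSeriesTensor ε) s * z = algebraMap _ _ (β 1) := hβ 1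
  have hsu : IsUnit (algebraMap _ (LocalPowerSeriesTensor ε) s) :=
    IsLocalization.map_units _ (⟨s, hs⟩ : (closedPointIdeal ε).primeCompl)
  have hε₀ : evalPowerSeries ε (β 0) = 0 := by
    rw [← localEval_algebraMap, ← hβ₀, map_mul, hy, mul_zero]
  have hε₁ : evalPowerSeries ε (β 1) = 0 := by
    rw [← localEval_algebraMap, ← hβ₁, map_mul, hz, mul_zero]
  have h₁ := congrArg (algebraMap _ (LocalPowerSeriesTensor ε)) (lTensor_mul_sub hμ (β 0) (β 1))
  have h₂ := congrArg (algebraMap _ (LocalPowerSeriesTensor ε))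
    (lTensor_mul_sub hμ (β 0) (1 ⊗ₜ x))
  rw [hε₀, hε₁, zero_tmul, sub_zero, sub_zero, map_mul, map_mul, ← hβ₀, ← hβ₁] at h₁
  rw [hε₀, evalPowerSeries_tmul, hx, map_zero, mul_zero, zero_tmul, sub_zero, sub_zero, map_mul,
    map_mul, ← hβ₀, LinearMap.lTensor_tmul] at h₂
  obtain ⟨g, hg⟩ := hreg' (algebraMap _ _ (μ.lTensor k⟦X⟧ (β 0)))
    ⟨algebraMap _ _ (μ.lTensor k⟦X⟧ (β 1)), hsu.mul_left_cancel (by linear_combination h₁)⟩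
  have h₃ : algebraMap _ (LocalPowerSeriesTensor ε) s * algebraMap _ _ ((1 : k⟦X⟧) ⊗ₜ[k] μ x) =
      g * algebraMap _ _ ((1 : k⟦X⟧) ⊗ₜ[k] x) := by
    refine sub_eq_zero.mp (hreg _ ?_)
    rw [hg] at h₂
    linear_combination -h₂
  have h₄ := congrArg (localReduceX ε) h₃
  simp only [map_mul, localReduceX_algebraMap, reduceX_tmul, map_one, one_mul] at h₄
  obtain ⟨n, d, hnd⟩ := IsLocalization.exists_mk'_eq (RingHom.ker ε).primeCompl (localReduceX ε g)
  have hinj := IsLocalization.injective (Localization.AtPrime (RingHom.ker ε))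
        (RingHom.ker ε).primeCompl_le_nonZeroDivisors
  have h₅ : (d * reduceX k S s) * μ x = n * x := by
    apply hinj
    rw [map_mul, map_mul, mul_assoc, h₄, map_mul, ← IsLocalization.mk'_spec' _ n d, hnd]
    ring
  have h₆ := hμx _ _ h₅
  rw [map_mul, mul_eq_zero] at h₆
  refine h₆.elim (fun h => d.2 h) fun h => hs ?_
  rwa [mem_closedPointIdeal, ← augmentation_reduceX]

variable {σ : ι → k⟦X⟧} {ρ : ι → S}

theorem height_add_one_le_ringKrullDim_shiftFractions [IsDomain S] {i₀ : ι} (hσ₀ : σ i₀ = X)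
    (hρ₀ : ρ i₀ = 0) (hρ : ∀ s, ε s = 0 → ∃ i, ρ i = s) :
    ((RingHom.ker ε).height : WithBot ℕ∞) + 1 ≤ ringKrullDim (shiftFractions ε σ ρ i₀) := by
  rw [← IsLocalization.AtPrime.ringKrullDim_eq_height _ (Localization.AtPrime (RingHom.ker ε))]
  refine ringKrullDim_succ_le_of_surjective
    ((localReduceX ε).comp (shiftFractions ε σ ρ i₀).subtype) (fun y => ?_)
    (r := ⟨_, map_mem_fractionSubring (MvPolynomial.X i₀)⟩) ?_ ?_
  · obtain ⟨f, rfl⟩ := localReduceX_surjective ε y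
    obtain ⟨a, ha, hfa⟩ := exists_mem_fractionSubring_dvd_sub ε hσ₀ hρ₀ hρ f
    refine ⟨⟨a, ha⟩, ?_⟩
    rw [localShift_apply, shiftHom_X hσ₀ hρ₀, ← localReduceX_eq_zero_iff, map_sub,
      sub_eq_zero] at hfa
    exact hfa.symm
  · rw [mem_nonZeroDivisors_iff_right]
    intro a ha
    exact Subtype.ext ((mem_nonZeroDivisors_iff_right.mp
      (localShift_X_mem_nonZeroDivisors ε hσ₀ hρ₀)) _ (congrArg Subtype.val ha))
  · change localReduceX ε (localShift ε σ ρ (MvPolynomial.X i₀)) = 0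
    rw [localShift_apply, shiftHom_X hσ₀ hρ₀, localReduceX_eq_zero_iff]

theorem not_isCohenMacaulayLocal_shiftFractions [IsDomain S] [Algebra.FiniteType k S]
    (hσ : AlgebraicIndependent k σ) {i₀ : ι} (hσ₀ : σ i₀ = X) (hρ₀ : ρ i₀ = 0)
    (hρ : ∀ s, ε s = 0 → ∃ i, ρ i = s) {μ : S →ₗ[k] S}
    (hμ : ∀ a b, μ a * (b - algebraMap k S (ε b)) = (a - algebraMap k S (ε a)) * μ b)
    {x : S} (hx : ε x = 0) (hμx : ∀ d n, d * μ x = n * x → ε d = 0)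
    (hheight : 2 ≤ (RingHom.ker ε).height) :
    ¬ IsCohenMacaulayLocal (shiftFractions ε σ ρ i₀) := by
  rintro ⟨rs, hrs, hreg, hlen⟩
  have hdim : 3 ≤ rs.length := by
    suffices h : ((3 : ℕ) : WithBot ℕ∞) ≤ (rs.length : ℕ) by exact_mod_cast h
    have h := height_add_one_le_ringKrullDim_shiftFractions ε hσ₀ hρ₀ hρ
    refine le_trans ?_ (h.trans_eq hlen.symm)
    have h2 : ((2 : ℕ∞) : WithBot ℕ∞) ≤ (RingHom.ker ε).height := WithBot.coe_le_coe.mpr hheight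
    calc ((3 : ℕ) : WithBot ℕ∞) = ((2 : ℕ∞) : WithBot ℕ∞) + 1 := by norm_num
      _ ≤ _ := by gcongr
  have := faithfullyFlat_shiftFractions ε hσ hσ₀ hρ₀ hρ
  match rs with
  | [] | [_] | [_, _] => simp at hdim
  | a :: b :: c :: l =>
    have h := (isWeaklyRegular_append_iff _ [a, b, c] l).mp hreg.toIsWeaklyRegular
    have h' := h.1.of_flat (S := LocalPowerSeriesTensor ε)
    have hmem : ∀ r ∈ maximalIdeal (shiftFractions ε σ ρ i₀),
        algebraMap _ (LocalPowerSeriesTensor ε) r ∈ maximalIdeal (LocalPowerSeriesTensor ε) :=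
      fun r hr => by
        rw [mem_maximalIdeal, mem_nonunits_iff] at hr ⊢
        exact fun hu => hr (isUnit_of_map_unit (algebraMap _ (LocalPowerSeriesTensor ε)) r hu)
    exact not_isWeaklyRegular_triple ε hμ hx hμx (hmem a (hrs a (by simp)))
      (hmem b (hrs b (by simp))) (hmem c (hrs c (by simp))) h'

end Depth

section IndependentPowerSeries

open PowerSeries Cardinal

theorem transcendental_powerSeries_X (k : Type*) [Field k] : Transcendental k (X : k⟦X⟧) := by
  rw [transcendental_iff_injective]
  have : ⇑(Polynomial.aeval (R := k) (X : k⟦X⟧)) = ((↑) : Polynomial k → k⟦X⟧) := by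
    have h : Polynomial.aeval (R := k) (X : k⟦X⟧) = Polynomial.coeToPowerSeries.algHom k := by
      ext1
      simp
    ext1 f
    rw [h]
    simp
  rw [this]
  exact Polynomial.coe_injective k

theorem uncountable_powerSeries (k : Type*) [Field k] : Uncountable k⟦X⟧ := by
  classical
  have hinj : Function.Injective
      (fun s : Set ℕ => (PowerSeries.mk fun n => if n ∈ s then 1 else 0 : k⟦X⟧)) := by
    intro s t h
    ext n
    have := congrArg (coeff n) h
    simp only [coeff_mk] at this
    by_cases hs : n ∈ s <;> by_cases ht : n ∈ t <;> simp_all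
  have : Uncountable (Set ℕ) := by
    rw [← aleph0_lt_mk_iff, mk_set, mk_nat]
    exact cantor _
  exact hinj.uncountable

theorem uncountable_of_isTranscendenceBasis {k : Type*} [Field k] [Countable k] {t : Set k⟦X⟧}
    (ht : IsTranscendenceBasis k ((↑) : t → k⟦X⟧)) : Uncountable t := by
  by_contra h
  rw [not_uncountable_iff] at h
  have := ht.isAlgebraic
  have hle := Algebra.IsAlgebraic.cardinalMk_le_max (Algebra.adjoin k (Set.range ((↑) : t → k⟦X⟧)))
    k⟦X⟧
  have hcount : Countable (Algebra.adjoin k (Set.range ((↑) : t → k⟦X⟧))) := by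
    have : Countable (MvPolynomial t k) := by
      rw [← mk_le_aleph0_iff]
      exact MvPolynomial.cardinalMk_le_max.trans (by simp)
    exact ht.1.aevalEquiv.surjective.countable
  have := uncountable_powerSeries k
  rw [← aleph0_lt_mk_iff] at this
  exact absurd (hle.trans (max_le (mk_le_aleph0_iff.mpr hcount) le_rfl)) this.not_ge

theorem exists_algebraicIndependent_powerSeries (k S : Type*) [Field k] [Countable k]
    [Countable S] : ∃ σ : Option S → k⟦X⟧, AlgebraicIndependent k σ ∧ σ none = X := by
  obtain ⟨t, hXt, ht⟩ := exists_isTranscendenceBasis_superset (R := k) (s := {(X : k⟦X⟧)}) (by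
    exact (algebraicIndependent_unique_type_iff (ι := ({(X : k⟦X⟧)} : Set k⟦X⟧))).mpr
      (transcendental_powerSeries_X k))
  have := uncountable_of_isTranscendenceBasis ht
  let x : t := ⟨X, hXt rfl⟩
  have hinf : Infinite ({x}ᶜ : Set t) := (Set.finite_singleton x).infinite_compl.to_subtype
  obtain ⟨f, hf⟩ := exists_injective_nat S
  let g : S ↪ t :=
    (⟨f, hf⟩ : S ↪ ℕ).trans ((Infinite.natEmbedding ({x}ᶜ : Set t)).trans (.subtype _))
  have hg : x ∉ Set.range g := by
    rintro ⟨s, hs⟩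
    exact (Infinite.natEmbedding ({x}ᶜ : Set t) (f s)).2 hs
  exact ⟨_, ht.1.comp (g.optionElim x hg) (g.optionElim x hg).injective, rfl⟩

end IndependentPowerSeries

section Contraction

open MvPolynomial

variable {τ L : Type*} [Field L]

open Classical in
/-- The linear map dividing exponents by `q`, killing monomials which are not `q`-th powers. -/
noncomputable def contractExponents (τ L : Type*) [Field L] (q : ℕ) :
    MvPolynomial τ L →ₗ[L] MvPolynomial τ L :=
  (basisMonomials τ L).constr L fun t =>
    if h : ∃ s, t = q • s then monomial h.choose 1 else 0

theorem contractExponents_monomial_smul {q : ℕ} (hq : q ≠ 0) (s : τ →₀ ℕ) (c : L) :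
    contractExponents τ L q (monomial (q • s) c) = monomial s c := by
  have h : ∃ s', q • s = q • s' := ⟨s, rfl⟩
  have hs : h.choose = s := by
    ext i
    have := DFunLike.congr_fun h.choose_spec i
    exact Nat.eq_of_mul_eq_mul_left (Nat.pos_of_ne_zero hq) this.symm
  have h₁ : contractExponents τ L q (monomial (q • s) 1) = monomial s 1 := by
    rw [contractExponents, ← congrFun (coe_basisMonomials τ L), Module.Basis.constr_basis,
      dif_pos h, hs]
  rw [← mul_one c, ← smul_eq_mul, ← smul_monomial, map_smul, h₁, smul_monomial]

theorem contractExponents_monomial_of_not {q : ℕ} {t : τ →₀ ℕ} (ht : ¬∃ s, t = q • s) (c : L) :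
    contractExponents τ L q (monomial t c) = 0 := by
  have h₁ : contractExponents τ L q (monomial t 1) = 0 := by
    rw [contractExponents, ← congrFun (coe_basisMonomials τ L), Module.Basis.constr_basis,
      dif_neg ht]
  rw [← mul_one c, ← smul_eq_mul, ← smul_monomial, map_smul, h₁, smul_zero]

theorem contractExponents_expand_mul {q : ℕ} (hq : q ≠ 0) (f g : MvPolynomial τ L) :
    contractExponents τ L q (expand q f * g) = f * contractExponents τ L q g := by
  induction f using MvPolynomial.induction_on' with
  | add f f' h h' => rw [map_add, add_mul, map_add, h, h', add_mul]
  | monomial s c =>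
    rw [expand_monomial]
    induction g using MvPolynomial.induction_on' with
    | add g g' h h' => rw [mul_add, map_add, map_add, h, h', mul_add]
    | monomial t d =>
      rw [monomial_mul]
      by_cases ht : ∃ u, t = q • u
      · obtain ⟨u, rfl⟩ := ht
        rw [← smul_add, contractExponents_monomial_smul hq, contractExponents_monomial_smul hq,
          monomial_mul]
      · rw [contractExponents_monomial_of_not ht, mul_zero, contractExponents_monomial_of_not]
        rintro ⟨u, hu⟩
        refine ht ⟨u - s, Finsupp.ext fun i => ?_⟩
        have hi : q * s i + t i = q * u i := DFunLike.congr_fun hu i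
        change t i = q * (u i - s i)
        rw [Nat.mul_sub]
        omega

theorem constantCoeff_contractExponents {q : ℕ} (hq : q ≠ 0) (f : MvPolynomial τ L) :
    constantCoeff (contractExponents τ L q f) = constantCoeff f := by
  classical
  induction f using MvPolynomial.induction_on' with
  | add f f' h h' => rw [map_add, map_add, map_add, h, h']
  | monomial t c =>
    by_cases ht : ∃ u, t = q • u
    · obtain ⟨u, rfl⟩ := ht
      rw [contractExponents_monomial_smul hq, constantCoeff_monomial, constantCoeff_monomial]
      simp [hq]
    · rw [contractExponents_monomial_of_not ht, map_zero, constantCoeff_monomial, if_neg]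
      rintro rfl
      exact ht ⟨0, (smul_zero q).symm⟩

variable (p : ℕ) [hp : Fact p.Prime] [CharP L p] [PerfectRing L p]

/-- A splitting of the `e`-th iterate of the Frobenius endomorphism of a polynomial ring. -/
noncomputable def frobeniusSplitting (τ L : Type*) [Field L] [CharP L p] [PerfectRing L p]
    (e : ℕ) : MvPolynomial τ L →+ MvPolynomial τ L :=
  (map (iterateFrobeniusEquiv L p e).symm.toRingHom).toAddMonoidHom.comp
    (contractExponents τ L (p ^ e)).toAddMonoidHom

theorem frobeniusSplitting_pow_mul (e : ℕ) (f g : MvPolynomial τ L) :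
    frobeniusSplitting p τ L e (f ^ p ^ e * g) = f * frobeniusSplitting p τ L e g := by
  have hcomp : ((iterateFrobeniusEquiv L p e).symm.toRingHom).comp (iterateFrobenius L p e) =
      RingHom.id L :=
    RingHom.ext fun x => (iterateFrobeniusEquiv L p e).symm_apply_apply x
  change map (iterateFrobeniusEquiv L p e).symm.toRingHom (contractExponents τ L _ _) =
    f * map (iterateFrobeniusEquiv L p e).symm.toRingHom (contractExponents τ L _ _)
  rw [← map_iterateFrobenius_expand, map_expand,
    contractExponents_expand_mul (pow_ne_zero e hp.out.ne_zero), map_mul, map_map, hcomp, map_id]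

theorem constantCoeff_frobeniusSplitting (e : ℕ) (f : MvPolynomial τ L) :
    constantCoeff (frobeniusSplitting p τ L e f) =
      (iterateFrobeniusEquiv L p e).symm (constantCoeff f) := by
  change constantCoeff (map (iterateFrobeniusEquiv L p e).symm.toRingHom
    (contractExponents τ L _ _)) = _
  rw [constantCoeff_map, constantCoeff_contractExponents (pow_ne_zero e hp.out.ne_zero)]
  rfl

end Contraction

section ConstantTerm

open MvPolynomial

variable (k L : Type*) [Field k] [Field L] [Algebra k L]

/-- The polynomials in two variables over `L` whose constant term lies in `k`. -/
noncomputable def constantTermSubalgebra : Subalgebra k (MvPolynomial (Fin 2) L) :=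
  (⊥ : Subalgebra k L).comap ((aeval 0 : MvPolynomial (Fin 2) L →ₐ[L] L).restrictScalars k)

variable {k L}

theorem mem_constantTermSubalgebra {f : MvPolynomial (Fin 2) L} :
    f ∈ constantTermSubalgebra k L ↔ ∃ c, algebraMap k L c = constantCoeff f := by
  rw [constantTermSubalgebra, Subalgebra.mem_comap, Algebra.mem_bot]
  simp [aeval_zero]

theorem mem_constantTermSubalgebra_of_constantCoeff_eq_zero {f : MvPolynomial (Fin 2) L}
    (hf : constantCoeff f = 0) : f ∈ constantTermSubalgebra k L :=
  mem_constantTermSubalgebra.mpr ⟨0, by rw [hf, map_zero]⟩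

variable (k L) in
/-- The constant term, as an element of the small field. -/
noncomputable def constantTerm : constantTermSubalgebra k L →ₐ[k] k :=
  (Algebra.botEquiv k L : (⊥ : Subalgebra k L) →ₐ[k] k).comp
    (((aeval 0 : MvPolynomial (Fin 2) L →ₐ[L] L).restrictScalars k |>.comp
      (constantTermSubalgebra k L).val).codRestrict ⊥ fun f => f.2)

@[simp] theorem algebraMap_constantTerm (f : constantTermSubalgebra k L) :
    algebraMap k L (constantTerm k L f) = constantCoeff (f : MvPolynomial (Fin 2) L) := by
  have h : ∀ x : (⊥ : Subalgebra k L), algebraMap k L (Algebra.botEquiv k L x) = x := by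
    intro x
    conv_rhs => rw [← (Algebra.botEquiv k L).symm_apply_apply x, Algebra.botEquiv_symm_apply]
    rfl
  refine (h _).trans ?_
  change aeval (0 : Fin 2 → L) (f : MvPolynomial (Fin 2) L) = _
  rw [aeval_zero, Algebra.algebraMap_self, RingHom.id_apply]

theorem constantTerm_eq_zero_iff {f : constantTermSubalgebra k L} :
    constantTerm k L f = 0 ↔ constantCoeff (f : MvPolynomial (Fin 2) L) = 0 := by
  rw [← algebraMap_constantTerm, map_eq_zero (algebraMap k L)]

instance finiteType_constantTermSubalgebra [FiniteDimensional k L] :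
    Algebra.FiniteType k (constantTermSubalgebra k L) := by
  have : Algebra.FiniteType k (MvPolynomial (Fin 2) L) :=
    .trans (S := L) inferInstance inferInstance
  refine ⟨fg_of_fg_of_fg k (constantTermSubalgebra k L) (MvPolynomial (Fin 2) L) this.1 ?_
    Subtype.val_injective⟩
  obtain ⟨t, ht⟩ := Module.Finite.fg_top (R := k) (M := L)
  have hC : ∀ c : L, C c ∈ Submodule.span (constantTermSubalgebra k L)
      (insert 1 (C '' (t : Set L)) : Set (MvPolynomial (Fin 2) L)) := by
    intro c
    have hc : c ∈ Submodule.span k (t : Set L) := ht ▸ trivial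
    induction hc using Submodule.span_induction with
    | mem c hc => exact Submodule.subset_span (Set.mem_insert_of_mem _ ⟨c, hc, rfl⟩)
    | zero => simp
    | add c d _ _ hc hd => rw [map_add]; exact add_mem hc hd
    | smul a c _ hc =>
      have := Submodule.smul_mem _ (algebraMap k (constantTermSubalgebra k L) a) hc
      rw [Algebra.smul_def, map_mul]
      exact this
  refine Submodule.fg_def.mpr ⟨_, (t.finite_toSet.image C).insert 1, eq_top_iff.mpr fun f _ => ?_⟩
  have hf : f - C (constantCoeff f) ∈ constantTermSubalgebra k L :=
    mem_constantTermSubalgebra_of_constantCoeff_eq_zero (by simp)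
  rw [← sub_add_cancel f (C (constantCoeff f))]
  refine add_mem ?_ (hC _)
  have := Submodule.smul_mem _ (⟨_, hf⟩ : constantTermSubalgebra k L)
    (Submodule.subset_span (R := constantTermSubalgebra k L)
      (Set.mem_insert (1 : MvPolynomial (Fin 2) L) (C '' (t : Set L))))
  rwa [Subalgebra.smul_def, smul_eq_mul, mul_one] at this

theorem two_le_height_ker_constantTerm : 2 ≤ (RingHom.ker (constantTerm k L)).height := by
  let φ : constantTermSubalgebra k L →+* Polynomial L :=
    (aeval ![0, Polynomial.X] : MvPolynomial (Fin 2) L →ₐ[L] Polynomial L).toRingHom.comp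
      (constantTermSubalgebra k L).val.toRingHom
  have hφ : ∀ f : constantTermSubalgebra k L,
      (φ f).eval 0 = constantCoeff (f : MvPolynomial (Fin 2) L) := by
    have h : (Polynomial.aeval (0 : L)).comp
        (aeval ![0, Polynomial.X] : MvPolynomial (Fin 2) L →ₐ[L] Polynomial L) = aeval 0 := by
      ext i
      fin_cases i <;> simp
    intro f
    have := DFunLike.congr_fun h (f : MvPolynomial (Fin 2) L)
    rw [aeval_zero] at this
    exact this
  let x (i : Fin 2) : constantTermSubalgebra k L :=
    ⟨X i, mem_constantTermSubalgebra_of_constantCoeff_eq_zero (by simp)⟩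
  have hx₀ : φ (x 0) = 0 := by simp [φ, x]
  have hx₁ : φ (x 1) = Polynomial.X := by simp [φ, x]
  have hbot : (⊥ : Ideal (constantTermSubalgebra k L)) < RingHom.ker φ := by
    rw [bot_lt_iff_ne_bot, Submodule.ne_bot_iff]
    exact ⟨x 0, hx₀, fun h => X_ne_zero (R := L) (0 : Fin 2) (congrArg Subtype.val h)⟩
  have hlt : RingHom.ker φ < RingHom.ker (constantTerm k L) := by
    refine lt_of_le_of_ne (fun f hf => ?_) fun h => ?_
    · rw [RingHom.mem_ker] at hf ⊢
      rw [constantTerm_eq_zero_iff, ← hφ, hf, Polynomial.eval_zero]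
    · have : x 1 ∈ RingHom.ker φ := by
        rw [h, RingHom.mem_ker, constantTerm_eq_zero_iff]
        simp [x]
      rw [RingHom.mem_ker, hx₁] at this
      exact Polynomial.X_ne_zero this
  have : (RingHom.ker φ).IsPrime := RingHom.ker_isPrime φ
  calc (2 : ℕ∞) = (⊥ : Ideal (constantTermSubalgebra k L)).height + 1 + 1 := by
        rw [Ideal.height_bot]; norm_num
    _ ≤ (RingHom.ker φ).height + 1 := by
        gcongr
        exact Ideal.height_add_one_le_of_lt_of_isPrime hbot
    _ ≤ _ := Ideal.height_add_one_le_of_lt_of_isPrime hlt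

/-- Removing the constant term and multiplying by a scalar. -/
noncomputable def scaleAugmentation (a : L) :
    constantTermSubalgebra k L →ₗ[k] constantTermSubalgebra k L where
  toFun f := ⟨C a * ((f - algebraMap k _ (constantTerm k L f) :
      constantTermSubalgebra k L) : MvPolynomial (Fin 2) L),
    mem_constantTermSubalgebra_of_constantCoeff_eq_zero (by
      rw [map_mul, ← algebraMap_constantTerm, map_sub, AlgHom.commutes]
      simp)⟩
  map_add' f g := Subtype.ext (by
    simp only [map_add, AddMemClass.coe_add, AddSubgroupClass.coe_sub]
    ring)
  map_smul' c f := Subtype.ext (by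
    simp only [map_mul, RingHom.id_apply, Algebra.smul_def, AlgHom.commutes,
      MulMemClass.coe_mul, AddSubgroupClass.coe_sub, Algebra.algebraMap_self]
    ring)

theorem coe_scaleAugmentation (a : L) (f : constantTermSubalgebra k L) :
    (scaleAugmentation a f : MvPolynomial (Fin 2) L) =
      C a * ((f - algebraMap k _ (constantTerm k L f) : constantTermSubalgebra k L) :
        MvPolynomial (Fin 2) L) := rfl

theorem scaleAugmentation_mul (a : L) (f g : constantTermSubalgebra k L) :
    scaleAugmentation a f * (g - algebraMap k _ (constantTerm k L g)) =
      (f - algebraMap k _ (constantTerm k L f)) * scaleAugmentation a g := by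
  apply Subtype.ext
  rw [MulMemClass.coe_mul, MulMemClass.coe_mul, coe_scaleAugmentation, coe_scaleAugmentation]
  ring

theorem constantTerm_eq_zero_of_mul_scaleAugmentation {a : L} (ha : a ∉ (algebraMap k L).range)
    {x : constantTermSubalgebra k L} (hx : constantTerm k L x = 0) (hx₀ : x ≠ 0)
    (d n : constantTermSubalgebra k L) (h : d * scaleAugmentation a x = n * x) :
    constantTerm k L d = 0 := by
  by_contra hd
  have h' := congrArg Subtype.val h
  rw [MulMemClass.coe_mul, MulMemClass.coe_mul, coe_scaleAugmentation, hx, map_zero, sub_zero,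
    ← mul_assoc] at h'
  have h₁ := congrArg constantCoeff (mul_right_cancel₀ (fun h => hx₀ (Subtype.ext h)) h')
  rw [map_mul, constantCoeff_C, ← algebraMap_constantTerm, ← algebraMap_constantTerm] at h₁
  refine ha ⟨constantTerm k L n / constantTerm k L d, ?_⟩
  rw [map_div₀, ← h₁, mul_div_cancel_left₀]
  rwa [Ne, map_eq_zero]

/-- The restriction of `frobeniusSplitting` to the polynomials with constant term in the prime
field. -/
theorem exists_frobeniusSplitting_constantTermSubalgebra (p : ℕ) [hp : Fact p.Prime] (L : Type*)
    [Field L] [Algebra (ZMod p) L] [CharP L p] [PerfectRing L p] (e : ℕ) :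
    ∃ Φ : constantTermSubalgebra (ZMod p) L →ₗ[ZMod p] constantTermSubalgebra (ZMod p) L,
      (∀ a b, Φ (a ^ p ^ e * b) = a * Φ b) ∧
        ∀ s, constantTerm (ZMod p) L (Φ s) = constantTerm (ZMod p) L s := by
  have hcoeff : ∀ f : constantTermSubalgebra (ZMod p) L,
      constantCoeff (frobeniusSplitting p (Fin 2) L e f) =
        algebraMap (ZMod p) L (constantTerm (ZMod p) L f) := by
    intro f
    rw [constantCoeff_frobeniusSplitting, ← algebraMap_constantTerm, RingEquiv.symm_apply_eq,
      iterateFrobeniusEquiv_def, ← map_pow, ZMod.pow_card_pow]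
  refine ⟨AddMonoidHom.toZModLinearMap p
    { toFun f := ⟨frobeniusSplitting p (Fin 2) L e f,
        mem_constantTermSubalgebra.mpr ⟨_, (hcoeff f).symm⟩⟩
      map_zero' := Subtype.ext (map_zero _)
      map_add' f g := Subtype.ext (map_add _ _ _) }, fun a b => Subtype.ext ?_, fun s => ?_⟩
  · exact frobeniusSplitting_pow_mul p e (a : MvPolynomial (Fin 2) L) b
  · apply (algebraMap (ZMod p) L).injective
    exact (algebraMap_constantTerm _).trans (hcoeff s)

end ConstantTerm

theorem exists_notMem_range_algebraMap_galoisField :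
    ∃ a : GaloisField 2 2, a ∉ (algebraMap (ZMod 2) (GaloisField 2 2)).range := by
  by_contra! h
  have hsurj : Function.Surjective (algebraMap (ZMod 2) (GaloisField 2 2)) := h
  have hcard := Nat.card_le_card_of_surjective _ hsurj
  rw [GaloisField.card 2 2 two_ne_zero, Nat.card_zmod] at hcard
  norm_num at hcard

instance countable_mvPolynomial {τ R : Type*} [CommSemiring R] [Countable R] [Countable τ] :
    Countable (MvPolynomial τ R) := by
  rw [← Cardinal.mk_le_aleph0_iff]
  refine MvPolynomial.cardinalMk_le_max_lift.trans (max_le (max_le ?_ ?_) le_rfl) <;> simp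

/-- There exists a weakly F-regular local unique factorization domain which
is not Cohen–Macaulay. -/
theorem exists_weaklyFRegular_local_UFD_not_cohenMacaulay :
    ∃ (A : Type) (_ : CommRing A) (_ : IsDomain A) (_ : IsLocalRing A) (p : ℕ),
      p.Prime ∧ CharP A p ∧ IsNoetherianRing A ∧ UniqueFactorizationMonoid A ∧
      WeaklyFRegular A p ∧ ¬ IsCohenMacaulayLocal A := by
  obtain ⟨a, ha⟩ := exists_notMem_range_algebraMap_galoisField
  let k := ZMod 2
  let L := GaloisField 2 2
  let S := constantTermSubalgebra k L
  let ε : S →ₐ[k] k := constantTerm k L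
  have : PerfectRing L 2 := inferInstance
  have : Countable S := inferInstance
  obtain ⟨σ, hσ, hσ₀⟩ := exists_algebraicIndependent_powerSeries k S
  let ρ (i : Option S) : S := i.elim 0 fun s => s - algebraMap k S (ε s)
  have hρ₀ : ρ none = 0 := rfl
  have hερ : ∀ i, ε (ρ i) = 0 := by
    rintro (_ | s)
    · exact map_zero ε
    · change ε (s - algebraMap k S (ε s)) = 0
      rw [map_sub, AlgHom.commutes]
      exact sub_self _
  have hρ : ∀ s, ε s = 0 → ∃ i, ρ i = s := fun s hs =>
    ⟨some s, by change s - algebraMap k S (ε s) = s; rw [hs, map_zero, sub_zero]⟩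
  let A := shiftFractions ε σ ρ none
  have hX := localShift_X_mem_nonZeroDivisors (i₀ := none) ε hσ₀ hρ₀
  have hinj := injective_localEval_comp_localShift ε hσ hερ
  have hshift : Function.Injective (localShift ε σ ρ) :=
    Function.Injective.of_comp (f := localEval ε) hinj
  have : IsDomain A := isDomain_fractionSubring hX (localEval ε) hinj
  have : Module.FaithfullyFlat A (LocalPowerSeriesTensor ε) :=
    faithfullyFlat_shiftFractions ε hσ hσ₀ hρ₀ hρ
  have : IsNoetherianRing A := isNoetherianRing_of_faithfullyFlat A (LocalPowerSeriesTensor ε)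
  choose Φ hΦ hΦε using exists_frobeniusSplitting_constantTermSubalgebra 2 L
  refine ⟨A, inferInstance, inferInstance, inferInstance, 2, Nat.prime_two, ?_, inferInstance,
    uniqueFactorizationMonoid_fractionSubring hX hshift
      (isPrime_span_localShift_X ε hσ₀ hρ₀),
    weaklyFRegular_of_splitting ε Φ hΦ hΦε A
      fun f hf h₀ => eq_zero_of_mem_fractionSubring hX (localEval ε) hinj hf h₀, ?_⟩
  · rw [CharP.charP_iff_prime_eq_zero Nat.prime_two]
    apply Subtype.ext
    have : ((2 : ℕ) : MvPolynomial (Option S) k) = 0 := CharP.cast_eq_zero _ 2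
    have := congrArg (localShift ε σ ρ) this
    rwa [map_natCast, map_zero] at this
  · have hx : MvPolynomial.constantCoeff (MvPolynomial.X 0 : MvPolynomial (Fin 2) L) = 0 :=
      MvPolynomial.constantCoeff_X ..
    refine not_isCohenMacaulayLocal_shiftFractions ε hσ hσ₀ hρ₀ hρ (scaleAugmentation_mul a)
      (x := ⟨MvPolynomial.X 0, mem_constantTermSubalgebra_of_constantCoeff_eq_zero hx⟩)
      (constantTerm_eq_zero_iff.mpr hx)
      (constantTerm_eq_zero_of_mul_scaleAugmentation ha (constantTerm_eq_zero_iff.mpr hx)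
        fun h => MvPolynomial.X_ne_zero (R := L) (0 : Fin 2) (congrArg Subtype.val h))
      two_le_height_ker_constantTerm
end
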